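/- arXiv:1409.7983 — 2 statements merged into one kernel-verified Lean document; each statement's English description precedes it below -/
import Mathlib

section
/- Let S_{k_1×k_2×⋯×k_m} be a caterpillar with all k_i ≥ 2, and suppose the pair (k_j, k_{j+1}) attains the minimum of max(k_i, k_{i+1}) over all adjacent pairs 1 ≤ i ≤ m−1. Write m = 2^a + b with 2 ≤ b ≤ 2^a. If b−1 < j < 2^a and max(k_j, k_{j+1}) ≥ ⌊log_2 m⌋, then for all sufficiently large n, sat(Q_n, S_{k_1×k_2×⋯×k_m}) ≤ max(k_j, k_{j+1}) · 2^(n−1). -/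
open SimpleGraph

/-- The hypercube graph `Q_n` on vertex set `{0,1}^n`: two vertices are adjacent
iff they differ in exactly one coordinate. -/
def hypercube (n : ℕ) : SimpleGraph (Fin n → Bool) :=
  SimpleGraph.fromRel (fun u v => hammingDist u v = 1)

/-- `HasCopy H G` means `H` contains a subgraph isomorphic to `G`. -/
def HasCopy {V W : Type*} (H : SimpleGraph V) (G : SimpleGraph W) : Prop :=
  ∃ f : G →g H, Function.Injective f

/-- `IsSat Host H G`: `H` is an `(Host, G)`-saturated subgraph of `Host`. -/
def IsSat {V W : Type*} (Host H : SimpleGraph V) (G : SimpleGraph W) : Prop :=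
  H ≤ Host ∧ ¬ HasCopy H G ∧
    ∀ u v : V, Host.Adj u v → ¬ H.Adj u v →
      HasCopy (H ⊔ SimpleGraph.fromEdgeSet {s(u, v)}) G

/-- The saturation number `sat(Host, G)`. -/
noncomputable def satNum {V W : Type*} (Host : SimpleGraph V) (G : SimpleGraph W) : ℕ :=
  sInf { m | ∃ H : SimpleGraph V, IsSat Host H G ∧ H.edgeSet.ncard = m }

/-- Number of spine-neighbors of the `i`-th spine vertex (0-based) of a
caterpillar with `m` spine vertices. -/
def spineExtra (m i : ℕ) : ℕ := (if i = 0 then 0 else 1) + (if i = m - 1 then 0 else 1)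

/-- The caterpillar `S_{k 0 × k 1 × ⋯ × k (m-1)}`: the vertices of degree `> 1`
form a path of `m` vertices (the spine) whose `i`-th vertex has degree `k i`;
all other vertices are leaves attached to the spine. -/
def caterpillar (m : ℕ) (k : ℕ → ℕ) :
    SimpleGraph (Fin m ⊕ Σ i : Fin m, Fin (k (i : ℕ) - spineExtra m (i : ℕ))) :=
  SimpleGraph.fromRel (fun u v =>
    match u, v with
    | Sum.inl a, Sum.inl b => (a : ℕ) + 1 = (b : ℕ)
    | Sum.inl a, Sum.inr p => a = p.1
    | _, _ => False)


namespace CubeSat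

section Flip

variable {ι : Type*} [DecidableEq ι]

/-- Flip the `i`-th coordinate of a Boolean vector. -/
def flip (u : ι → Bool) (i : ι) : ι → Bool := Function.update u i (!u i)

@[simp] lemma flip_self (u : ι → Bool) (i : ι) : flip u i i = !u i := by simp [flip]

lemma flip_of_ne (u : ι → Bool) {i q : ι} (h : q ≠ i) : flip u i q = u q := by simp [flip, h]

@[simp] lemma flip_flip (u : ι → Bool) (i : ι) : flip (flip u i) i = u := by simp [flip]

lemma flip_injective (u : ι → Bool) : Function.Injective (flip u) := by
  intro i i' h
  by_contra hne
  have := congrFun h i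
  rw [flip_self, flip_of_ne u hne] at this
  simp at this

lemma flip_ne (u : ι → Bool) (i : ι) : flip u i ≠ u := by
  intro h
  have := congrFun h i
  simp at this

lemma flip_left_cancel {u v : ι → Bool} {i : ι} (h : flip u i = flip v i) : u = v := by
  rw [← flip_flip u i, h, flip_flip]

lemma hypercube_adj {n : ℕ} {u v : Fin n → Bool} :
    (hypercube n).Adj u v ↔ ∃ i, v = flip u i := by
  have key : hammingDist u v = 1 ↔ ∃ i, v = flip u i := by
    unfold hammingDist
    rw [Finset.card_eq_one]
    constructor
    · rintro ⟨i, hi⟩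
      refine ⟨i, funext fun q => ?_⟩
      have hq := Finset.ext_iff.1 hi q
      simp only [Finset.mem_filter, Finset.mem_univ, true_and, Finset.mem_singleton] at hq
      by_cases h : q = i
      · subst h
        have : u q ≠ v q := hq.2 rfl
        rw [flip_self]
        cases hu : u q <;> cases hv : v q <;> simp_all
      · rw [flip_of_ne u h]
        by_contra hne
        exact h (hq.1 fun e => hne e.symm)
    · rintro ⟨i, rfl⟩
      refine ⟨i, ?_⟩
      ext q
      by_cases h : q = i
      · subst h; simp
      · simp [flip_of_ne u h, h]
  unfold hypercube
  rw [SimpleGraph.fromRel_adj, hammingDist_comm v u, or_self, key]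
  constructor
  · exact fun h => h.2
  · rintro ⟨i, rfl⟩
    exact ⟨(flip_ne u i).symm, i, rfl⟩

/-- The sum of the weights of the coordinates where `u` is `true`. -/
def weight [Fintype ι] {A : Type*} [AddCommGroup A] (w : ι → A) (u : ι → Bool) : A :=
  ∑ i, if u i then w i else 0

lemma weight_flip [Fintype ι] {A : Type*} [AddCommGroup A] (two : ∀ x : A, x + x = 0) (w : ι → A)
    (u : ι → Bool) (i : ι) : weight w (flip u i) = weight w u + w i := by
  unfold weight
  rw [← Finset.add_sum_erase _ _ (Finset.mem_univ i),
    ← Finset.add_sum_erase (a := i) _ (fun q => if u q then w q else 0) (Finset.mem_univ i)]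
  have : ∑ q ∈ Finset.univ.erase i, (if flip u i q then w q else 0)
      = ∑ q ∈ Finset.univ.erase i, (if u q then w q else 0) := by
    refine Finset.sum_congr rfl fun q hq => ?_
    rw [flip_of_ne u (Finset.ne_of_mem_erase hq)]
  rw [this, flip_self]
  cases u i
  · simp [add_comm]
  · simp only [Bool.not_true, Bool.false_eq_true, if_false, if_true]
    rw [add_right_comm, two]

lemma card_le_of_agree_off (S : Finset ι) (w : ι → Bool) (F : Finset (ι → Bool))
    (h : ∀ x ∈ F, ∀ q, q ∉ S → x q = w q) : F.card ≤ 2 ^ S.card := by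
  rw [← Finset.card_powerset]
  refine Finset.card_le_card_of_injOn (fun x => S.filter fun q => x q = true) ?_ ?_
  · intro x _
    exact Finset.mem_powerset.2 (Finset.filter_subset _ _)
  · intro x hx y hy hxy
    funext q
    by_cases hq : q ∈ S
    · have := Finset.ext_iff.1 hxy q
      simp only [Finset.mem_filter, hq, true_and] at this
      exact Bool.eq_iff_iff.2 this
    · rw [h x hx q hq, h y hy q hq]

/-- Gray code: a Hamiltonian path with prescribed start in the subcube through `w` spanned by the
directions in `S`. -/
lemma exists_gray (S : Finset ι) : ∀ w : ι → Bool, ∃ P : ℕ → ι → Bool, P 0 = w ∧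
    (∀ s, s + 1 < 2 ^ S.card → ∃ i ∈ S, P (s + 1) = flip (P s) i) ∧
    (∀ s, s < 2 ^ S.card → ∀ t, t < 2 ^ S.card → P s = P t → s = t) ∧
    ∀ s q, q ∉ S → P s q = w q := by
  induction S using Finset.induction_on with
  | empty =>
    intro w
    refine ⟨fun _ => w, rfl, ?_, ?_, fun _ _ _ => rfl⟩
    · intro s hs; simp at hs
    · intro s hs t ht _
      simp at hs ht
      omega
  | insert i S hi ih =>
    intro w
    obtain ⟨P, hP0, hPadj, hPinj, hPoff⟩ := ih w
    obtain ⟨R, hR0, hRadj, hRinj, hRoff⟩ := ih (flip (P (2 ^ S.card - 1)) i)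
    have hpos : 0 < 2 ^ S.card := by positivity
    rw [Finset.card_insert_of_notMem hi, pow_succ]
    have hPi : ∀ s, P s i = w i := fun s => hPoff s i hi
    have hRi : ∀ s, R s i = !w i := fun s => by rw [hRoff s i hi, flip_self, hPi]
    refine ⟨fun s => if s < 2 ^ S.card then P s else R (s - 2 ^ S.card), ?_, ?_, ?_, ?_⟩
    · simp [hP0]
    · intro s hs
      rcases lt_trichotomy (s + 1) (2 ^ S.card) with h | h | h
      · obtain ⟨q, hq, e⟩ := hPadj s h
        refine ⟨q, Finset.mem_insert_of_mem hq, ?_⟩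
        simp only [h, if_true, (by omega : s < 2 ^ S.card), e]
      · refine ⟨i, Finset.mem_insert_self _ _, ?_⟩
        simp only [h, lt_irrefl, if_false, (by omega : s < 2 ^ S.card), if_true, Nat.sub_self, hR0]
        rw [(by omega : 2 ^ S.card - 1 = s)]
      · obtain ⟨q, hq, e⟩ := hRadj (s - 2 ^ S.card) (by omega)
        refine ⟨q, Finset.mem_insert_of_mem hq, ?_⟩
        have h1 : ¬ s + 1 < 2 ^ S.card := by omega
        have h2 : ¬ s < 2 ^ S.card := by omega
        simp only [h1, h2, if_false]
        rw [← e, (by omega : s + 1 - 2 ^ S.card = s - 2 ^ S.card + 1)]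
    · intro s hs t ht h
      by_cases h1 : s < 2 ^ S.card <;> by_cases h2 : t < 2 ^ S.card <;>
        simp only [h1, h2, if_true, if_false] at h
      · exact hPinj s h1 t h2 h
      · have := congrFun h i
        rw [hPi, hRi] at this
        simp at this
      · have := congrFun h i
        rw [hPi, hRi] at this
        simp at this
      · have := hRinj _ (by omega) _ (by omega) h
        omega
    · intro s q hq
      rw [Finset.mem_insert, not_or] at hq
      by_cases h1 : s < 2 ^ S.card <;> simp only [h1, if_true, if_false]
      · exact hPoff s q hq.2
      · rw [hRoff _ q hq.2, flip_of_ne _ hq.1, hPoff _ q hq.2]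

end Flip

section Caterpillar

variable {V : Type*}

/-- `G` contains a spine `g` together with pairwise disjoint sets `N t` of candidate leaves that are
large enough for a copy of `caterpillar m k`. -/
def Spans (G : SimpleGraph V) (m : ℕ) (k : ℕ → ℕ) : Prop :=
  ∃ (g : ℕ → V) (N : ℕ → Finset V),
    (∀ s < m, ∀ t < m, g s = g t → s = t) ∧
    (∀ t, t + 1 < m → G.Adj (g t) (g (t + 1))) ∧
    (∀ t < m, k t - spineExtra m t ≤ (N t).card) ∧
    (∀ t < m, ∀ x ∈ N t, G.Adj (g t) x) ∧
    (∀ s < m, ∀ t < m, g s ∉ N t) ∧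
    ∀ s < m, ∀ t < m, s ≠ t → Disjoint (N s) (N t)

lemma Spans.hasCopy {G : SimpleGraph V} {m : ℕ} {k : ℕ → ℕ} (h : Spans G m k) :
    HasCopy G (caterpillar m k) := by
  obtain ⟨g, N, hg, hadj, hcard, hNadj, hNg, hNN⟩ := h
  have hex : ∀ t : Fin m, ∃ l : Fin (k t - spineExtra m t) → V,
      Function.Injective l ∧ ∀ x, l x ∈ N t := by
    intro t
    obtain ⟨F, hF, hFc⟩ := Finset.exists_subset_card_eq (hcard t t.2)
    let e := F.equivFinOfCardEq hFc
    exact ⟨fun x => (e.symm x : V), fun x y h => e.symm.injective (Subtype.ext h),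
      fun x => hF (e.symm x).2⟩
  choose l hl hlN using hex
  refine ⟨⟨Sum.elim (fun t => g t) (fun p => l p.1 p.2), ?_⟩, ?_⟩
  · have key : ∀ u v : Fin m ⊕ Σ i : Fin m, Fin (k (i : ℕ) - spineExtra m (i : ℕ)),
        (match u, v with
        | Sum.inl a, Sum.inl b => (a : ℕ) + 1 = (b : ℕ)
        | Sum.inl a, Sum.inr p => a = p.1
        | _, _ => False) →
        G.Adj (Sum.elim (fun t : Fin m => g t) (fun p => l p.1 p.2) u)
          (Sum.elim (fun t : Fin m => g t) (fun p => l p.1 p.2) v) := by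
      rintro (s | p) (t | q) h
      · simp only at h
        simp only [Sum.elim_inl]
        rw [← h]
        exact hadj s (h ▸ t.2)
      · simp only at h
        subst h
        exact hNadj _ q.1.2 _ (hlN _ _)
      · exact h.elim
      · exact h.elim
    intro u v h
    unfold caterpillar at h
    rw [SimpleGraph.fromRel_adj] at h
    rcases h.2 with h | h
    · exact key u v h
    · exact (key v u h).symm
  · rintro (s | p) (t | q) h
    · exact congrArg Sum.inl (Fin.ext (hg s s.2 t t.2 h))
    · exact (hNg s s.2 q.1 q.1.2 (by
        have h' : g s = l q.1 q.2 := h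
        rw [h']; exact hlN _ _)).elim
    · exact (hNg t t.2 p.1 p.1.2 (by
        have h' : l p.1 p.2 = g t := h
        rw [← h']; exact hlN _ _)).elim
    · obtain ⟨s, x⟩ := p
      obtain ⟨t, y⟩ := q
      have h' : l s x = l t y := h
      by_cases hst : s = t
      · subst hst
        rw [hl s h']
      · exact (Finset.disjoint_left.1 (hNN s s.2 t t.2 fun e => hst (Fin.ext e)) (hlN s x)
          (h' ▸ hlN t y)).elim

lemma spineExtra_reverse {m t : ℕ} (ht : t < m) :
    spineExtra m (m - 1 - t) = spineExtra m t := by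
  unfold spineExtra
  split_ifs <;> omega

lemma Spans.reverse {G : SimpleGraph V} {m : ℕ} {k : ℕ → ℕ}
    (h : Spans G m fun t => k (m - 1 - t)) : Spans G m k := by
  obtain ⟨g, N, hg, hadj, hcard, hNadj, hNg, hNN⟩ := h
  refine ⟨fun t => g (m - 1 - t), fun t => N (m - 1 - t), ?_, ?_, ?_, ?_, ?_, ?_⟩
  · intro s hs t ht h
    have := hg _ (by omega) _ (by omega) h
    omega
  · intro t ht
    have := hadj (m - 1 - (t + 1)) (by omega)
    rw [(by omega : m - 1 - (t + 1) + 1 = m - 1 - t)] at this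
    exact this.symm
  · intro t ht
    have := hcard (m - 1 - t) (by omega)
    beta_reduce at this
    rwa [spineExtra_reverse ht, (by omega : m - 1 - (m - 1 - t) = t)] at this
  · exact fun t ht => hNadj _ (by omega)
  · exact fun s hs t ht => hNg _ (by omega) _ (by omega)
  · exact fun s hs t ht h => hNN _ (by omega) _ (by omega) (by omega)

lemma exists_spine_of_hasCopy {G : SimpleGraph V} {m : ℕ} {k : ℕ → ℕ} (hm : 0 < m)
    (hk : ∀ t < m, 2 ≤ k t) (h : HasCopy G (caterpillar m k)) :
    ∃ g : ℕ → V, (∀ s < m, ∀ t < m, g s = g t → s = t) ∧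
      (∀ t, t + 1 < m → G.Adj (g t) (g (t + 1))) ∧
      ∀ t < m, ∃ N : Finset V, k t ≤ N.card ∧ ∀ x ∈ N, G.Adj (g t) x := by
  obtain ⟨f, hf⟩ := h
  have hspine : ∀ s t (hs : s < m) (ht : t < m), s + 1 = t →
      (caterpillar m k).Adj (Sum.inl ⟨s, hs⟩) (Sum.inl ⟨t, ht⟩) := by
    intro s t hs ht hst
    unfold caterpillar
    rw [SimpleGraph.fromRel_adj]
    refine ⟨fun e => ?_, Or.inl hst⟩
    have := congrArg Fin.val (Sum.inl_injective e)
    simp only at this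
    omega
  refine ⟨fun t => if ht : t < m then f (Sum.inl ⟨t, ht⟩) else f (Sum.inl ⟨0, hm⟩), ?_, ?_, ?_⟩
  · intro s hs t ht h
    simp only [hs, ht, dite_true] at h
    simpa using hf h
  · intro t ht
    simp only [ht, (by omega : t < m), dite_true]
    exact f.map_adj (hspine _ _ _ _ rfl)
  · intro t ht
    simp only [ht, dite_true]
    let L : Finset (Fin m ⊕ Σ i : Fin m, Fin (k (i : ℕ) - spineExtra m (i : ℕ))) :=
      (Finset.univ : Finset (Fin (k t - spineExtra m t))).map
        ⟨fun x => Sum.inr ⟨⟨t, ht⟩, x⟩, fun x y h => by simpa using h⟩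
    let B : Finset (Fin m) := Finset.univ.filter fun s => (s : ℕ) + 1 = t ∨ t + 1 = (s : ℕ)
    have hB : spineExtra m t ≤ B.card := by
      have h1 : t ≠ 0 → (⟨t - 1, by omega⟩ : Fin m) ∈ B := by
        intro h; simp only [B, Finset.mem_filter, Finset.mem_univ, true_and]; omega
      have h2 : ∀ h : t ≠ m - 1, (⟨t + 1, by omega⟩ : Fin m) ∈ B := by
        intro h; simp [B]
      unfold spineExtra
      split_ifs with ht0 htm htm
      · simp
      · exact Finset.card_pos.2 ⟨_, h2 htm⟩
      · exact Finset.card_pos.2 ⟨_, h1 ht0⟩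
      · exact Finset.one_lt_card.2 ⟨_, h1 ht0, _, h2 htm, by simp [Fin.ext_iff]⟩
    refine ⟨((B.map ⟨Sum.inl, Sum.inl_injective⟩) ∪ L).map ⟨f, hf⟩, ?_, ?_⟩
    · rw [Finset.card_map, Finset.card_union_of_disjoint]
      · have := hk t ht
        simp only [Finset.card_map, L, Finset.card_univ, Fintype.card_fin]
        omega
      · rw [Finset.disjoint_left]
        intro x hx hx'
        simp only [L, Finset.mem_map, Function.Embedding.coeFn_mk] at hx hx'
        obtain ⟨s, _, rfl⟩ := hx
        obtain ⟨y, _, hy⟩ := hx'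
        exact Sum.inr_ne_inl hy
    · intro x hx
      rw [Finset.mem_map] at hx
      obtain ⟨y, hy, rfl⟩ := hx
      refine f.map_adj ?_
      rw [Finset.mem_union, Finset.mem_map, Finset.mem_map] at hy
      rcases hy with ⟨s, hs, rfl⟩ | ⟨x, _, rfl⟩
      · simp only [B, Finset.mem_filter, Finset.mem_univ, true_and] at hs
        rcases hs with hs | hs
        · exact (hspine _ _ s.2 ht hs).symm
        · exact hspine _ _ ht s.2 hs
      · unfold caterpillar
        rw [SimpleGraph.fromRel_adj]
        exact ⟨Sum.inl_ne_inr, Or.inl rfl⟩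

end Caterpillar

/-- The coordinates of the cube are labelled by a group `A` of exponent two; every nonzero label is
carried by (at least) two coordinates `coord p 0` and `coord p 1`. The zero-labelled coordinates
contain disjoint sets `S` (spanning the clusters) and `T ⊇ T'` (directions of edges far from the
clusters). -/
structure Scheme (ι A : Type*) [Fintype ι] [DecidableEq ι] [AddCommGroup A] where
  add_self : ∀ x : A, x + x = 0
  lab : ι → A
  coord : A → ZMod 2 → ι
  lab_coord : ∀ p ε, p ≠ 0 → lab (coord p ε) = p
  coord_injective : ∀ p, p ≠ 0 → Function.Injective (coord p)
  S : Finset ι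
  T : Finset ι
  T' : Finset ι
  lab_S : ∀ i ∈ S, lab i = 0
  lab_T : ∀ i ∈ T, lab i = 0
  disj : ∀ i ∈ T, i ∉ S
  sub : T' ⊆ T

namespace Scheme

variable {ι A : Type*} [Fintype ι] [DecidableEq ι] [AddCommGroup A]
  (c : Scheme ι A)

/-- The syndrome of a vertex; vertices of syndrome zero are the centres. -/
def syn (u : ι → Bool) : A := weight c.lab u

/-- The parity of a vertex in the directions of `S`. -/
def par (u : ι → Bool) : ZMod 2 := weight (fun i => if i ∈ c.S then 1 else 0) u

lemma syn_flip (u : ι → Bool) (i : ι) : c.syn (flip u i) = c.syn u + c.lab i :=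
  weight_flip c.add_self _ u i

lemma par_flip_mem (u : ι → Bool) {i : ι} (h : i ∈ c.S) : c.par (flip u i) = c.par u + 1 := by
  unfold par
  rw [weight_flip CharTwo.add_self_eq_zero, if_pos h]

lemma par_flip_notMem (u : ι → Bool) {i : ι} (h : i ∉ c.S) : c.par (flip u i) = c.par u := by
  unfold par
  rw [weight_flip CharTwo.add_self_eq_zero, if_neg h, add_zero]

lemma notMem_S {i : ι} (h : c.lab i ≠ 0) : i ∉ c.S := fun hi => h (c.lab_S i hi)

lemma add_eq_zero (c : Scheme ι A) {x y : A} : x + y = 0 ↔ x = y := by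
  constructor
  · intro h
    rw [← add_zero x, ← c.add_self y, ← add_assoc, h, zero_add]
  · rintro rfl
    exact c.add_self x

/-- The edge in direction `i` at `u` is selected. -/
def Edge (i : ι) (u : ι → Bool) : Prop :=
  (c.lab i ≠ 0 ∧ i = c.coord (c.lab i) (c.par u) ∧ (c.syn u = 0 ∨ c.syn u = c.lab i)) ∨
  (i ∈ c.S ∧ c.syn u = 0) ∨
  (c.syn u ≠ 0 ∧ (i ∈ c.T' ∨ (i ∈ c.T ∧ c.par u = 0)))

lemma edge_flip {i : ι} {u : ι → Bool} (h : c.Edge i u) : c.Edge i (flip u i) := by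
  rcases h with ⟨h1, h2, h3⟩ | ⟨h1, h2⟩ | ⟨h1, h2⟩
  · left
    rw [c.par_flip_notMem u (c.notMem_S h1), c.syn_flip]
    refine ⟨h1, h2, ?_⟩
    rcases h3 with h3 | h3
    · right; rw [h3, zero_add]
    · left; rw [h3, c.add_self]
  · right; left
    rw [c.syn_flip, h2, c.lab_S i h1, add_zero]
    exact ⟨h1, rfl⟩
  · right; right
    have hT : i ∈ c.T := h2.elim (fun h => c.sub h) fun h => h.1
    rw [c.syn_flip, c.lab_T i hT, add_zero, c.par_flip_notMem u (c.disj i hT)]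
    exact ⟨h1, h2⟩

/-- The graph of all selected edges. -/
def graph : SimpleGraph (ι → Bool) where
  Adj u v := ∃ i, v = flip u i ∧ c.Edge i u
  symm := ⟨by
    rintro u v ⟨i, rfl, h⟩
    exact ⟨i, (flip_flip u i).symm, c.edge_flip h⟩⟩
  loopless := ⟨by
    rintro u ⟨i, h, _⟩
    exact flip_ne u i h.symm⟩

/-- The centre to which a vertex of nonzero syndrome is attached. -/
def att (u : ι → Bool) : ι → Bool := flip u (c.coord (c.syn u) (c.par u))

open Classical in
/-- The vertex itself if it is a centre, else the centre to which it is attached. -/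
noncomputable def root (u : ι → Bool) : ι → Bool := if c.syn u = 0 then u else c.att u

lemma syn_att {u : ι → Bool} (h : c.syn u ≠ 0) : c.syn (c.att u) = 0 := by
  unfold att
  rw [c.syn_flip, c.lab_coord _ _ h, c.add_self]

lemma coord_notMem_S {p : A} (h : p ≠ 0) (ε : ZMod 2) : c.coord p ε ∉ c.S :=
  c.notMem_S (by rwa [c.lab_coord _ _ h])

lemma par_att {u : ι → Bool} (h : c.syn u ≠ 0) : c.par (c.att u) = c.par u :=
  c.par_flip_notMem u (c.coord_notMem_S h _)

lemma adj_att {u : ι → Bool} (h : c.syn u ≠ 0) : c.graph.Adj u (c.att u) := by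
  refine ⟨_, rfl, Or.inl ?_⟩
  rw [c.lab_coord _ _ h]
  exact ⟨h, rfl, Or.inr rfl⟩

lemma adj_coord {u : ι → Bool} (h : c.syn u = 0) {p : A} (hp : p ≠ 0) :
    c.graph.Adj u (flip u (c.coord p (c.par u))) := by
  refine ⟨_, rfl, Or.inl ?_⟩
  rw [c.lab_coord _ _ hp]
  exact ⟨hp, rfl, Or.inl h⟩

lemma eq_att_of_adj {u v : ι → Bool} (hu : c.syn u ≠ 0) (hv : c.syn v = 0)
    (h : c.graph.Adj u v) : v = c.att u := by
  obtain ⟨i, rfl, h⟩ := h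
  rw [c.syn_flip, c.add_eq_zero] at hv
  rcases h with ⟨h1, h2, h3⟩ | ⟨h1, h2⟩ | ⟨h1, h2⟩
  · unfold att
    rw [hv, ← h2]
  · exact (hu h2).elim
  · have hT : i ∈ c.T := h2.elim (fun h => c.sub h) fun h => h.1
    rw [c.lab_T i hT] at hv
    exact (hu hv).elim

lemma exists_mem_S_of_adj {u v : ι → Bool} (hu : c.syn u = 0) (hv : c.syn v = 0)
    (h : c.graph.Adj u v) : ∃ i ∈ c.S, v = flip u i := by
  obtain ⟨i, rfl, h⟩ := h
  rw [c.syn_flip, c.add_eq_zero, hu] at hv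
  rcases h with ⟨h1, h2, h3⟩ | ⟨h1, h2⟩ | ⟨h1, h2⟩
  · exact (h1 hv.symm).elim
  · exact ⟨i, h1, rfl⟩
  · exact (h1 hu).elim

lemma card_neighbors_le {u : ι → Bool} (hu : c.syn u ≠ 0) (N : Finset (ι → Bool))
    (hN : ∀ x ∈ N, c.graph.Adj u x) :
    N.card ≤ 1 + (if c.par u = 0 then c.T else c.T').card := by
  have hsub : N ⊆ insert (c.att u) ((if c.par u = 0 then c.T else c.T').image (flip u)) := by
    intro x hx
    rw [Finset.mem_insert, Finset.mem_image]
    by_cases hx0 : c.syn x = 0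
    · exact Or.inl (c.eq_att_of_adj hu hx0 (hN x hx))
    · right
      obtain ⟨i, rfl, h⟩ := hN x hx
      refine ⟨i, ?_, rfl⟩
      rcases h with ⟨h1, h2, h3⟩ | ⟨h1, h2⟩ | ⟨h1, h2⟩
      · rcases h3 with h3 | h3
        · exact (hu h3).elim
        · rw [c.syn_flip, h3, c.add_self] at hx0
          exact (hx0 rfl).elim
      · exact (hu h2).elim
      · split_ifs with hp
        · exact h2.elim (fun h => c.sub h) fun h => h.1
        · exact h2.elim id fun h => (hp h.2).elim
  calc N.card ≤ _ := Finset.card_le_card hsub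
    _ ≤ _ := Finset.card_insert_le _ _
    _ ≤ 1 + (if c.par u = 0 then c.T else c.T').card := by
      rw [add_comm]
      exact Nat.add_le_add_left Finset.card_image_le _

/-- A path of centres stays in one cluster, and its parity alternates. -/
lemma run_of_centres (g : ℕ → ι → Bool) {s e : ℕ}
    (hinj : ∀ x, s ≤ x → x ≤ e → ∀ y, s ≤ y → y ≤ e → g x = g y → x = y)
    (hadj : ∀ t, s ≤ t → t + 1 ≤ e → c.graph.Adj (g t) (g (t + 1)))
    (hsyn : ∀ t, s ≤ t → t ≤ e → c.syn (g t) = 0) :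
    e + 1 - s ≤ 2 ^ c.S.card ∧ ∀ t, s + t ≤ e → c.par (g (s + t)) = c.par (g s) + t := by
  have hstep : ∀ t, s ≤ t → t + 1 ≤ e → ∃ i ∈ c.S, g (t + 1) = flip (g t) i := fun t h1 h2 =>
    c.exists_mem_S_of_adj (hsyn t h1 (by omega)) (hsyn _ (by omega) h2) (hadj t h1 h2)
  constructor
  · have hoff : ∀ t, s + t ≤ e → ∀ q, q ∉ c.S → g (s + t) q = g s q := by
      intro t
      induction t with
      | zero => intros; rfl
      | succ t ih =>
        intro ht q hq
        obtain ⟨i, hi, h⟩ := hstep (s + t) (by omega) (by omega)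
        rw [← add_assoc, h, flip_of_ne _ (fun h' => hq (by rwa [h'])), ih (by omega) q hq]
    have := card_le_of_agree_off c.S (g s) ((Finset.Icc s e).image g) (by
      intro x hx q hq
      obtain ⟨t, ht, rfl⟩ := Finset.mem_image.1 hx
      rw [Finset.mem_Icc] at ht
      have := hoff (t - s) (by omega) q hq
      rwa [Nat.add_sub_cancel' ht.1] at this)
    rwa [Finset.card_image_of_injOn, Nat.card_Icc] at this
    intro x hx y hy h
    have hx' := Finset.mem_Icc.1 hx
    have hy' := Finset.mem_Icc.1 hy
    exact hinj x hx'.1 hx'.2 y hy'.1 hy'.2 h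
  · intro t
    induction t with
    | zero => simp
    | succ t ih =>
      intro ht
      obtain ⟨i, hi, h⟩ := hstep (s + t) (by omega) (by omega)
      rw [← add_assoc, h, c.par_flip_mem _ hi, ih (by omega)]
      push_cast
      ring

/-- `hA` describes the two possible shapes of the scheme: the second is needed when a spine with
low ends and all inner vertices in one cluster has to be excluded. -/
lemma not_hasCopy {m d a b : ℕ} {k : ℕ → ℕ} (hm : m = 2 ^ a + b) (hb : 2 ≤ b) (ha : 1 ≤ a)
    (hd : 2 ≤ d) (hk : ∀ t < m, 2 ≤ k t) (hmin : ∀ t, t + 1 < m → d ≤ max (k t) (k (t + 1)))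
    (hS : c.S.card = a) (hT : c.T.card = d - 2)
    (hT' : b = 2 → k 0 < d → k (m - 1) < d → c.T'.card = min (k 0) (k (m - 1)) - 2) :
    ¬ HasCopy c.graph (caterpillar m k) := by
  intro hcopy
  have hpow : 2 ≤ 2 ^ a := by
    calc 2 = 2 ^ 1 := rfl
      _ ≤ 2 ^ a := Nat.pow_le_pow_right (by norm_num) ha
  obtain ⟨g, hinj, hadj, hdeg⟩ := exists_spine_of_hasCopy (by omega) hk hcopy
  have hlow : ∀ t < m, c.syn (g t) ≠ 0 → k t < d := by
    intro t ht h
    obtain ⟨N, hN, hNadj⟩ := hdeg t ht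
    have h1 := c.card_neighbors_le h N hNadj
    have h2 : (if c.par (g t) = 0 then c.T else c.T').card ≤ c.T.card := by
      split_ifs
      · exact le_rfl
      · exact Finset.card_le_card c.sub
    omega
  have hlow' : ∀ t < m, c.syn (g t) ≠ 0 → c.par (g t) ≠ 0 → k t ≤ 1 + c.T'.card := by
    intro t ht h hp
    obtain ⟨N, hN, hNadj⟩ := hdeg t ht
    have h1 := c.card_neighbors_le h N hNadj
    rw [if_neg hp] at h1
    omega
  have hnext : ∀ t, t + 1 < m → c.syn (g t) ≠ 0 → c.syn (g (t + 1)) = 0 := by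
    intro t ht h
    by_contra h'
    have h1 := hlow t (by omega) h
    have h2 := hlow (t + 1) ht h'
    have h3 := hmin t ht
    omega
  have hinner : ∀ t, 1 ≤ t → t ≤ m - 2 → c.syn (g t) = 0 := by
    intro t h1 h2
    by_contra h
    have hr := c.eq_att_of_adj h (hnext t (by omega) h) (hadj t (by omega))
    have hprev : c.syn (g (t - 1)) = 0 := by
      by_contra h'
      have := hnext (t - 1) (by omega) h'
      rw [Nat.sub_add_cancel h1] at this
      exact h this
    have hl := hadj (t - 1) (by omega)
    rw [Nat.sub_add_cancel h1] at hl
    have hl := c.eq_att_of_adj h hprev hl.symm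
    have := hinj _ (by omega) _ (by omega) (hl.trans hr.symm)
    omega
  have hrun : ∀ s e, e < m → (∀ t, s ≤ t → t ≤ e → c.syn (g t) = 0) →
      e + 1 - s ≤ 2 ^ c.S.card ∧ ∀ t, s + t ≤ e → c.par (g (s + t)) = c.par (g s) + t :=
    fun s e he h => c.run_of_centres g
      (fun x _ hx y _ hy => hinj x (by omega) y (by omega))
      (fun t _ ht => hadj t (by omega)) h
  rw [hS] at hrun
  have hb2 : b = 2 := by
    have := (hrun 1 (m - 2) (by omega) hinner).1
    omega
  have h0 : c.syn (g 0) ≠ 0 := by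
    intro h
    have := (hrun 0 (m - 2) (by omega) (by
      intro t _ ht
      rcases Nat.eq_zero_or_pos t with rfl | ht'
      · exact h
      · exact hinner t ht' ht)).1
    omega
  have h1 : c.syn (g (m - 1)) ≠ 0 := by
    intro h
    have := (hrun 1 (m - 1) (by omega) (by
      intro t ht' ht
      rcases Nat.lt_or_ge (m - 2) t with ht'' | ht''
      · rwa [(by omega : t = m - 1)]
      · exact hinner t ht' ht'')).1
    omega
  have hk0 := hlow 0 (by omega) h0
  have hk1 := hlow (m - 1) (by omega) h1
  have hcard := hT' hb2 hk0 hk1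
  have hpar := (hrun 1 (m - 2) (by omega) hinner).2 (m - 3) (by omega)
  have e0 := c.eq_att_of_adj h0 (hinner 1 le_rfl (by omega)) (hadj 0 (by omega))
  have e0' : g 1 = c.att (g 0) := e0
  have hl := hadj (m - 2) (by omega)
  rw [(by omega : m - 2 + 1 = m - 1)] at hl
  have e1 := c.eq_att_of_adj h1 (hinner (m - 2) (by omega) le_rfl) hl.symm
  rw [(by omega : 1 + (m - 3) = m - 2), e1, e0', c.par_att h0, c.par_att h1] at hpar
  have hodd : ((m - 3 : ℕ) : ZMod 2) = 1 := by
    rw [ZMod.natCast_eq_one_iff_odd, hm, hb2]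
    obtain ⟨e, rfl⟩ := Nat.exists_eq_add_of_le' ha
    rw [pow_succ] at *
    exact ⟨2 ^ e - 1, by omega⟩
  rw [hodd] at hpar
  have h2k0 := hk 0 (by omega)
  have h2k1 := hk (m - 1) (by omega)
  by_cases hp : c.par (g 0) = 0
  · have := hlow' (m - 1) (by omega) h1 (by rw [hpar, hp]; decide)
    omega
  · have := hlow' 0 (by omega) h0 hp
    omega

/-- A Hamiltonian path of the cluster of `w` that starts at `w`. -/
noncomputable def gray (w : ι → Bool) : ℕ → ι → Bool := Classical.choose (exists_gray c.S w)

lemma gray_zero (w : ι → Bool) : c.gray w 0 = w := (Classical.choose_spec (exists_gray c.S w)).1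

lemma gray_succ (w : ι → Bool) (s : ℕ) (hs : s + 1 < 2 ^ c.S.card) :
    ∃ i ∈ c.S, c.gray w (s + 1) = flip (c.gray w s) i :=
  (Classical.choose_spec (exists_gray c.S w)).2.1 s hs

lemma gray_inj (w : ι → Bool) {s t : ℕ} (hs : s < 2 ^ c.S.card) (ht : t < 2 ^ c.S.card)
    (h : c.gray w s = c.gray w t) : s = t :=
  (Classical.choose_spec (exists_gray c.S w)).2.2.1 s hs t ht h

lemma gray_off (w : ι → Bool) (s : ℕ) {q : ι} (hq : q ∉ c.S) : c.gray w s q = w q :=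
  (Classical.choose_spec (exists_gray c.S w)).2.2.2 s q hq

lemma syn_par_gray (w : ι → Bool) (s : ℕ) (hs : s < 2 ^ c.S.card) :
    c.syn (c.gray w s) = c.syn w ∧ c.par (c.gray w s) = c.par w + s := by
  induction s with
  | zero => simp [gray_zero]
  | succ s ih =>
    obtain ⟨i, hi, h⟩ := c.gray_succ w s hs
    obtain ⟨h1, h2⟩ := ih (by omega)
    rw [h, c.syn_flip, c.par_flip_mem _ hi, c.lab_S i hi, h1, h2]
    refine ⟨add_zero _, ?_⟩
    push_cast
    ring

lemma gray_adj {w : ι → Bool} (hw : c.syn w = 0) (s : ℕ) (hs : s + 1 < 2 ^ c.S.card) :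
    c.graph.Adj (c.gray w s) (c.gray w (s + 1)) := by
  obtain ⟨i, hi, h⟩ := c.gray_succ w s hs
  exact ⟨i, h, Or.inr (Or.inl ⟨hi, (c.syn_par_gray w s (by omega)).1.trans hw⟩)⟩

open Classical in
/-- The path that starts at `u` and continues through the cluster of `root u`. -/
noncomputable def arm (u : ι → Bool) (s : ℕ) : ι → Bool :=
  if c.syn u = 0 then c.gray u s else if s = 0 then u else c.gray (c.att u) (s - 1)

open Classical in
/-- The number of vertices of `arm u`. -/
noncomputable def armLength (u : ι → Bool) : ℕ :=
  if c.syn u = 0 then 2 ^ c.S.card else 2 ^ c.S.card + 1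

lemma le_armLength (u : ι → Bool) : 2 ^ c.S.card ≤ c.armLength u := by
  unfold armLength; split_ifs <;> omega

lemma arm_zero (u : ι → Bool) : c.arm u 0 = u := by
  unfold arm
  rw [if_pos rfl, c.gray_zero, ite_self]

lemma syn_arm (u : ι → Bool) {s : ℕ} (hs : s < c.armLength u) (h0 : s ≠ 0) :
    c.syn (c.arm u s) = 0 := by
  unfold arm armLength at *
  split_ifs at * with hu
  · rw [(c.syn_par_gray u s hs).1, hu]
  · rw [(c.syn_par_gray _ (s - 1) (by omega)).1, c.syn_att hu]

lemma arm_adj (u : ι → Bool) {s : ℕ} (hs : s + 1 < c.armLength u) :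
    c.graph.Adj (c.arm u s) (c.arm u (s + 1)) := by
  unfold armLength at hs
  unfold arm
  split_ifs at * with hu h0
  · exact c.gray_adj hu s hs
  · subst h0
    rw [zero_add, Nat.sub_self, c.gray_zero]
    exact c.adj_att hu
  · have := c.gray_adj (c.syn_att hu) (s - 1) (by omega)
    rwa [Nat.sub_add_cancel (by omega)] at this

lemma arm_inj (u : ι → Bool) {s t : ℕ} (hs : s < c.armLength u) (ht : t < c.armLength u)
    (h : c.arm u s = c.arm u t) : s = t := by
  by_cases hu : c.syn u = 0
  · unfold armLength at hs ht
    unfold arm at h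
    rw [if_pos hu] at hs ht
    rw [if_pos hu, if_pos hu] at h
    exact c.gray_inj u hs ht h
  · by_cases hs0 : s = 0 <;> by_cases ht0 : t = 0
    · omega
    · subst hs0
      rw [c.arm_zero] at h
      exact (hu (h ▸ c.syn_arm u ht ht0)).elim
    · subst ht0
      rw [c.arm_zero] at h
      exact (hu (h ▸ c.syn_arm u hs hs0)).elim
    · unfold armLength at hs ht
      unfold arm at h
      rw [if_neg hu] at hs ht
      rw [if_neg hu, if_neg hu, if_neg hs0, if_neg ht0] at h
      have := c.gray_inj _ (by omega) (by omega) h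
      omega

lemma arm_off (u : ι → Bool) {s : ℕ} (h : c.syn (c.arm u s) = 0) {q : ι} (hq : q ∉ c.S) :
    c.arm u s q = c.root u q := by
  unfold arm root at *
  split_ifs at * with hu h0
  · exact c.gray_off u s hq
  · exact (hu h).elim
  · exact c.gray_off _ _ hq

section Assembly

variable [Fintype A] [DecidableEq A]

/-- To exhibit a caterpillar it suffices to give the spine and the leaves of the spine vertices of
nonzero syndrome: centres have plenty of attached vertices with other syndromes. -/
lemma spans_of_spine {G : SimpleGraph (ι → Bool)} (hG : c.graph ≤ G) {m K : ℕ} {k : ℕ → ℕ}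
    (hK : ∀ t < m, k t ≤ K) (bad : Finset A) (h0 : 0 ∈ bad)
    (hbad : bad.card + K ≤ Fintype.card A)
    (g : ℕ → ι → Bool) (L : ℕ → Finset (ι → Bool))
    (hg : ∀ s < m, ∀ t < m, g s = g t → s = t)
    (hadj : ∀ t, t + 1 < m → G.Adj (g t) (g (t + 1)))
    (hsyn : ∀ t < m, c.syn (g t) ≠ 0 → c.syn (g t) ∈ bad)
    (hcard : ∀ t < m, c.syn (g t) ≠ 0 → k t - spineExtra m t ≤ (L t).card)
    (hL : ∀ t < m, c.syn (g t) ≠ 0 → ∀ x ∈ L t,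
      G.Adj (g t) x ∧ c.syn x ∈ bad ∧ ∀ s < m, g s ≠ x)
    (hLL : ∀ s < m, ∀ t < m, s ≠ t → c.syn (g s) ≠ 0 → c.syn (g t) ≠ 0 → Disjoint (L s) (L t)) :
    Spans G m k := by
  let M : (ι → Bool) → Finset (ι → Bool) := fun w =>
    (Finset.univ \ bad).image fun p => flip w (c.coord p (c.par w))
  have hne : ∀ p ∈ Finset.univ \ bad, p ≠ 0 := by
    rintro p hp rfl
    exact (Finset.mem_sdiff.1 hp).2 h0
  have hM : ∀ w, c.syn w = 0 → ∀ x ∈ M w, c.syn x ∉ bad ∧ c.par x = c.par w ∧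
      x = flip w (c.coord (c.syn x) (c.par x)) ∧ G.Adj w x := by
    intro w hw x hx
    obtain ⟨p, hp, rfl⟩ := Finset.mem_image.1 hx
    have hp0 := hne p hp
    have e : c.syn (flip w (c.coord p (c.par w))) = p := by
      rw [c.syn_flip, hw, zero_add, c.lab_coord _ _ hp0]
    have e' := c.par_flip_notMem w (c.coord_notMem_S hp0 (c.par w))
    refine ⟨?_, e', ?_, hG (c.adj_coord hw hp0)⟩
    · rw [e]; exact (Finset.mem_sdiff.1 hp).2
    · rw [e, e']
  refine ⟨g, fun t => if c.syn (g t) = 0 then M (g t) else L t, hg, hadj, ?_, ?_, ?_, ?_⟩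
  · intro t ht
    beta_reduce
    split_ifs with h
    · have : (M (g t)).card = Fintype.card A - bad.card := by
        rw [Finset.card_image_of_injOn, Finset.card_sdiff_of_subset (Finset.subset_univ _),
          Finset.card_univ]
        intro p hp p' hp' e
        have := flip_injective _ e
        rw [← c.lab_coord p (c.par (g t)) (hne p hp), this, c.lab_coord _ _ (hne p' hp')]
      have := hK t ht
      omega
    · exact hcard t ht h
  · intro t ht x hx
    beta_reduce at hx
    split_ifs at hx with h
    · exact (hM _ h x hx).2.2.2
    · exact (hL t ht h x hx).1
  · intro s hs t ht hx
    beta_reduce at hx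
    split_ifs at hx with h
    · have h1 := (hM _ h _ hx).1
      by_cases h2 : c.syn (g s) = 0
      · exact h1 (h2 ▸ h0)
      · exact h1 (hsyn s hs h2)
    · exact (hL t ht h _ hx).2.2 s hs rfl
  · intro s hs t ht hst
    rw [Finset.disjoint_left]
    intro x hx hx'
    beta_reduce at hx hx'
    split_ifs at hx hx' with h h' h'
    · obtain ⟨_, _, e1, _⟩ := hM _ h _ hx
      obtain ⟨_, _, e2, _⟩ := hM _ h' _ hx'
      exact hst (hg s hs t ht (flip_left_cancel (e1.symm.trans e2)))
    · exact (hM _ h _ hx).1 (hL t ht h' x hx').2.1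
    · exact (hM _ h' _ hx').1 (hL s hs h x hx).2.1
    · exact Finset.disjoint_left.1 (hLL s hs t ht hst h h') hx hx'

/-- A caterpillar made of two arms in different clusters joined by the edge `u v`. -/
lemma spans_of_two_arms {G : SimpleGraph (ι → Bool)} (hG : c.graph ≤ G) {m K d j : ℕ} {k : ℕ → ℕ}
    (hK : ∀ t < m, k t ≤ K) (hA : 3 + K ≤ Fintype.card A) (hT : c.T.card = d - 2)
    (hj : 2 ≤ j) (hjm : j + 2 ≤ m) (hj' : j ≤ 2 ^ c.S.card) (hmj : m - j ≤ 2 ^ c.S.card)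
    (hk : k (j - 1) ≤ d) (hk' : k j ≤ d) {u : ι → Bool} {i : ι}
    (huv : G.Adj u (flip u i))
    (hu : c.syn u ≠ 0 → ∀ x ∈ c.T, c.Edge x u)
    (hv : c.syn (flip u i) ≠ 0 → ∀ x ∈ c.T, c.Edge x (flip u i))
    (hi : c.syn u ≠ 0 → c.syn (flip u i) ≠ 0 → i ∉ c.T)
    {q : ι} (hq : q ∉ c.S) (hroot : c.root u q ≠ c.root (flip u i) q) : Spans G m k := by
  set v := flip u i with hvdef
  have hlu := c.le_armLength u
  have hlv := c.le_armLength v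
  let g : ℕ → ι → Bool := fun t => if t < j then c.arm u (j - 1 - t) else c.arm v (t - j)
  have hgl : ∀ t < j, g t = c.arm u (j - 1 - t) := fun t ht => if_pos ht
  have hgr : ∀ t, j ≤ t → g t = c.arm v (t - j) := fun t ht => if_neg (by omega)
  have hcent : ∀ t < m, c.syn (g t) ≠ 0 → (t = j - 1 ∧ g t = u) ∨ (t = j ∧ g t = v) := by
    intro t ht h
    by_cases htj : t < j
    · left
      rw [hgl t htj] at h ⊢
      have : j - 1 - t = 0 := by
        by_contra h'
        exact h (c.syn_arm u (by omega) h')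
      rw [this]
      exact ⟨by omega, c.arm_zero u⟩
    · right
      rw [hgr t (by omega)] at h ⊢
      have : t - j = 0 := by
        by_contra h'
        exact h (c.syn_arm v (by omega) h')
      rw [this]
      exact ⟨by omega, c.arm_zero v⟩
  have hcross : ∀ s < j, ∀ t, j ≤ t → t < m → g s ≠ g t := by
    intro s hs t htj ht h
    by_cases h0 : c.syn (g s) = 0
    · have h0' := h ▸ h0
      rw [hgl s hs] at h h0
      rw [hgr t htj] at h h0'
      have := congrFun h q
      rw [c.arm_off u h0 hq, c.arm_off v h0' hq] at this
      exact hroot this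
    · have h1 := hcent s (by omega) h0
      have h2 := hcent t ht (h ▸ h0)
      have e1 : g s = u := h1.elim (fun h => h.2) fun h => by omega
      have e2 : g t = v := h2.elim (fun h => by omega) fun h => h.2
      exact flip_ne u i (e2.symm.trans (h.symm.trans e1))
  have hsynT : ∀ (w : ι → Bool), ∀ x ∈ c.T, c.syn (flip w x) = c.syn w := by
    intro w x hx
    rw [c.syn_flip, c.lab_T x hx, add_zero]
  refine c.spans_of_spine hG hK {0, c.syn u, c.syn v} (by simp)
    (le_trans (Nat.add_le_add_right Finset.card_le_three _) hA) g
    (fun t => c.T.image (flip (g t))) ?_ ?_ ?_ ?_ ?_ ?_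
  · intro s hs t ht h
    by_cases h1 : s < j <;> by_cases h2 : t < j
    · rw [hgl s h1, hgl t h2] at h
      have := c.arm_inj u (by omega) (by omega) h
      omega
    · exact (hcross s h1 t (by omega) ht h).elim
    · exact (hcross t h2 s (by omega) hs h.symm).elim
    · rw [hgr s (by omega), hgr t (by omega)] at h
      have := c.arm_inj v (by omega) (by omega) h
      omega
  · intro t ht
    rcases lt_trichotomy (t + 1) j with h | h | h
    · rw [hgl t (by omega), hgl _ h, (by omega : j - 1 - t = j - 1 - (t + 1) + 1)]
      exact (hG (c.arm_adj u (by omega))).symm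
    · rw [hgl t (by omega), hgr _ h.ge, (by omega : j - 1 - t = 0), (by omega : t + 1 - j = 0),
        c.arm_zero, c.arm_zero]
      exact huv
    · rw [hgr t (by omega), hgr _ h.le, (by omega : t + 1 - j = t - j + 1)]
      exact hG (c.arm_adj v (by omega))
  · intro t ht h
    rcases hcent t ht h with ⟨_, h⟩ | ⟨_, h⟩ <;> simp [h]
  · intro t ht h
    rw [Finset.card_image_of_injective _ (flip_injective _), hT]
    unfold spineExtra
    rcases hcent t ht h with ⟨h, _⟩ | ⟨h, _⟩ <;> subst h
    · rw [if_neg (by omega), if_neg (by omega)]; omega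
    · rw [if_neg (by omega), if_neg (by omega)]; omega
  · intro t ht h x hx
    obtain ⟨y, hy, rfl⟩ := Finset.mem_image.1 hx
    have hsx := hsynT (g t) y hy
    refine ⟨hG ⟨y, rfl, ?_⟩, ?_, ?_⟩
    · rcases hcent t ht h with ⟨_, e⟩ | ⟨_, e⟩ <;> rw [e] at h ⊢
      · exact hu h y hy
      · exact hv h y hy
    · rw [hsx]
      rcases hcent t ht h with ⟨_, h⟩ | ⟨_, h⟩ <;> simp [h]
    · intro s hs e
      have hs0 : c.syn (g s) ≠ 0 := by rw [e, hsx]; exact h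
      rcases hcent t ht h with ⟨_, e1⟩ | ⟨_, e1⟩ <;> rcases hcent s hs hs0 with ⟨_, e2⟩ | ⟨_, e2⟩ <;>
        rw [e1] at h <;> rw [e2] at hs0 <;> rw [e1, e2] at e
      · exact flip_ne _ _ e.symm
      · exact hi h hs0 ((flip_injective u e) ▸ hy)
      · rw [hvdef] at e
        have e' : flip u i = flip u y := by rw [← flip_flip (flip u i) y, ← e]
        exact hi hs0 h ((flip_injective u e') ▸ hy)
      · exact flip_ne _ _ e.symm
  · have key : c.syn u ≠ 0 → c.syn v ≠ 0 → Disjoint (c.T.image (flip u)) (c.T.image (flip v)) := by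
      intro h1 h2
      have hiT := hi h1 h2
      rw [Finset.disjoint_left]
      intro x hx hx'
      obtain ⟨y, hy, rfl⟩ := Finset.mem_image.1 hx
      obtain ⟨y', hy', e⟩ := Finset.mem_image.1 hx'
      have := congrFun e i
      rw [flip_of_ne _ (fun h => hiT (by rwa [h])), flip_of_ne _ (fun h => hiT (by rwa [h])),
        hvdef, flip_self] at this
      simp at this
    intro s hs t ht hst h1 h2
    rcases hcent s hs h1 with ⟨e1, e1'⟩ | ⟨e1, e1'⟩ <;>
      rcases hcent t ht h2 with ⟨e2, e2'⟩ | ⟨e2, e2'⟩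
    · omega
    · rw [e1', e2']; rw [e1'] at h1; rw [e2'] at h2; exact key h1 h2
    · rw [e1', e2']; rw [e1'] at h1; rw [e2'] at h2; exact (key h2 h1).symm
    · omega

/-- A caterpillar with low ends and all inner spine vertices in one cluster, where the new edge
`z v` only provides a leaf. -/
lemma spans_of_new_leaf {G : SimpleGraph (ι → Bool)} (hG : c.graph ≤ G) {m K : ℕ} {k : ℕ → ℕ}
    (hK : ∀ t < m, k t ≤ K) (hA : 4 + K ≤ Fintype.card A) (hS : 1 ≤ c.S.card)
    (hm : m = 2 ^ c.S.card + 2) (hk0 : k 0 ≤ c.T'.card + 2) (hk1 : k (m - 1) ≤ c.T.card + 1)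
    {z : ι → Bool} {i : ι} (hzv : G.Adj z (flip z i)) (hnot : ¬ c.Edge i z)
    (hz : c.syn z ≠ 0) (hpar : c.par z = 1) : Spans G m k := by
  set v := flip z i with hv
  have hpow : 2 ≤ 2 ^ c.S.card := by
    calc 2 = 2 ^ 1 := rfl
      _ ≤ 2 ^ c.S.card := Nat.pow_le_pow_right (by norm_num) hS
  have hlen : c.armLength z = 2 ^ c.S.card + 1 := if_neg hz
  obtain ⟨p, hp⟩ : ∃ p, p ∉ ({0, c.syn z, c.syn v} : Finset A) := by
    by_contra! h
    have h1 : Fintype.card A ≤ ({0, c.syn z, c.syn v} : Finset A).card := by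
      rw [← Finset.card_univ]
      exact Finset.card_le_card fun x _ => h x
    have := h1.trans Finset.card_le_three
    omega
  simp only [Finset.mem_insert, Finset.mem_singleton, not_or] at hp
  obtain ⟨hp0, hpz, hpv⟩ := hp
  have hlast : c.syn (c.arm z (2 ^ c.S.card)) = 0 ∧ c.par (c.arm z (2 ^ c.S.card)) = 0 := by
    refine ⟨c.syn_arm z (by omega) (by omega), ?_⟩
    unfold arm
    rw [if_neg hz, if_neg (by omega), (c.syn_par_gray _ _ (by omega)).2, c.par_att hz, hpar]
    have : ((2 ^ c.S.card - 1 : ℕ) : ZMod 2) = 1 := by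
      rw [ZMod.natCast_eq_one_iff_odd]
      obtain ⟨e, he⟩ := Nat.exists_eq_add_of_le' hS
      have he' : 2 ^ c.S.card = 2 ^ e * 2 := by rw [he, pow_succ]
      exact ⟨2 ^ e - 1, by omega⟩
    rw [this]
    decide
  obtain ⟨e, he, hes, hep⟩ : ∃ e, c.graph.Adj (c.arm z (2 ^ c.S.card)) e ∧ c.syn e = p ∧
      c.par e = 0 := by
    refine ⟨_, c.adj_coord hlast.1 hp0, ?_, ?_⟩
    · rw [c.syn_flip, hlast.1, zero_add, c.lab_coord _ _ hp0]
    · rw [c.par_flip_notMem _ (c.coord_notMem_S hp0 _), hlast.2]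
  let g : ℕ → ι → Bool := fun t => if t < 2 ^ c.S.card + 1 then c.arm z t else e
  have hgl : ∀ t < 2 ^ c.S.card + 1, g t = c.arm z t := fun t ht => if_pos ht
  have hgm : g (m - 1) = e := if_neg (by omega)
  have hg0 : g 0 = z := (hgl 0 (by omega)).trans (c.arm_zero z)
  have hm0 : m - 1 ≠ 0 := by omega
  have hmid : ∀ t < m, t ≠ 0 → t ≠ m - 1 → c.syn (g t) = 0 ∧ g t ≠ v := by
    intro t ht h0 h1
    have hs := c.syn_arm z (s := t) (by omega) h0
    rw [hgl t (by omega)]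
    refine ⟨hs, fun h => hnot ?_⟩
    have hq := c.coord_notMem_S hz (c.par z)
    have h2 := c.arm_off z hs hq
    rw [h, hv] at h2
    unfold root att at h2
    rw [if_neg hz, flip_self] at h2
    have hqi : c.coord (c.syn z) (c.par z) = i := by
      by_contra hne
      rw [flip_of_ne _ hne] at h2
      simp at h2
    rw [← hqi]
    left
    rw [c.lab_coord _ _ hz]
    exact ⟨hz, rfl, Or.inr rfl⟩
  have hends : ∀ t < m, c.syn (g t) ≠ 0 → t = 0 ∨ t = m - 1 := by
    intro t ht h
    by_contra! h'
    exact h (hmid t ht h'.1 h'.2).1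
  have hsynT : ∀ (w : ι → Bool), ∀ x ∈ c.T, c.syn (flip w x) = c.syn w := by
    intro w x hx
    rw [c.syn_flip, c.lab_T x hx, add_zero]
  refine c.spans_of_spine hG hK {0, c.syn z, c.syn v, p} (by simp)
    (le_trans (Nat.add_le_add_right Finset.card_le_four _) hA) g
    (fun t => if t = 0 then insert v (c.T'.image (flip z)) else c.T.image (flip e)) ?_ ?_ ?_ ?_ ?_ ?_
  · have hlt : ∀ t < m - 1, g t ≠ e := by
      intro t ht h
      by_cases h0 : t = 0
      · rw [h0, hg0] at h
        exact hpz (hes ▸ h ▸ rfl)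
      · have := (hmid t (by omega) h0 (by omega)).1
        rw [h, hes] at this
        exact hp0 this
    intro s hs t ht h
    by_cases h1 : s = m - 1 <;> by_cases h2 : t = m - 1
    · omega
    · rw [h1, hgm] at h
      exact (hlt t (by omega) h.symm).elim
    · rw [h2, hgm] at h
      exact (hlt s (by omega) h).elim
    · rw [hgl s (by omega), hgl t (by omega)] at h
      exact c.arm_inj z (by omega) (by omega) h
  · intro t ht
    by_cases h : t + 1 = m - 1
    · rw [h, hgm, hgl t (by omega), (by omega : t = 2 ^ c.S.card)]
      exact hG he
    · rw [hgl t (by omega), hgl _ (by omega)]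
      exact hG (c.arm_adj z (by omega))
  · intro t ht h
    rcases hends t ht h with rfl | rfl
    · simp [hg0]
    · simp [hgm, hes]
  · intro t ht h
    rcases hends t ht h with rfl | rfl
    · rw [if_pos rfl, Finset.card_insert_of_notMem, Finset.card_image_of_injective _ (flip_injective _)]
      · unfold spineExtra
        rw [if_pos rfl, if_neg hm0.symm]
        omega
      · intro hx
        obtain ⟨y, hy, e⟩ := Finset.mem_image.1 hx
        have := flip_injective z e
        exact hnot (Or.inr (Or.inr ⟨hz, Or.inl (this ▸ hy)⟩))
    · rw [if_neg hm0, Finset.card_image_of_injective _ (flip_injective _)]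
      unfold spineExtra
      rw [if_neg hm0, if_pos rfl]
      omega
  · intro t ht h x hx
    rcases hends t ht h with rfl | rfl
    · rw [if_pos rfl, Finset.mem_insert] at hx
      rw [hg0]
      rcases hx with rfl | hx
      · refine ⟨hzv, by simp, fun s hs h' => ?_⟩
        by_cases h0 : s = 0
        · rw [h0, hg0] at h'
          exact flip_ne z i h'.symm
        · by_cases h1 : s = m - 1
          · rw [h1, hgm] at h'
            exact hpv (by rw [← hes, h'])
          · exact (hmid s hs h0 h1).2 h'
      · obtain ⟨y, hy, rfl⟩ := Finset.mem_image.1 hx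
        have hsx := hsynT z y (c.sub hy)
        refine ⟨hG ⟨y, rfl, Or.inr (Or.inr ⟨hz, Or.inl hy⟩)⟩, by simp [hsx], fun s hs h' => ?_⟩
        have hs0 : c.syn (g s) ≠ 0 := by rw [h', hsx]; exact hz
        rcases hends s hs hs0 with rfl | rfl
        · rw [hg0] at h'
          exact flip_ne z y h'.symm
        · rw [hgm] at h'
          exact hpz (by rw [← hes, h', hsx])
    · rw [if_neg hm0] at hx
      rw [hgm]
      obtain ⟨y, hy, rfl⟩ := Finset.mem_image.1 hx
      have hsx := hsynT e y hy
      rw [hes] at hsx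
      refine ⟨hG ⟨y, rfl, Or.inr (Or.inr ⟨hes ▸ hp0, Or.inr ⟨hy, hep⟩⟩)⟩, by simp [hsx],
        fun s hs h' => ?_⟩
      have hs0 : c.syn (g s) ≠ 0 := by rw [h', hsx]; exact hp0
      rcases hends s hs hs0 with rfl | rfl
      · rw [hg0] at h'
        exact hpz (by rw [← hsx, ← h'])
      · rw [hgm] at h'
        exact flip_ne e y h'.symm
  · have key : Disjoint (insert v (c.T'.image (flip z))) (c.T.image (flip e)) := by
      rw [Finset.disjoint_left]
      intro x hx hx'
      obtain ⟨y, hy, rfl⟩ := Finset.mem_image.1 hx'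
      have hsx := hsynT e y hy
      rw [hes] at hsx
      rcases Finset.mem_insert.1 hx with h | h
      · exact hpv (by rw [← hsx, h])
      · obtain ⟨y', hy', h⟩ := Finset.mem_image.1 h
        exact hpz (by rw [← hsx, ← h, hsynT z y' (c.sub hy')])
    intro s hs t ht hst h1 h2
    rcases hends s hs h1 with rfl | rfl <;> rcases hends t ht h2 with rfl | rfl
    · exact (hst rfl).elim
    · rw [if_pos rfl, if_neg hm0]; exact key
    · rw [if_pos rfl, if_neg hm0]; exact key.symm
    · exact (hst rfl).elim

end Assembly

lemma root_apart {u : ι → Bool} {i : ι} (h : ¬ c.Edge i u) :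
    ∃ q, q ∉ c.S ∧ c.root u q ≠ c.root (flip u i) q := by
  have hedge : ∀ w : ι → Bool, c.syn w ≠ 0 → ¬ c.Edge i w → i ≠ c.coord (c.syn w) (c.par w) := by
    intro w hw hE hi
    refine hE (Or.inl ?_)
    rw [hi, c.lab_coord _ _ hw]
    exact ⟨hw, rfl, Or.inr rfl⟩
  have h' : ¬ c.Edge i (flip u i) := fun h' => h (flip_flip u i ▸ c.edge_flip h')
  have hsyn := c.syn_flip u i
  have hui : u i ≠ flip u i i := by simp
  unfold root
  by_cases hu : c.syn u = 0 <;> by_cases hv : c.syn (flip u i) = 0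
  · rw [if_pos hu, if_pos hv]
    exact ⟨i, fun hi => h (Or.inr (Or.inl ⟨hi, hu⟩)), hui⟩
  · rw [if_pos hu, if_neg hv]
    rw [hu, zero_add] at hsyn
    refine ⟨i, c.notMem_S (hsyn ▸ hv), ?_⟩
    unfold att
    rwa [flip_of_ne _ (hedge _ hv h')]
  · rw [if_neg hu, if_pos hv]
    rw [hv, eq_comm, c.add_eq_zero] at hsyn
    refine ⟨i, c.notMem_S (hsyn ▸ hu), ?_⟩
    unfold att
    rwa [flip_of_ne _ (hedge _ hu h)]
  · rw [if_neg hu, if_neg hv]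
    unfold att
    by_cases hq : c.coord (c.syn u) (c.par u) = c.coord (c.syn (flip u i)) (c.par (flip u i))
    · have hs : c.syn u = c.syn (flip u i) := by
        rw [← c.lab_coord _ (c.par u) hu, hq, c.lab_coord _ _ hv]
      refine ⟨i, fun hi => ?_, ?_⟩
      · rw [← hs] at hq
        have := c.coord_injective _ hu hq
        rw [c.par_flip_mem u hi] at this
        simp at this
      · rwa [flip_of_ne _ (hedge _ hu h), flip_of_ne _ (hedge _ hv h')]
    · refine ⟨_, c.coord_notMem_S hu (c.par u), ?_⟩
      rw [flip_self, flip_of_ne _ hq, flip_of_ne _ (hedge _ hu h).symm]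
      simp

lemma card_centres_mul_le [Fintype A] [DecidableEq A] :
    (Finset.univ.filter fun u => c.syn u = 0).card * Fintype.card A ≤ 2 ^ Fintype.card ι := by
  have : (Fintype.card (ι → Bool)) = 2 ^ Fintype.card ι := by simp
  rw [← this, ← Finset.card_univ, ← Finset.card_univ, ← Finset.card_product]
  let F : (ι → Bool) × A → ι → Bool := fun x =>
    if x.2 = 0 then x.1 else flip x.1 (c.coord x.2 0)
  have hF : ∀ x : (ι → Bool) × A, c.syn x.1 = 0 → c.syn (F x) = x.2 := by
    intro x hx
    simp only [F]
    split_ifs with h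
    · rw [hx, h]
    · rw [c.syn_flip, hx, zero_add, c.lab_coord _ _ h]
  refine Finset.card_le_card_of_injOn F (fun _ _ => Finset.mem_coe.2 (Finset.mem_univ _)) ?_
  rintro ⟨u, p⟩ hx ⟨v, p'⟩ hy h
  simp only [Finset.coe_product, Set.mem_prod, Finset.mem_coe, Finset.mem_filter, Finset.mem_univ,
    true_and, and_true] at hx hy
  have hp : p = p' := (hF (u, p) hx).symm.trans ((congrArg c.syn h).trans (hF (v, p') hy))
  subst hp
  simp only [F] at h
  split_ifs at h
  · rw [h]
  · rw [flip_left_cancel h]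

lemma two_mul_card_edges_le [Fintype A] {d : ℕ} (hd : 2 ≤ d) (hS : c.S.card ≤ d)
    (hT : c.T.card = d - 2) :
    2 * c.graph.edgeSet.ncard ≤ d * 2 ^ Fintype.card ι := by
  classical
  have hdeg : ∀ u, c.graph.degree u ≤ (d - 1) + if c.syn u = 0 then Fintype.card A else 0 := by
    intro u
    rw [← SimpleGraph.card_neighborFinset_eq_degree]
    split_ifs with hu
    · have hsub : c.graph.neighborFinset u ⊆
          ((Finset.univ.erase 0).image fun p => flip u (c.coord p (c.par u))) ∪
            c.S.image (flip u) := by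
        intro x hx
        rw [SimpleGraph.mem_neighborFinset] at hx
        obtain ⟨i, rfl, h⟩ := hx
        rw [Finset.mem_union, Finset.mem_image, Finset.mem_image]
        rcases h with ⟨h1, h2, h3⟩ | ⟨h1, h2⟩ | ⟨h1, h2⟩
        · exact Or.inl ⟨c.lab i, by simpa using h1, by rw [← h2]⟩
        · exact Or.inr ⟨i, h1, rfl⟩
        · exact (h1 hu).elim
      have h1 := (Finset.card_le_card hsub).trans (Finset.card_union_le _ _)
      have h2 := (Finset.card_image_le (s := Finset.univ.erase (0 : A))
        (f := fun p => flip u (c.coord p (c.par u))))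
      have h3 := (Finset.card_image_le (s := c.S) (f := flip u))
      rw [Finset.card_erase_of_mem (Finset.mem_univ _), Finset.card_univ] at h2
      have h4 : 0 < Fintype.card A := Fintype.card_pos
      omega
    · have h1 := c.card_neighbors_le hu (c.graph.neighborFinset u)
        fun x hx => (SimpleGraph.mem_neighborFinset _ _ _).1 hx
      have h2 : (if c.par u = 0 then c.T else c.T').card ≤ c.T.card := by
        split_ifs
        · exact le_rfl
        · exact Finset.card_le_card c.sub
      omega
  rw [← SimpleGraph.coe_edgeFinset, Set.ncard_coe_finset,
    ← SimpleGraph.sum_degrees_eq_twice_card_edges]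
  refine (Finset.sum_le_sum fun u _ => hdeg u).trans ?_
  rw [Finset.sum_add_distrib, Finset.sum_const, ← Finset.sum_filter, Finset.sum_const,
    Finset.card_univ, smul_eq_mul, smul_eq_mul]
  have h1 := c.card_centres_mul_le
  have h2 : (Fintype.card (ι → Bool)) = 2 ^ Fintype.card ι := by simp
  rw [h2]
  obtain ⟨e, rfl⟩ := Nat.exists_eq_add_of_le' hd
  have : e + 2 - 1 = e + 1 := by omega
  rw [this]
  calc _ ≤ 2 ^ Fintype.card ι * (e + 1) + 2 ^ Fintype.card ι := Nat.add_le_add_left h1 _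
    _ = (e + 2) * 2 ^ Fintype.card ι := by ring

lemma isSat {n : ℕ} [Fintype A] (c : Scheme (Fin n) A) {m a b j d K : ℕ} {k : ℕ → ℕ}
    (hm : m = 2 ^ a + b) (hb : 2 ≤ b) (hbj : b ≤ j) (hj : j < 2 ^ a) (ha : 1 ≤ a)
    (hk : ∀ t < m, 2 ≤ k t) (hd : d = max (k (j - 1)) (k j))
    (hmin : ∀ t, t + 1 < m → d ≤ max (k t) (k (t + 1)))
    (hK : ∀ t < m, k t ≤ K) (hA : 4 + K ≤ Fintype.card A)
    (hS : c.S.card = a) (hT : c.T.card = d - 2)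
    (hT' : (b = 2 ∧ k 0 < d ∧ k (m - 1) < d ∧ c.T'.card = min (k 0) (k (m - 1)) - 2) ∨
      (¬ (b = 2 ∧ k 0 < d ∧ k (m - 1) < d) ∧ c.T' = c.T)) :
    IsSat (hypercube n) c.graph (caterpillar m k) := by
  classical
  have hk0 := hk 0 (by omega)
  have hkm := hk (m - 1) (by omega)
  have hkj := hk j (by omega)
  refine ⟨?_, ?_, ?_⟩
  · rintro u v ⟨i, h, _⟩
    exact hypercube_adj.2 ⟨i, h⟩
  · refine c.not_hasCopy hm hb ha (by omega) hk hmin hS hT ?_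
    intro h1 h2 h3
    rcases hT' with h | h
    · exact h.2.2.2
    · exact (h.1 ⟨h1, h2, h3⟩).elim
  · intro u v huv hnot
    obtain ⟨i, rfl⟩ := hypercube_adj.1 huv
    have hE : ¬ c.Edge i u := fun h => hnot ⟨i, rfl, h⟩
    have hE' : ¬ c.Edge i (flip u i) := fun h' => hE (flip_flip u i ▸ c.edge_flip h')
    set G := c.graph ⊔ SimpleGraph.fromEdgeSet {s(u, flip u i)} with hGdef
    have hG : c.graph ≤ G := le_sup_left
    have hGuv : G.Adj u (flip u i) := by
      rw [hGdef, SimpleGraph.sup_adj, SimpleGraph.fromEdgeSet_adj]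
      exact Or.inr ⟨rfl, (flip_ne u i).symm⟩
    have hleaf : ∀ z, c.syn z ≠ 0 → ¬ (c.par z = 0 ∨ c.T' = c.T) → ¬ c.Edge i z →
        G.Adj z (flip z i) → Spans G m k := by
      intro z hz hfull hEz hGz
      rw [not_or] at hfull
      have hp : c.par z = 1 := by
        have : ∀ x : ZMod 2, x ≠ 0 → x = 1 := by decide
        exact this _ hfull.1
      rcases hT' with ⟨h1, h2, h3, h4⟩ | h
      · rcases le_total (k 0) (k (m - 1)) with hle | hle
        · exact c.spans_of_new_leaf hG hK hA (by omega) (by rw [hS, hm, h1]) (by omega) (by omega)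
            hGz hEz hz hp
        · refine Spans.reverse (c.spans_of_new_leaf hG (fun t ht => hK _ (by omega)) hA (by omega)
            (by rw [hS, hm, h1]) ?_ ?_ hGz hEz hz hp)
          · rw [Nat.sub_zero]; omega
          · rw [Nat.sub_self]; omega
      · exact (hfull.2 h.2).elim
    refine Spans.hasCopy ?_
    by_cases hu : c.syn u ≠ 0 → c.par u = 0 ∨ c.T' = c.T
    · by_cases hv : c.syn (flip u i) ≠ 0 → c.par (flip u i) = 0 ∨ c.T' = c.T
      · have hfull : ∀ w, (c.syn w ≠ 0 → c.par w = 0 ∨ c.T' = c.T) → c.syn w ≠ 0 →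
            ∀ x ∈ c.T, c.Edge x w := fun w h h0 x hx =>
          Or.inr (Or.inr ⟨h0, (h h0).elim (fun h => Or.inr ⟨hx, h⟩) fun h => Or.inl (by rwa [h])⟩)
        obtain ⟨q, hq, hroot⟩ := c.root_apart hE
        exact c.spans_of_two_arms hG hK (by omega) hT (j := j) (by omega) (by omega)
          (by rw [hS]; omega) (by rw [hS]; omega) (by omega) (by omega) hGuv (hfull u hu)
          (hfull _ hv) (fun h0 _ hi => hE (hfull u hu h0 i hi)) hq hroot
      · push Not at hv
        refine hleaf (flip u i) hv.1 ?_ hE' ?_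
        · rw [not_or]; exact hv.2
        · rw [flip_flip]; exact hGuv.symm
    · push Not at hu
      refine hleaf u hu.1 ?_ hE hGuv
      rw [not_or]; exact hu.2

lemma exists_scheme [Fintype A] (two : ∀ x : A, x + x = 0) {a τ τ' : ℕ} (hτ : τ' ≤ τ) :
    ∃ N : ℕ, ∀ n ≥ N, ∃ c : Scheme (Fin n) A,
      c.S.card = a ∧ c.T.card = τ ∧ c.T'.card = τ' := by
  classical
  let X := ({p : A // p ≠ 0} × ZMod 2) ⊕ (Fin a ⊕ Fin τ)
  refine ⟨Fintype.card X + 1, fun n hn => ?_⟩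
  obtain ⟨e⟩ : Nonempty (X ↪ Fin n) :=
    Function.Embedding.nonempty_of_card_le (by rw [Fintype.card_fin]; omega)
  let i₀ : Fin n := ⟨0, by omega⟩
  let lab : Fin n → A := Function.extend e (Sum.elim (fun x => (x.1 : A)) fun _ => 0) 0
  have hlab : ∀ x : X, lab (e x) = Sum.elim (fun x => (x.1 : A)) (fun _ => 0) x :=
    fun x => e.injective.extend_apply _ _ x
  let S : Finset (Fin n) := Finset.univ.map
    ⟨fun x : Fin a => e (Sum.inr (Sum.inl x)), fun _ _ h =>
      Sum.inl_injective (Sum.inr_injective (e.injective h))⟩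
  let T : Finset (Fin n) := Finset.univ.map
    ⟨fun x : Fin τ => e (Sum.inr (Sum.inr x)), fun _ _ h =>
      Sum.inr_injective (Sum.inr_injective (e.injective h))⟩
  have hScard : S.card = a := by simp [S]
  have hTcard : T.card = τ := by simp [T]
  have hSmem : ∀ i ∈ S, ∃ x : Fin a, e (Sum.inr (Sum.inl x)) = i := by
    intro i hi
    obtain ⟨x, _, h⟩ := Finset.mem_map.1 hi
    exact ⟨x, h⟩
  have hTmem : ∀ i ∈ T, ∃ x : Fin τ, e (Sum.inr (Sum.inr x)) = i := by
    intro i hi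
    obtain ⟨x, _, h⟩ := Finset.mem_map.1 hi
    exact ⟨x, h⟩
  obtain ⟨T', hT', hT'card⟩ := Finset.exists_subset_card_eq (s := T) (n := τ') (by omega)
  refine ⟨{
    add_self := two
    lab := lab
    coord := fun p ε => if h : p ≠ 0 then e (Sum.inl (⟨p, h⟩, ε)) else i₀
    lab_coord := fun p ε hp => by rw [dif_pos hp, hlab]; rfl
    coord_injective := fun p hp ε ε' h => by
      simp only [dif_pos hp] at h
      exact (Prod.ext_iff.1 (Sum.inl_injective (e.injective h))).2
    S := S
    T := T
    T' := T'
    lab_S := fun i hi => by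
      obtain ⟨x, rfl⟩ := hSmem i hi
      rw [hlab]; rfl
    lab_T := fun i hi => by
      obtain ⟨x, rfl⟩ := hTmem i hi
      rw [hlab]; rfl
    disj := fun i hi hi' => by
      obtain ⟨x, rfl⟩ := hTmem i hi
      obtain ⟨y, h⟩ := hSmem _ hi'
      exact Sum.inl_ne_inr (Sum.inr_injective (e.injective h))
    sub := hT' }, hScard, hTcard, hT'card⟩

end Scheme

end CubeSat

/-- upper bound on the saturation number of a caterpillar
`S_{k_1×⋯×k_m}`.  Here the paper's 1-based degrees `k_1, …, k_m` are
`k 0, …, k (m-1)`, and the paper's pair `(k_j, k_{j+1})` (1-based `j`) is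
`(k (j-1), k j)`.  The pair attains the minimum of `max` over all adjacent
pairs, `m = 2^a + b` with `2 ≤ b ≤ 2^a`, `b - 1 < j < 2^a`, and
`max(k_j, k_{j+1}) ≥ ⌊log₂ m⌋`. -/
theorem stmt6 (m : ℕ) (k : ℕ → ℕ) (hdeg : ∀ t < m, 2 ≤ k t)
    (a b : ℕ) (hm : m = 2 ^ a + b) (hb1 : 2 ≤ b) (hb2 : b ≤ 2 ^ a)
    (j : ℕ) (hj1 : 1 ≤ j) (hj2 : j ≤ m - 1)
    (hmin : ∀ t, 1 ≤ t → t ≤ m - 1 →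
      max (k (j - 1)) (k j) ≤ max (k (t - 1)) (k t))
    (hrange1 : b - 1 < j) (hrange2 : j < 2 ^ a)
    (hbig : Nat.log 2 m ≤ max (k (j - 1)) (k j)) :
    ∃ N : ℕ, ∀ n ≥ N,
      satNum (hypercube n) (caterpillar m k) ≤ max (k (j - 1)) (k j) * 2 ^ (n - 1) := by
  classical
  set d := max (k (j - 1)) (k j) with hd
  have hbj : b ≤ j := by omega
  have ha : 1 ≤ a := by
    rcases Nat.eq_zero_or_pos a with rfl | h
    · rw [pow_zero] at hrange2; omega
    · exact h
  have had : a ≤ d := (Nat.le_log_of_pow_le (by norm_num) (by omega)).trans hbig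
  have hd2 : 2 ≤ d := (hdeg j (by omega)).trans (le_max_right _ _)
  let K := (Finset.range m).sup k
  have hK : ∀ t < m, k t ≤ K := fun t ht => Finset.le_sup (f := k) (Finset.mem_range.2 ht)
  have hcard : Fintype.card (Fin (4 + K) → ZMod 2) = 2 ^ (4 + K) := by simp [ZMod.card]
  have hA : 4 + K ≤ Fintype.card (Fin (4 + K) → ZMod 2) := hcard ▸ Nat.lt_two_pow_self.le
  let τ := if b = 2 ∧ k 0 < d ∧ k (m - 1) < d then min (k 0) (k (m - 1)) - 2 else d - 2
  have hτ : τ ≤ d - 2 := by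
    simp only [τ]
    split_ifs <;> omega
  obtain ⟨N, hN⟩ := CubeSat.Scheme.exists_scheme (A := Fin (4 + K) → ZMod 2) (a := a)
    (fun x => funext fun i => CharTwo.add_self_eq_zero (x i)) hτ
  refine ⟨N + 1, fun n hn => ?_⟩
  obtain ⟨c, hS, hT, hT'⟩ := hN n (by omega)
  have hsat : IsSat (hypercube n) c.graph (caterpillar m k) := by
    refine c.isSat hm hb1 hbj hrange2 ha hdeg hd ?_ hK hA hS hT ?_
    · intro t ht
      simpa using hmin (t + 1) (by omega) (by omega)
    · by_cases h : b = 2 ∧ k 0 < d ∧ k (m - 1) < d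
      · simp only [τ, if_pos h] at hT'
        exact Or.inl ⟨h.1, h.2.1, h.2.2, hT'⟩
      · simp only [τ, if_neg h] at hT'
        exact Or.inr ⟨h, Finset.eq_of_subset_of_card_le c.sub (by omega)⟩
  have hedges := c.two_mul_card_edges_le hd2 (by omega) hT
  have hpow : 2 ^ n = 2 ^ (n - 1) * 2 := by
    rw [← pow_succ, Nat.sub_add_cancel (by omega : 1 ≤ n)]
  rw [Fintype.card_fin, hpow, ← mul_assoc] at hedges
  have hle : c.graph.edgeSet.ncard ≤ d * 2 ^ (n - 1) := by omega
  exact le_trans (Nat.sInf_le ⟨c.graph, hsat, rfl⟩) hle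
end

section
/- Let S_{k_1×⋯×k_m} be a caterpillar with all k_i ≥ 2 and m = 2^a + 1 for some integer a ≥ 1. Suppose the pair (k_i, k_{i+1}) attaining the minimum of max(k_t, k_{t+1}) over all adjacent pairs 1 ≤ t ≤ m−1 occurs at i = 1 or i = m−1, and that max(k_i, k_{i+1}) ≥ a. Then for all sufficiently large n, sat(Q_n, S_{k_1×⋯×k_m}) ≤ max(k_i, k_{i+1}) · 2^(n−1). -/
open SimpleGraph

/-- Copies of a caterpillar are copies of its reversal. -/
lemma HasCopy.reverse {V : Type*} {H : SimpleGraph V} {m : ℕ} {k k' : ℕ → ℕ}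
    (hk : ∀ j < m, k' j = k (m - 1 - j)) (h : HasCopy H (caterpillar m k)) :
    HasCopy H (caterpillar m k') := by
  obtain ⟨f, hf⟩ := h
  have hc : ∀ j : Fin m, k' (j : ℕ) - spineExtra m (j : ℕ) =
      k (j.rev : ℕ) - spineExtra m (j.rev : ℕ) := by
    intro j
    have h1 : (j.rev : ℕ) = m - 1 - j := by rw [Fin.val_rev]; omega
    rw [h1, hk j j.2]
    congr 1
    unfold spineExtra
    have := j.2
    split_ifs <;> omega
  let g : (Fin m ⊕ Σ i : Fin m, Fin (k' (i : ℕ) - spineExtra m (i : ℕ))) →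
      (Fin m ⊕ Σ i : Fin m, Fin (k (i : ℕ) - spineExtra m (i : ℕ))) :=
    Sum.map Fin.rev (fun p => ⟨p.1.rev, Fin.cast (hc p.1) p.2⟩)
  have hg : Function.Injective g := by
    apply Function.Injective.sumMap Fin.rev_injective
    rintro ⟨i, s⟩ ⟨j, t⟩ h
    simp only [Sigma.mk.injEq] at h
    obtain ⟨h1, h2⟩ := h
    obtain rfl := Fin.rev_injective h1
    simpa using h2
  refine ⟨⟨fun v => f (g v), ?_⟩, hf.comp hg⟩
  intro u v huv
  apply f.map_rel
  simp only [caterpillar, fromRel_adj] at huv ⊢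
  refine ⟨fun h => huv.1 (hg h), ?_⟩
  rcases u with u | u <;> rcases v with v | v <;> simp only [g, Sum.map_inl, Sum.map_inr] <;>
    simp only [Fin.val_rev, Fin.ext_iff] at huv ⊢
  · have := u.2; have := v.2; omega
  · have := huv.2.resolve_right id
    simp only [this, or_false]
  · have := huv.2.resolve_left id
    simp only [this, false_or]
  · simpa using huv.2

/-- A path with enough private neighbours at each vertex extends to a caterpillar. -/
lemma hasCopy_caterpillar_of_list {V : Type*} {H : SimpleGraph V} {m : ℕ} {k : ℕ → ℕ}
    (l : List V) (hl : l.length = m) (hnd : l.Nodup) (hch : l.IsChain H.Adj)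
    (L : V → Finset V) (hL : ∀ w ∈ l, ∀ z ∈ L w, H.Adj w z ∧ z ∉ l)
    (hdisj : ∀ w ∈ l, ∀ w' ∈ l, ∀ z ∈ L w, z ∈ L w' → w = w')
    (hcard : ∀ (j : ℕ) (hj : j < l.length), k j - spineExtra m j ≤ (L l[j]).card) :
    HasCopy H (caterpillar m k) := by
  subst hl
  have hem : ∀ j : Fin l.length, ∃ g : Fin (k (j : ℕ) - spineExtra l.length (j : ℕ)) → V,
      Function.Injective g ∧ ∀ t, g t ∈ L l[j] := by
    intro j
    have h1 := hcard j j.2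
    obtain ⟨T, hT, hTc⟩ := Finset.exists_subset_card_eq h1
    refine ⟨fun t => ((T.equivFinOfCardEq hTc).symm t : V), ?_, ?_⟩
    · exact Subtype.val_injective.comp (Equiv.injective _)
    · intro t
      exact hT ((T.equivFinOfCardEq hTc).symm t).2
  choose g hgi hgm using hem
  have hmem : ∀ j : Fin l.length, l[j] ∈ l := fun j => List.getElem_mem _
  let φ : (Fin l.length ⊕ Σ i : Fin l.length,
      Fin (k (i : ℕ) - spineExtra l.length (i : ℕ))) → V :=
    Sum.elim (fun j => l[j]) (fun p => g p.1 p.2)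
  have hinj : Function.Injective φ := by
    have hli : Function.Injective (fun j : Fin l.length => l[j]) := by
      intro i j hij
      exact Fin.ext ((List.Nodup.getElem_inj_iff hnd).1 hij)
    apply Function.Injective.sumElim hli
    · rintro ⟨i, s⟩ ⟨j, t⟩ h
      have h1 := hli (hdisj _ (hmem i) _ (hmem j) (g i s) (hgm i s)
        (by simp only at h; rw [h]; exact hgm j t))
      subst h1
      simpa using hgi i h
    · rintro i ⟨j, t⟩ h
      exact (hL _ (hmem j) _ (hgm j t)).2 (h ▸ hmem i)
  refine ⟨⟨φ, ?_⟩, hinj⟩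
  have hspine : ∀ i j : Fin l.length, (i : ℕ) + 1 = j → H.Adj l[i] l[j] := by
    intro i j h
    have h2 := List.isChain_iff_getElem.1 hch i (by omega)
    simpa [h] using h2
  intro u v huv
  simp only [caterpillar, fromRel_adj] at huv
  obtain ⟨-, huv⟩ := huv
  rcases u with i | ⟨i, s⟩ <;> rcases v with j | ⟨j, t⟩
  · exact huv.elim (hspine i j) (fun h => (hspine j i h).symm)
  · obtain rfl : i = j := huv.resolve_right id
    exact (hL _ (hmem i) _ (hgm i t)).1
  · obtain rfl : j = i := huv.resolve_left id
    exact (hL _ (hmem j) _ (hgm j s)).1.symm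
  · exact (huv.elim id id).elim

/-- The spine of a copy of a caterpillar, with its degree condition. -/
lemma HasCopy.exists_spine {V : Type*} [Fintype V] {H : SimpleGraph V} [DecidableRel H.Adj] {m : ℕ}
    {k : ℕ → ℕ} (h : HasCopy H (caterpillar m k)) :
    ∃ s : Fin m → V, Function.Injective s ∧
      (∀ i j : Fin m, (i : ℕ) + 1 = j → H.Adj (s i) (s j)) ∧ ∀ j : Fin m, k j ≤ H.degree (s j) := by
  classical
  obtain ⟨f, hf⟩ := h
  refine ⟨fun j => f (Sum.inl j), hf.comp Sum.inl_injective, ?_, ?_⟩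
  · intro i j hij
    apply f.map_rel
    simp only [caterpillar, fromRel_adj]
    exact ⟨by intro h; rw [Sum.inl.injEq] at h; subst h; omega, Or.inl hij⟩
  · intro j
    let P : Finset (Fin m) := Finset.univ.filter (fun i : Fin m => (i : ℕ) + 1 = j ∨ (j : ℕ) + 1 = i)
    have hP : spineExtra m j ≤ P.card := by
      have hj := j.2
      have h1 : (if (j : ℕ) = 0 then 0 else 1) =
          (Finset.univ.filter (fun i : Fin m => (i : ℕ) + 1 = j)).card := by
        split_ifs with h0
        · symm; rw [Finset.card_eq_zero, Finset.filter_eq_empty_iff]; intro i _; omega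
        · symm; rw [Finset.card_eq_one]
          refine ⟨⟨j - 1, by omega⟩, ?_⟩
          ext i; simp [Fin.ext_iff]; omega
      have h2 : (if (j : ℕ) = m - 1 then 0 else 1) =
          (Finset.univ.filter (fun i : Fin m => (j : ℕ) + 1 = i)).card := by
        split_ifs with h0
        · symm; rw [Finset.card_eq_zero, Finset.filter_eq_empty_iff]; intro i _; omega
        · symm; rw [Finset.card_eq_one]
          refine ⟨⟨j + 1, by omega⟩, ?_⟩
          ext i; simp [Fin.ext_iff]; omega
      unfold spineExtra
      rw [h1, h2, ← Finset.card_union_of_disjoint, ← Finset.filter_or]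
      rw [Finset.disjoint_filter]; intro i _ _; omega
    have hsub : (P.disjSum ((Finset.univ : Finset (Fin (k j - spineExtra m j))).map
        ⟨Sigma.mk j, sigma_mk_injective⟩)).image f ⊆ H.neighborFinset (f (Sum.inl j)) := by
      intro w hw
      rw [Finset.mem_image] at hw
      obtain ⟨v, hv, rfl⟩ := hw
      rw [mem_neighborFinset]
      apply f.map_rel
      simp only [caterpillar, fromRel_adj]
      rw [Finset.mem_disjSum] at hv
      rcases hv with ⟨i, hi, rfl⟩ | ⟨p, hp, rfl⟩
      · simp only [P, Finset.mem_filter, Finset.mem_univ, true_and] at hi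
        exact ⟨by intro h; rw [Sum.inl.injEq] at h; subst h; omega, hi.symm⟩
      · simp only [Finset.mem_map, Finset.mem_univ, true_and] at hp
        obtain ⟨t, rfl⟩ := hp
        exact ⟨by simp, Or.inl rfl⟩
    have := Finset.card_le_card hsub
    rw [Finset.card_image_of_injective _ hf, Finset.card_disjSum, Finset.card_map, Finset.card_univ,
      Fintype.card_fin, card_neighborFinset_eq_degree] at this
    change k j ≤ H.degree (f (Sum.inl j))
    omega

/-- A saturated subgraph of an isomorphic host bounds the saturation number. -/
lemma satNum_le_of_iso {V V' W : Type*} {Host : SimpleGraph V} {Host' : SimpleGraph V'}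
    {G : SimpleGraph W} (e : Host ≃g Host') {H : SimpleGraph V'} (hs : IsSat Host' H G) :
    satNum Host G ≤ H.edgeSet.ncard := by
  obtain ⟨hle, hno, hadd⟩ := hs
  let φ : H.comap e ≃g H := ⟨e.toEquiv, Iff.rfl⟩
  refine Nat.sInf_le ⟨H.comap e, ⟨?_, ?_, ?_⟩, Nat.card_congr φ.mapEdgeSet⟩
  · intro u v huv
    exact e.map_rel_iff.1 (hle huv)
  · rintro ⟨f, hf⟩
    exact hno ⟨φ.toHom.comp f, φ.injective.comp hf⟩
  · intro u v huv hn
    obtain ⟨f, hf⟩ := hadd (e u) (e v) (e.map_rel_iff.2 huv) hn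
    refine ⟨⟨fun w => e.symm (f w), ?_⟩, e.symm.injective.comp hf⟩
    intro a b hab
    have h := f.map_rel hab
    simp only [sup_adj, fromEdgeSet_adj, comap_adj, Set.mem_singleton_iff, Sym2.eq_iff] at h ⊢
    simpa [RelIso.symm_apply_eq, e.symm.injective.eq_iff] using h

/-- A path of hubs from the component `c`, given as a list. -/
structure IsHubPath {B κ : Type*} (Q : SimpleGraph B) (hub : B → Prop) (comp : B → κ) (c : κ)
    (l : List B) : Prop where
  nodup : l.Nodup
  chain : l.IsChain Q.Adj
  hub : ∀ b ∈ l, hub b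
  comp : ∀ b ∈ l, comp b = c

/-- A distinguished set of vertices (hubs) of `Q`, split into small components, such that the other
vertices are assigned to adjacent hubs. Each non-edge of the graph built from these data is
critical; `strict` says that the first vertex of the caterpillar has the largest allowed degree. -/
structure HubSystem {B κ : Type*} (Q : SimpleGraph B) (p r M K : ℕ) (strict : Prop)
    (hub : B → Prop) (comp : B → κ) (asg : B → Option B) : Prop where
  asg_hub : ∀ b h, ¬ hub b → asg b = some h → hub h ∧ Q.Adj b h
  many : ∀ h, hub h → ∃ T : Finset B, M ≤ T.card ∧ ∀ b ∈ T, ¬ hub b ∧ asg b = some h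
  size : ∀ c l, IsHubPath Q hub comp c l → l.length ≤ p
  deg : ∀ h, hub h → ∀ T : Finset B, (∀ b ∈ T, hub b ∧ comp b = comp h ∧ Q.Adj h b) → T.card ≤ K
  path : ∀ h, hub h → ∃ l, IsHubPath Q hub comp (comp h) (h :: l) ∧ r ≤ (h :: l).length
  low_low : ∀ u v, ¬ hub u → ¬ hub v → Q.Adj u v → ∃ a b, (a = u ∧ b = v ∨ a = v ∧ b = u) ∧
    ∃ h, asg b = some h ∧ (∃ l, IsHubPath Q hub comp (comp h) (h :: l) ∧ (h :: l).length = p) ∧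
      (strict → ∃ h', asg a = some h' ∧ comp h' ≠ comp h)
  low_hub : ∀ u h, ¬ hub u → hub h → Q.Adj u h → asg u ≠ some h →
    (∃ l, IsHubPath Q hub comp (comp h) (h :: l) ∧ (h :: l).length = p) ∧
      ∃ h', asg u = some h' ∧ comp h' ≠ comp h

/-- The graph built from a hub system and a regular graph `F`. -/
def hubGraph {B κ Y : Type*} (Q : SimpleGraph B) (hub : B → Prop) (comp : B → κ)
    (asg : B → Option B) (F : SimpleGraph Y) : SimpleGraph (B × Y) where
  Adj v w := (¬ hub v.1 ∧ v.1 = w.1 ∧ F.Adj v.2 w.2) ∨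
    (v.2 = w.2 ∧ ((hub v.1 ∧ hub w.1 ∧ comp v.1 = comp w.1 ∧ Q.Adj v.1 w.1) ∨
      (¬ hub v.1 ∧ asg v.1 = some w.1 ∧ hub w.1) ∨ (¬ hub w.1 ∧ asg w.1 = some v.1 ∧ hub v.1)))
  symm := ⟨by
    rintro v w (⟨h1, h2, h3⟩ | ⟨h1, h⟩)
    · exact Or.inl ⟨h2 ▸ h1, h2.symm, h3.symm⟩
    · refine Or.inr ⟨h1.symm, ?_⟩
      rcases h with ⟨h2, h3, h4, h5⟩ | h | h
      · exact Or.inl ⟨h3, h2, h4.symm, h5.symm⟩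
      · exact Or.inr (Or.inr h)
      · exact Or.inr (Or.inl h)⟩
  loopless := ⟨by
    rintro v (⟨_, _, h⟩ | ⟨_, ⟨_, _, _, h⟩ | ⟨h, _, h'⟩ | ⟨h, _, h'⟩⟩)
    · exact F.loopless.irrefl _ h
    · exact Q.loopless.irrefl _ h
    · exact h h'
    · exact h h'⟩

/-- A path whose vertices outside the hubs lie over different base vertices. -/
structure IsSpine {B Y : Type*} (hub : B → Prop) (H : SimpleGraph (B × Y)) (l : List (B × Y)) :
    Prop where
  nodup : l.Nodup
  chain : l.IsChain H.Adj
  key : ∀ v ∈ l, ∀ w ∈ l, ¬ hub v.1 → v.1 = w.1 → v = w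

/-- Numerical relations between a caterpillar and the parameters of a hub system. -/
structure CaterpillarParams (m : ℕ) (k : ℕ → ℕ) (p r M K : ℕ) : Prop where
  two_le : 2 ≤ K
  three_le : 3 ≤ m
  four_le : k (m - 1) < K → 4 ≤ m
  size : p + 1 + (if k 0 < K then 1 else 0) + (if k (m - 1) < K then 1 else 0) ≤ m
  stem : m ≤ p + 2 + (if k (m - 1) < K then 1 else 0)
  double : m ≤ 2 * r + (if k 0 < K then 1 else 0) + (if k (m - 1) < K then 1 else 0)
  first : k 0 ≤ K
  second : k 1 ≤ K
  adjacent : ∀ t, t + 1 < m → K ≤ max (k t) (k (t + 1))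
  many : ∀ j < m, m + k j < M

section HubSystem

variable {B κ Y : Type*} {Q : SimpleGraph B} {p r M K m : ℕ} {k : ℕ → ℕ} {strict : Prop}
  {hub : B → Prop} {comp : B → κ} {asg : B → Option B} {F : SimpleGraph Y}
  {H' : SimpleGraph (B × Y)}

lemma IsSpine.reverse {l : List (B × Y)} (h : IsSpine hub H' l) : IsSpine hub H' l.reverse where
  nodup := List.nodup_reverse.2 h.nodup
  chain := by
    rw [List.isChain_reverse]
    exact h.chain.imp fun _ _ h => h.symm
  key v hv w hw := h.key v (List.mem_reverse.1 hv) w (List.mem_reverse.1 hw)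

lemma IsSpine.take {l : List (B × Y)} (h : IsSpine hub H' l) (n : ℕ) :
    IsSpine hub H' (l.take n) where
  nodup := h.nodup.sublist (List.take_sublist _ _)
  chain := h.chain.take n
  key v hv w hw := h.key v (List.mem_of_mem_take hv) w (List.mem_of_mem_take hw)

lemma HubSystem.exists_cons (S : HubSystem Q p r M K strict hub comp asg)
    (hH : hubGraph Q hub comp asg F ≤ H') {h : B × Y} {l : List (B × Y)}
    (hs : IsSpine hub H' (h :: l)) (hh : hub h.1) (hl : (h :: l).length < M) :
    ∃ e, ¬ hub e.1 ∧ IsSpine hub H' (e :: h :: l) := by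
  classical
  obtain ⟨T, hT, hTm⟩ := S.many _ hh
  obtain ⟨b, hbT, hb⟩ : ∃ b ∈ T, b ∉ ((h :: l).map Prod.fst).toFinset := by
    apply Finset.exists_mem_notMem_of_card_lt_card
    refine lt_of_le_of_lt (List.toFinset_card_le _) ?_
    rw [List.length_map]
    omega
  obtain ⟨hb1, hb2⟩ := hTm b hbT
  have hne : ∀ v ∈ h :: l, v.1 ≠ b := by
    rintro v hv rfl
    exact hb (List.mem_toFinset.2 (List.mem_map_of_mem hv))
  refine ⟨(b, h.2), hb1, ?_, ?_, ?_⟩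
  · exact List.nodup_cons.2 ⟨fun hm => hne _ hm rfl, hs.nodup⟩
  · rw [List.isChain_cons_cons]
    exact ⟨hH (Or.inr ⟨rfl, Or.inr (Or.inl ⟨hb1, hb2, hh⟩)⟩), hs.chain⟩
  · intro v hv w hw hv1 hvw
    rcases List.mem_cons.1 hv with rfl | hv <;> rcases List.mem_cons.1 hw with rfl | hw
    · rfl
    · exact (hne _ hw hvw.symm).elim
    · exact (hne _ hv hvw).elim
    · exact hs.key v hv w hw hv1 hvw

lemma HubSystem.exists_concat (S : HubSystem Q p r M K strict hub comp asg)
    (hH : hubGraph Q hub comp asg F ≤ H') {h : B × Y} {l : List (B × Y)}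
    (hs : IsSpine hub H' (l ++ [h])) (hh : hub h.1) (hl : (l ++ [h]).length < M) :
    ∃ e, ¬ hub e.1 ∧ IsSpine hub H' (l ++ [h] ++ [e]) := by
  have hs' := hs.reverse
  rw [List.reverse_append, List.reverse_singleton, List.singleton_append] at hs'
  obtain ⟨e, he, hse⟩ := S.exists_cons hH hs' hh (by simpa using hl)
  exact ⟨e, he, by simpa using hse.reverse⟩

/-- A spine whose vertices outside the hubs have small prescribed degree extends to a caterpillar;
at the vertex `u` the extra neighbours `E` may be used. -/
lemma HubSystem.hasCopy_of_spine [Fintype Y] [DecidableRel F.Adj]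
    (S : HubSystem Q p r M K strict hub comp asg) (N : CaterpillarParams m k p r M K)
    (hF : F.IsRegularOfDegree (K - 2)) (hH : hubGraph Q hub comp asg F ≤ H')
    {l : List (B × Y)} (hs : IsSpine hub H' l) (hl : l.length = m) (u : B × Y)
    (E : Finset (B × Y)) (hE : ∀ x ∈ E, hub x.1 ∧ H'.Adj u x ∧ x ∉ l)
    (hlow : ∀ (j : ℕ) (hj : j < l.length), ¬ hub l[j].1 →
      k j - spineExtra m j ≤ K - 2 ∨ l[j] = u ∧ k j - spineExtra m j ≤ K - 2 + E.card) :
    HasCopy H' (caterpillar m k) := by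
  classical
  choose! T hT hTm using S.many
  let keys := (l.map Prod.fst).toFinset
  let L : B × Y → Finset (B × Y) := fun w => if hub w.1 then
      ((T w.1).filter (· ∉ keys)).image (fun b => (b, w.2))
    else (F.neighborFinset w.2).image (fun y => (w.1, y)) ∪ if w = u then E else ∅
  have hkey : ∀ v ∈ l, v.1 ∈ keys := fun v hv => List.mem_toFinset.2 (List.mem_map_of_mem hv)
  have memHub : ∀ w z, hub w.1 → z ∈ L w →
      ¬ hub z.1 ∧ asg z.1 = some w.1 ∧ z.1 ∉ keys ∧ z.2 = w.2 := by
    intro w z hw hz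
    simp only [L, hw, if_true, Finset.mem_image, Finset.mem_filter] at hz
    obtain ⟨b, ⟨hb, hb'⟩, rfl⟩ := hz
    exact ⟨(hTm _ hw b hb).1, (hTm _ hw b hb).2, hb', rfl⟩
  have memLow : ∀ w z, ¬ hub w.1 → z ∈ L w →
      z.1 = w.1 ∧ F.Adj w.2 z.2 ∨ w = u ∧ z ∈ E := by
    intro w z hw hz
    simp only [L, hw, if_false, Finset.mem_union, Finset.mem_image, mem_neighborFinset] at hz
    rcases hz with ⟨y, hy, rfl⟩ | hz
    · exact Or.inl ⟨rfl, hy⟩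
    · split_ifs at hz with h
      · exact Or.inr ⟨h, hz⟩
      · simp at hz
  refine hasCopy_caterpillar_of_list l hl hs.nodup hs.chain L ?_ ?_ ?_
  · intro w hw z hz
    by_cases hwh : hub w.1
    · obtain ⟨h1, h2, h3, h4⟩ := memHub w z hwh hz
      exact ⟨hH (Or.inr ⟨h4.symm, Or.inr (Or.inr ⟨h1, h2, hwh⟩)⟩), fun h => h3 (hkey _ h)⟩
    · rcases memLow w z hwh hz with ⟨h1, h2⟩ | ⟨rfl, h⟩
      · refine ⟨hH (Or.inl ⟨hwh, h1.symm, h2⟩), fun h => ?_⟩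
        have := hs.key w hw z h hwh h1.symm
        rw [this] at h2
        exact F.loopless.irrefl _ h2
      · exact (hE z h).2
  · intro w hw w' hw' z hz hz'
    by_cases hwh : hub w.1 <;> by_cases hwh' : hub w'.1
    · obtain ⟨-, h2, -, h4⟩ := memHub w z hwh hz
      obtain ⟨-, h2', -, h4'⟩ := memHub w' z hwh' hz'
      exact Prod.ext (Option.some_injective _ (h2.symm.trans h2')) (h4.symm.trans h4')
    · obtain ⟨h1, h2, h3, h4⟩ := memHub w z hwh hz
      rcases memLow w' z hwh' hz' with ⟨h5, -⟩ | ⟨-, h5⟩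
      · exact (h3 (h5 ▸ hkey _ hw')).elim
      · exact (h1 (hE z h5).1).elim
    · obtain ⟨h1, h2, h3, h4⟩ := memHub w' z hwh' hz'
      rcases memLow w z hwh hz with ⟨h5, -⟩ | ⟨-, h5⟩
      · exact (h3 (h5 ▸ hkey _ hw)).elim
      · exact (h1 (hE z h5).1).elim
    · rcases memLow w z hwh hz with ⟨h1, h2⟩ | ⟨rfl, h⟩ <;>
        rcases memLow w' z hwh' hz' with ⟨h1', h2'⟩ | ⟨rfl, h'⟩
      · exact hs.key w hw w' hw' hwh (h1.symm.trans h1')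
      · exact (hwh (h1 ▸ (hE z h').1)).elim
      · exact (hwh' (h1' ▸ (hE z h).1)).elim
      · rfl
  · intro j hj
    by_cases hh : hub l[j].1
    · have h1 : (L l[j]).card = ((T l[j].1).filter (· ∉ keys)).card := by
        simp only [L, hh, if_true]
        exact Finset.card_image_of_injective _ fun a b h => (Prod.ext_iff.1 h).1
      have h2 : (T l[j].1).card ≤ ((T l[j].1).filter (· ∉ keys)).card + keys.card := by
        rw [Finset.filter_notMem_eq_sdiff]
        exact Finset.card_le_card_sdiff_add_card
      have h3 : keys.card ≤ m := (List.toFinset_card_le _).trans (by simp [hl])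
      have h4 := hT _ hh
      have h5 := N.many j (hl ▸ hj)
      omega
    · have hc : ((F.neighborFinset l[j].2).image (fun y => (l[j].1, y))).card = K - 2 := by
        rw [Finset.card_image_of_injective _ fun a b h => (Prod.ext_iff.1 h).2,
          card_neighborFinset_eq_degree, hF]
      have hL : L l[j] = (F.neighborFinset l[j].2).image (fun y => (l[j].1, y)) ∪
          if l[j] = u then E else ∅ := by simp only [L, hh, if_false]
      rcases hlow j hj hh with h | ⟨h, h'⟩
      · refine h.trans (hc ▸ Finset.card_le_card ?_)
        rw [hL]
        exact Finset.subset_union_left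
      · rw [hL, if_pos h, Finset.card_union_of_disjoint, hc]
        · exact h'
        · rw [Finset.disjoint_left]
          intro z hz hzE
          obtain ⟨y, -, rfl⟩ := Finset.mem_image.1 hz
          exact hh (hE _ hzE).1


lemma IsHubPath.isSpine_map {c : κ} {l : List B} (hl : IsHubPath Q hub comp c l)
    (hH : hubGraph Q hub comp asg F ≤ H') (y : Y) : IsSpine hub H' (l.map fun b => (b, y)) where
  nodup := hl.nodup.map fun a b h => (Prod.ext_iff.1 h).1
  chain := by
    rw [List.isChain_map]
    refine hl.chain.imp_of_mem_imp fun a b ha hb hab => ?_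
    exact hH (Or.inr ⟨rfl, Or.inl ⟨hl.hub a ha, hl.hub b hb,
      (hl.comp a ha).trans (hl.comp b hb).symm, hab⟩⟩)
  key v hv w hw hv1 _ := by
    obtain ⟨b, hb, rfl⟩ := List.mem_map.1 hv
    exact (hv1 (hl.hub b hb)).elim

/-- A spine starting with two vertices of small degree and continuing through a component. -/
lemma HubSystem.hasCopy_of_stem [Fintype Y] [DecidableRel F.Adj]
    (S : HubSystem Q p r M K strict hub comp asg) (N : CaterpillarParams m k p r M K)
    (hF : F.IsRegularOfDegree (K - 2)) (hH : hubGraph Q hub comp asg F ≤ H')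
    {u v : B × Y} {P : List (B × Y)} (hs : IsSpine hub H' (u :: v :: P)) (hP : P.length = p)
    (hhub : ∀ b ∈ P, hub b.1) (E : Finset (B × Y))
    (hE : ∀ x ∈ E, hub x.1 ∧ H'.Adj u x ∧ x ∉ u :: v :: P)
    (hu : ¬ hub u.1 → k 0 - 1 ≤ K - 2 + E.card) : HasCopy H' (caterpillar m k) := by
  have N3 := N.three_le
  have N4 := N.four_le
  have Ns := N.stem
  have e0 : spineExtra m 0 = 1 := by unfold spineExtra; split_ifs <;> omega
  have e1 : spineExtra m (0 + 1) = 2 := by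
    unfold spineExtra
    rw [if_neg (by omega), if_neg (by omega)]
  have em : spineExtra m (m - 1) = 1 := by unfold spineExtra; split_ifs <;> omega
  have N1 : k (0 + 1) ≤ K := N.second
  by_cases hm : k (m - 1) < K
  · have h4 := N4 hm
    have hp : m - 3 ≤ p := by
      rw [if_pos hm] at Ns
      omega
    obtain ⟨P', h, hPh⟩ : ∃ P' h, P.take (m - 3) = P' ++ [h] := by
      rcases List.eq_nil_or_concat (P.take (m - 3)) with h | ⟨P', h, hh⟩
      · have := congrArg List.length h
        rw [List.length_take, List.length_nil] at this
        omega
      · exact ⟨P', h, by simpa using hh⟩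
    have htake : (u :: v :: P).take (m - 1) = u :: v :: P' ++ [h] := by
      obtain ⟨r, rfl⟩ : ∃ r, m = r + 3 := ⟨m - 3, by omega⟩
      have h2 : r + 3 - 1 = r + 1 + 1 := by omega
      rw [h2, List.take_succ_cons, List.take_succ_cons]
      have h3 : r + 3 - 3 = r := by omega
      rw [h3] at hPh
      rw [hPh]
      rfl
    have hP'l : P'.length + 1 = m - 3 := by
      have := congrArg List.length hPh
      rw [List.length_take, List.length_append, List.length_singleton] at this
      omega
    have hsub : ∀ b ∈ P' ++ [h], b ∈ P := fun b hb => List.mem_of_mem_take (hPh ▸ hb)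
    have hs' := hs.take (m - 1)
    rw [htake] at hs'
    obtain ⟨e, he, hse⟩ := S.exists_concat hH hs' (hhub h (hsub h (by simp))) (by
      have := N.many 0 (by omega)
      simp only [List.length_append, List.length_cons, List.length_nil]
      omega)
    refine S.hasCopy_of_spine N hF hH hse (by simp; omega) u E ?_ ?_
    · intro x hx
      obtain ⟨h1, h2, h3⟩ := hE x hx
      refine ⟨h1, h2, ?_⟩
      rw [← htake]
      intro hmem
      rcases List.mem_append.1 hmem with hmem | hmem
      · exact h3 (List.mem_of_mem_take hmem)
      · rw [List.mem_singleton.1 hmem] at h1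
        exact he h1
    · intro j hj hl
      have hjm : j < m := by
        have : (u :: v :: P' ++ [h] ++ [e]).length = m := by simp; omega
        omega
      rcases j with _ | _ | j
      · right
        rw [e0]
        exact ⟨rfl, hu hl⟩
      · left
        rw [e1]
        omega
      · by_cases hjl : j < (P' ++ [h]).length
        · refine (hl (hhub _ (hsub _ ?_))).elim
          have : (u :: v :: P' ++ [h] ++ [e])[j + 1 + 1] = (P' ++ [h])[j] := by
            simp only [List.cons_append, List.getElem_cons_succ]
            rw [List.getElem_append_left hjl]
          rw [this]
          exact List.getElem_mem _
        · left
          have : j + 1 + 1 = m - 1 := by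
            simp only [List.length_append, List.length_singleton] at hjl
            omega
          rw [this, em]
          omega
  · have hp : m - 2 ≤ p := by
      rw [if_neg hm] at Ns
      omega
    refine S.hasCopy_of_spine N hF hH (hs.take m) (by simp; omega) u E ?_ ?_
    · intro x hx
      obtain ⟨h1, h2, h3⟩ := hE x hx
      exact ⟨h1, h2, fun h => h3 (List.mem_of_mem_take h)⟩
    · intro j hj hl
      rw [List.getElem_take] at hl ⊢
      rcases j with _ | _ | j
      · right
        rw [e0]
        exact ⟨rfl, hu hl⟩
      · left
        rw [e1]
        omega
      · exact (hl (hhub _ (by simp))).elim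

lemma HubSystem.hasCopy_of_low_low [Fintype Y] [DecidableRel F.Adj]
    (S : HubSystem Q p r M K strict hub comp asg) (N : CaterpillarParams m k p r M K)
    (hstrict : k 0 = K → strict)
    (hF : F.IsRegularOfDegree (K - 2)) (hH : hubGraph Q hub comp asg F ≤ H')
    {u v : B} {y : Y} (hu : ¬ hub u) (hv : ¬ hub v) (huv : Q.Adj u v)
    (hadj : H'.Adj (u, y) (v, y)) : HasCopy H' (caterpillar m k) := by
  classical
  obtain ⟨a, b, hab, h, hbh, ⟨l, hl, hlp⟩, hst⟩ := S.low_low u v hu hv huv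
  have ha : ¬ hub a := by rcases hab with ⟨rfl, -⟩ | ⟨rfl, -⟩ <;> assumption
  have hb : ¬ hub b := by rcases hab with ⟨-, rfl⟩ | ⟨-, rfl⟩ <;> assumption
  have hne : a ≠ b := by
    rcases hab with ⟨rfl, rfl⟩ | ⟨rfl, rfl⟩
    exacts [huv.ne, huv.ne.symm]
  have hadj' : H'.Adj (a, y) (b, y) := by
    rcases hab with ⟨rfl, rfl⟩ | ⟨rfl, rfl⟩
    exacts [hadj, hadj.symm]
  have hlm := hl.isSpine_map hH y
  have low_notMem : ∀ c, ¬ hub c → (c, y) ∉ (h :: l).map fun b => (b, y) := by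
    intro c hc hm
    obtain ⟨d, hd, hdc⟩ := List.mem_map.1 hm
    exact hc ((Prod.mk.inj hdc).1 ▸ hl.hub d hd)
  have hs : IsSpine hub H' ((a, y) :: (b, y) :: (h :: l).map fun b => (b, y)) := by
    refine ⟨?_, ?_, ?_⟩
    · rw [List.nodup_cons, List.nodup_cons]
      refine ⟨?_, low_notMem b hb, hlm.nodup⟩
      rw [List.mem_cons, not_or]
      exact ⟨fun h => hne (Prod.ext_iff.1 h).1, low_notMem a ha⟩
    · rw [List.isChain_cons_cons, List.map_cons, List.isChain_cons_cons]
      exact ⟨hadj', hH (Or.inr ⟨rfl, Or.inr (Or.inl ⟨hb, hbh, (S.asg_hub b h hb hbh).1⟩)⟩),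
        hlm.chain⟩
    · intro v _ w _ _ hvw
      refine Prod.ext hvw ?_
      have : ∀ v ∈ (a, y) :: (b, y) :: (h :: l).map (fun b => (b, y)), v.2 = y := by
        intro v hv
        simp only [List.mem_cons, List.mem_map] at hv
        rcases hv with rfl | rfl | ⟨c, -, rfl⟩ <;> rfl
      rw [this v ‹_›, this w ‹_›]
  have hhub : ∀ c ∈ (h :: l).map (fun b => (b, y)), hub c.1 := by
    intro c hc
    obtain ⟨d, hd, rfl⟩ := List.mem_map.1 hc
    exact hl.hub d hd
  have N0 := N.first
  have N2 := N.two_le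
  by_cases hk : k 0 = K
  · obtain ⟨h', hah', hne'⟩ := hst (hstrict hk)
    have hh' := (S.asg_hub a h' ha hah').1
    refine S.hasCopy_of_stem N hF hH hs (by simpa using hlp) hhub {(h', y)} ?_
      (fun _ => by rw [Finset.card_singleton]; omega)
    intro x hx
    rw [Finset.mem_singleton.1 hx]
    refine ⟨hh', hH (Or.inr ⟨rfl, Or.inr (Or.inl ⟨ha, hah', hh'⟩)⟩), ?_⟩
    rw [List.mem_cons, List.mem_cons, not_or, not_or]
    refine ⟨fun h => ha ((Prod.mk.inj h).1 ▸ hh'), fun h => hb ((Prod.mk.inj h).1 ▸ hh'), ?_⟩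
    intro hm
    obtain ⟨d, hd, hdc⟩ := List.mem_map.1 hm
    obtain rfl := (Prod.mk.inj hdc).1
    exact hne' (hl.comp _ hd)
  · exact S.hasCopy_of_stem N hF hH hs (by simpa using hlp) hhub ∅ (by simp) (fun _ => by omega)

lemma HubSystem.hasCopy_of_low_hub [Fintype Y] [DecidableRel F.Adj]
    (S : HubSystem Q p r M K strict hub comp asg) (N : CaterpillarParams m k p r M K)
    (hF : F.IsRegularOfDegree (K - 2)) (hH : hubGraph Q hub comp asg F ≤ H')
    {u h : B} {y : Y} (hu : ¬ hub u) (hh : hub h) (huh : Q.Adj u h) (hn : asg u ≠ some h)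
    (hadj : H'.Adj (u, y) (h, y)) : HasCopy H' (caterpillar m k) := by
  obtain ⟨⟨l, hl, hlp⟩, h', huh', hne⟩ := S.low_hub u h hu hh huh hn
  have hh' := (S.asg_hub u h' hu huh').1
  have hlm := hl.isSpine_map hH y
  have hs : IsSpine hub H' ((h', y) :: (u, y) :: (h :: l).map fun b => (b, y)) := by
    refine ⟨?_, ?_, ?_⟩
    · rw [List.nodup_cons, List.nodup_cons, List.mem_cons, not_or]
      refine ⟨⟨fun h => hu ((Prod.mk.inj h).1 ▸ hh'), ?_⟩, ?_, hlm.nodup⟩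
      · intro hm
        obtain ⟨d, hd, hdc⟩ := List.mem_map.1 hm
        obtain rfl := (Prod.mk.inj hdc).1
        exact hne (hl.comp _ hd)
      · intro hm
        obtain ⟨d, hd, hdc⟩ := List.mem_map.1 hm
        exact hu ((Prod.mk.inj hdc).1 ▸ hl.hub d hd)
    · rw [List.isChain_cons_cons, List.map_cons, List.isChain_cons_cons]
      exact ⟨hH (Or.inr ⟨rfl, Or.inr (Or.inr ⟨hu, huh', hh'⟩)⟩), hadj, hlm.chain⟩
    · have : ∀ v ∈ (h', y) :: (u, y) :: (h :: l).map (fun b => (b, y)), v.2 = y := by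
        intro v hv
        simp only [List.mem_cons, List.mem_map] at hv
        rcases hv with rfl | rfl | ⟨c, -, rfl⟩ <;> rfl
      intro v hv w hw _ hvw
      exact Prod.ext hvw (by rw [this v hv, this w hw])
  refine S.hasCopy_of_stem N hF hH hs (by simpa using hlp) ?_ ∅ (by simp) (fun h => (h hh').elim)
  intro c hc
  obtain ⟨d, hd, rfl⟩ := List.mem_map.1 hc
  exact hl.hub d hd

/-- From each vertex of a path starts a path covering at least half of it. -/
lemma IsHubPath.exists_half {c : κ} {l : List B} (hl : IsHubPath Q hub comp c l) {h : B}
    (hm : h ∈ l) :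
    ∃ l', IsHubPath Q hub comp c (h :: l') ∧ l.length + 1 ≤ 2 * (h :: l').length := by
  obtain ⟨l₁, l₂, rfl⟩ := List.append_of_mem hm
  rcases le_total l₁.length l₂.length with hle | hle
  · refine ⟨l₂, ⟨(List.nodup_append.1 hl.nodup).2.1, (List.isChain_append.1 hl.chain).2.1,
      fun b hb => hl.hub b (List.mem_append_right _ hb),
      fun b hb => hl.comp b (List.mem_append_right _ hb)⟩, ?_⟩
    simp only [List.length_append, List.length_cons]
    omega
  · have hsplit : l₁ ++ h :: l₂ = (l₁ ++ [h]) ++ l₂ := by simp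
    have hmem : ∀ b ∈ h :: l₁.reverse, b ∈ l₁ ++ h :: l₂ := by
      intro b hb
      simp only [List.mem_cons, List.mem_reverse, List.mem_append] at hb ⊢
      tauto
    have hrev : h :: l₁.reverse = (l₁ ++ [h]).reverse := by simp
    refine ⟨l₁.reverse, ⟨?_, ?_, fun b hb => hl.hub b (hmem b hb),
      fun b hb => hl.comp b (hmem b hb)⟩, ?_⟩
    · rw [hrev, List.nodup_reverse]
      have := hl.nodup
      rw [hsplit] at this
      exact (List.nodup_append.1 this).1
    · rw [hrev, List.isChain_reverse]
      have := hl.chain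
      rw [hsplit] at this
      exact (List.isChain_append.1 this).1.imp fun _ _ h => h.symm
    · simp only [List.length_append, List.length_cons, List.length_reverse]
      omega

lemma HubSystem.hasCopy_of_hub_hub [Fintype Y] [DecidableRel F.Adj]
    (S : HubSystem Q p r M K strict hub comp asg) (N : CaterpillarParams m k p r M K)
    (hF : F.IsRegularOfDegree (K - 2)) (hH : hubGraph Q hub comp asg F ≤ H')
    {v w : B × Y} (hv : hub v.1) (hw : hub w.1) (hne : comp v.1 ≠ comp w.1 ∨ v.2 ≠ w.2)
    (hadj : H'.Adj v w) : HasCopy H' (caterpillar m k) := by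
  obtain ⟨l₁, h₁, hl₁⟩ := S.path _ hv
  obtain ⟨l₂, h₂, hl₂⟩ := S.path _ hw
  have s₁ := h₁.isSpine_map hH v.2
  have s₂ := h₂.isSpine_map hH w.2
  set T := ((v.1 :: l₁).map fun b => (b, v.2)).reverse ++ (w.1 :: l₂).map fun b => (b, w.2) with hT
  have hThub : ∀ t ∈ T, hub t.1 := by
    intro t ht
    rcases List.mem_append.1 ht with ht | ht
    · obtain ⟨b, hb, rfl⟩ := List.mem_map.1 (List.mem_reverse.1 ht)
      exact h₁.hub b hb
    · obtain ⟨b, hb, rfl⟩ := List.mem_map.1 ht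
      exact h₂.hub b hb
  have sT : IsSpine hub H' T := by
    refine ⟨?_, ?_, fun t ht _ _ h => (h (hThub t ht)).elim⟩
    · rw [hT, List.nodup_append]
      refine ⟨s₁.reverse.nodup, s₂.nodup, ?_⟩
      rintro a ha b hb rfl
      obtain ⟨c, hc, rfl⟩ := List.mem_map.1 (List.mem_reverse.1 ha)
      obtain ⟨d, hd, hdc⟩ := List.mem_map.1 hb
      obtain ⟨hdc1, hdc2⟩ := Prod.ext_iff.1 hdc
      simp only at hdc1 hdc2
      subst hdc1
      exact hne.elim (fun h => h ((h₁.comp _ hc).symm.trans (h₂.comp _ hd))) (fun h => h hdc2.symm)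
    · rw [hT, List.isChain_append]
      refine ⟨s₁.reverse.chain, s₂.chain, ?_⟩
      simp only [List.map_cons, List.reverse_cons, List.getLast?_append, List.getLast?_singleton,
        List.head?_cons, Option.mem_def, Option.some_or, Option.some.injEq]
      rintro _ rfl _ rfl
      exact hadj
  have N3 := N.three_le
  have Ns := N.double
  have N2 := N.two_le
  have Nm := N.many 0 (by omega)
  have e0 : spineExtra m 0 = 1 := by unfold spineExtra; split_ifs <;> omega
  have em : spineExtra m (m - 1) = 1 := by unfold spineExtra; split_ifs <;> omega
  have b0 : (if k 0 < K then 1 else 0) ≤ 1 := by split_ifs <;> omega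
  have bm : (if k (m - 1) < K then 1 else 0) ≤ 1 := by split_ifs <;> omega
  obtain ⟨q, hq⟩ : ∃ q, q + 1 + (if k 0 < K then 1 else 0) + (if k (m - 1) < K then 1 else 0) = m :=
    ⟨m - 1 - (if k 0 < K then 1 else 0) - (if k (m - 1) < K then 1 else 0), by omega⟩
  have hTl : q + 1 ≤ T.length := by
    simp only [hT, List.length_append, List.length_reverse, List.length_map]
    omega
  have hTt := sT.take (q + 1)
  have hTtl : (T.take (q + 1)).length = q + 1 := by simp; omega
  have hTth : ∀ t ∈ T.take (q + 1), hub t.1 := fun t ht => hThub t (List.mem_of_mem_take ht)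
  generalize T.take (q + 1) = R at hTt hTtl hTth
  obtain ⟨A, hA, hAs, hA1⟩ : ∃ A : List (B × Y), A.length = (if k 0 < K then 1 else 0) ∧
      IsSpine hub H' (A ++ R) ∧ (A = [] ∨ k 0 < K) := by
    split_ifs with h0
    · obtain ⟨r, R', rfl⟩ := List.exists_cons_of_length_eq_add_one hTtl
      rw [if_pos h0] at hq
      obtain ⟨e, -, he⟩ := S.exists_cons hH hTt (hTth r (by simp)) (by omega)
      exact ⟨[e], rfl, he, Or.inr h0⟩
    · exact ⟨[], rfl, hTt, Or.inl rfl⟩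
  obtain ⟨Z, hZ, hZs, hZ1⟩ : ∃ Z : List (B × Y), Z.length = (if k (m - 1) < K then 1 else 0) ∧
      IsSpine hub H' (A ++ R ++ Z) ∧ (Z = [] ∨ k (m - 1) < K) := by
    split_ifs with h0
    · obtain ⟨R', r, hR⟩ : ∃ R' r, R = R' ++ [r] := by
        rcases List.eq_nil_or_concat R with h | h
        · subst h; simp at hTtl
        · simpa using h
      have hr : hub r.1 := hTth r (by simp [hR])
      have hAs' := hAs
      have hlen : (A ++ R).length < M := by
        rw [List.length_append, hA, hTtl]
        omega
      rw [hR, ← List.append_assoc] at hAs' hlen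
      obtain ⟨e, -, he⟩ := S.exists_concat hH hAs' hr hlen
      refine ⟨[e], rfl, ?_, Or.inr h0⟩
      rw [hR, ← List.append_assoc]
      exact he
    · exact ⟨[], rfl, by simpa using hAs, Or.inl rfl⟩
  have hlen : (A ++ R ++ Z).length = m := by
    rw [List.length_append, List.length_append, hA, hZ, hTtl]
    omega
  refine S.hasCopy_of_spine N hF hH hZs hlen v ∅ (by simp) ?_
  intro j hj hl
  left
  have hA' : A.length ≤ 1 := by rw [hA]; split_ifs <;> omega
  by_cases hj1 : j < A.length
  · have h0 : k 0 < K := hA1.resolve_left (by rintro rfl; simp at hj1)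
    obtain rfl : j = 0 := by omega
    rw [e0]
    omega
  · by_cases hj2 : j < (A ++ R).length
    · rw [List.getElem_append_left hj2, List.getElem_append_right (by omega)] at hl
      exact (hl (hTth _ (List.getElem_mem _))).elim
    · have hZ0 : Z ≠ [] := by
        rintro rfl
        rw [List.append_nil] at hj
        exact hj2 hj
      have h0 := hZ1.resolve_left hZ0
      rw [if_pos h0] at hZ
      rw [List.length_append] at hj
      obtain rfl : j = m - 1 := by
        rw [List.length_append] at hlen
        omega
      rw [em]
      omega


lemma HubSystem.not_hasCopy [Fintype B] [Fintype Y] [DecidableRel F.Adj]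
    (S : HubSystem Q p r M K strict hub comp asg) (N : CaterpillarParams m k p r M K)
    (hF : F.IsRegularOfDegree (K - 2)) :
    ¬ HasCopy (hubGraph Q hub comp asg F) (caterpillar m k) := by
  classical
  intro hcopy
  have N3 := N.three_le
  have N2 := N.two_le
  have Ns := N.size
  obtain ⟨s, hinj, hadj, hdeg⟩ : ∃ s : ℕ → B × Y, (∀ i < m, ∀ j < m, s i = s j → i = j) ∧
      (∀ j, j + 1 < m → (hubGraph Q hub comp asg F).Adj (s j) (s (j + 1))) ∧
      ∀ j < m, k j ≤ (hubGraph Q hub comp asg F).degree (s j) := by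
    obtain ⟨s, h1, h2, h3⟩ := hcopy.exists_spine
    refine ⟨fun j => if h : j < m then s ⟨j, h⟩ else s ⟨0, by omega⟩, ?_, ?_, ?_⟩
    · intro i hi j hj hij
      simp only [hi, hj, dif_pos] at hij
      exact Fin.mk.inj (h1 hij)
    · intro j hj
      simp only [hj, show j < m by omega, dif_pos]
      exact h2 _ _ rfl
    · intro j hj
      convert h3 ⟨j, hj⟩
      exact dif_pos hj
  have low_deg : ∀ v : B × Y, ¬ hub v.1 → (hubGraph Q hub comp asg F).degree v < K := by
    intro v hv
    have hsub : (hubGraph Q hub comp asg F).neighborFinset v ⊆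
        (F.neighborFinset v.2).image (fun y => (v.1, y)) ∪
          (asg v.1).toFinset.image (fun h => (h, v.2)) := by
      intro w hw
      rw [mem_neighborFinset] at hw
      simp only [Finset.mem_union, Finset.mem_image, mem_neighborFinset, Option.mem_toFinset,
        Option.mem_def]
      rcases hw with ⟨-, h1, h2⟩ | ⟨h1, ⟨h, -⟩ | ⟨-, h, -⟩ | ⟨-, -, h⟩⟩
      · exact Or.inl ⟨w.2, h2, Prod.ext h1 rfl⟩
      · exact (hv h).elim
      · exact Or.inr ⟨w.1, h, Prod.ext rfl h1⟩
      · exact (hv h).elim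
    have h1 := (Finset.card_le_card hsub).trans (Finset.card_union_le _ _)
    have h2 := Finset.card_image_le (s := F.neighborFinset v.2) (f := fun y => (v.1, y))
    have h3 := Finset.card_image_le (s := (asg v.1).toFinset) (f := fun h => (h, v.2))
    have h4 : (asg v.1).toFinset.card ≤ 1 := by cases asg v.1 <;> simp
    rw [card_neighborFinset_eq_degree] at h1
    rw [card_neighborFinset_eq_degree, hF] at h2
    omega
  have low_hub : ∀ v w : B × Y, ¬ hub v.1 → hub w.1 → (hubGraph Q hub comp asg F).Adj v w →
      asg v.1 = some w.1 ∧ v.2 = w.2 := by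
    rintro v w hv hw (⟨-, h1, -⟩ | ⟨h1, ⟨h, -⟩ | ⟨-, h, -⟩ | ⟨-, -, h⟩⟩)
    · exact (hv (h1 ▸ hw)).elim
    · exact (hv h).elim
    · exact ⟨h, h1⟩
    · exact (hv h).elim
  have hlow : ∀ j, j + 1 < m → hub (s j).1 ∨ hub (s (j + 1)).1 := by
    intro j hj
    by_contra! h
    have h1 := (hdeg j (by omega)).trans_lt (low_deg _ h.1)
    have h2 := (hdeg (j + 1) hj).trans_lt (low_deg _ h.2)
    have := N.adjacent j hj
    omega
  have hint : ∀ j, j + 2 < m → hub (s (j + 1)).1 := by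
    intro j hj
    by_contra h
    have h1 := low_hub _ _ h ((hlow j (by omega)).resolve_right h) (hadj j (by omega)).symm
    have h2 := low_hub _ _ h ((hlow (j + 1) hj).resolve_left h) (hadj (j + 1) hj)
    have h3 : s j = s (j + 2) := Prod.ext (Option.some_injective _ (h1.1.symm.trans h2.1))
      (h1.2.symm.trans h2.2)
    have := hinj j (by omega) (j + 2) hj h3
    omega
  obtain ⟨A, hA⟩ : ∃ A, A = if k 0 < K then 1 else 0 := ⟨_, rfl⟩
  have hhub : ∀ t ≤ p, hub (s (A + t)).1 ∧ A + t < m := by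
    intro t ht
    rw [← hA] at Ns
    refine ⟨?_, by omega⟩
    by_contra hn
    by_cases h0 : A + t = 0
    · rw [h0] at hn
      have := (hdeg 0 (by omega)).trans_lt (low_deg _ hn)
      rw [if_pos this] at hA
      omega
    by_cases h1 : A + t = m - 1
    · rw [h1] at hn
      have := (hdeg (m - 1) (by omega)).trans_lt (low_deg _ hn)
      rw [if_pos this] at Ns
      omega
    · obtain ⟨j, hj⟩ : ∃ j, A + t = j + 1 := ⟨A + t - 1, by omega⟩
      rw [hj] at hn
      exact hn (hint j (by omega))
  have hstep : ∀ t < p, (s (A + t)).2 = (s (A + (t + 1))).2 ∧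
      comp (s (A + t)).1 = comp (s (A + (t + 1))).1 ∧ Q.Adj (s (A + t)).1 (s (A + (t + 1))).1 := by
    intro t ht
    obtain ⟨a1, -⟩ := hhub t ht.le
    obtain ⟨a2, a3⟩ := hhub (t + 1) ht
    rcases hadj (A + t) a3 with ⟨h, -⟩ | ⟨h1, ⟨-, -, h2, h3⟩ | ⟨h, -⟩ | ⟨h, -⟩⟩
    · exact (h a1).elim
    · exact ⟨h1, h2, h3⟩
    · exact (h a1).elim
    · exact (h a2).elim
  have hconst : ∀ t ≤ p, (s (A + t)).2 = (s A).2 ∧ comp (s (A + t)).1 = comp (s A).1 := by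
    intro t
    induction t with
    | zero => exact fun _ => ⟨rfl, rfl⟩
    | succ t ih =>
      intro ht
      obtain ⟨h1, h2⟩ := ih (by omega)
      obtain ⟨h3, h4, -⟩ := hstep t ht
      exact ⟨h3.symm.trans h1, h4.symm.trans h2⟩
  have hpath : IsHubPath Q hub comp (comp (s A).1)
      (List.ofFn fun t : Fin (p + 1) => (s (A + t)).1) := by
    refine ⟨?_, ?_, ?_, ?_⟩
    · rw [List.nodup_ofFn]
      intro i j hij
      have h1 : s (A + i) = s (A + j) :=
        Prod.ext hij ((hconst i (by omega)).1.trans (hconst j (by omega)).1.symm)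
      have := hinj _ (hhub i (by omega)).2 _ (hhub j (by omega)).2 h1
      exact Fin.ext (by omega)
    · rw [List.isChain_iff_getElem]
      intro i hi
      rw [List.length_ofFn] at hi
      simpa only [List.getElem_ofFn] using (hstep i (by omega)).2.2
    · intro b hb
      obtain ⟨t, rfl⟩ := (List.mem_ofFn' _ _).1 hb
      exact (hhub t (by omega)).1
    · intro b hb
      obtain ⟨t, rfl⟩ := (List.mem_ofFn' _ _).1 hb
      exact (hconst t (by omega)).2
  have := S.size _ _ hpath
  rw [List.length_ofFn] at this
  omega

lemma HubSystem.two_mul_ncard_edgeSet_le [Fintype B] [Fintype Y] [DecidableRel F.Adj]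
    (S : HubSystem Q p r M K strict hub comp asg) (hK : 2 ≤ K)
    (hF : F.IsRegularOfDegree (K - 2)) :
    2 * (hubGraph Q hub comp asg F).edgeSet.ncard ≤ K * Fintype.card (B × Y) := by
  classical
  let R₁ : B × Y → B × Y → Prop := fun v w => (¬ hub v.1 ∧ v.1 = w.1 ∧ F.Adj v.2 w.2) ∨
    (hub v.1 ∧ v.2 = w.2 ∧ hub w.1 ∧ comp w.1 = comp v.1 ∧ Q.Adj v.1 w.1)
  let R₂ : B × Y → B × Y → Prop := fun v w => ¬ hub v.1 ∧ asg v.1 = some w.1 ∧ v.2 = w.2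
  have hdeg : ∀ v, (hubGraph Q hub comp asg F).degree v ≤ (Finset.univ.filter (R₁ v)).card +
      (Finset.univ.filter (R₂ v)).card + (Finset.univ.filter (fun w => R₂ w v)).card := by
    intro v
    rw [← card_neighborFinset_eq_degree]
    refine (Finset.card_le_card (t := Finset.univ.filter (R₁ v) ∪ Finset.univ.filter (R₂ v) ∪
      Finset.univ.filter (fun w => R₂ w v)) ?_).trans
      ((Finset.card_union_le _ _).trans (Nat.add_le_add_right (Finset.card_union_le _ _) _))
    intro w hw
    rw [mem_neighborFinset] at hw
    simp only [Finset.mem_union, Finset.mem_filter, Finset.mem_univ, true_and]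
    rcases hw with h | ⟨h1, ⟨h2, h3, h4, h5⟩ | ⟨h2, h3, -⟩ | ⟨h2, h3, -⟩⟩
    · exact Or.inl (Or.inl (Or.inl h))
    · exact Or.inl (Or.inl (Or.inr ⟨h2, h1, h3, h4.symm, h5⟩))
    · exact Or.inl (Or.inr ⟨h2, h3, h1⟩)
    · exact Or.inr ⟨h2, h3, h1.symm⟩
  have hR : ∀ v, (Finset.univ.filter (R₁ v)).card + 2 * (Finset.univ.filter (R₂ v)).card ≤ K := by
    intro v
    by_cases hv : hub v.1
    · have h2 : Finset.univ.filter (R₂ v) = ∅ :=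
        Finset.filter_eq_empty_iff.2 fun w _ h => h.1 hv
      have h1 : Finset.univ.filter (R₁ v) ⊆ (Finset.univ.filter (fun b : B =>
          hub b ∧ comp b = comp v.1 ∧ Q.Adj v.1 b)).image (fun b => (b, v.2)) := by
        intro w hw
        rcases (Finset.mem_filter.1 hw).2 with h | ⟨-, h1, h2⟩
        · exact (h.1 hv).elim
        · exact Finset.mem_image.2 ⟨w.1, by simpa using h2, Prod.ext rfl h1⟩
      have h3 := (Finset.card_le_card h1).trans Finset.card_image_le
      have h4 := S.deg _ hv (Finset.univ.filter (fun b : B =>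
          hub b ∧ comp b = comp v.1 ∧ Q.Adj v.1 b)) (by simp)
      rw [h2, Finset.card_empty]
      omega
    · have h1 : Finset.univ.filter (R₁ v) ⊆ (F.neighborFinset v.2).image (fun y => (v.1, y)) := by
        intro w hw
        rcases (Finset.mem_filter.1 hw).2 with ⟨-, h1, h2⟩ | h
        · exact Finset.mem_image.2 ⟨w.2, by simpa using h2, Prod.ext h1 rfl⟩
        · exact (hv h.1).elim
      have h3 := (Finset.card_le_card h1).trans Finset.card_image_le
      rw [card_neighborFinset_eq_degree, hF] at h3
      have h2 : (Finset.univ.filter (R₂ v)).card ≤ 1 := by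
        rw [Finset.card_le_one]
        intro x hx y hy
        obtain ⟨-, h1, h2⟩ := (Finset.mem_filter.1 hx).2
        obtain ⟨-, h1', h2'⟩ := (Finset.mem_filter.1 hy).2
        exact Prod.ext (Option.some_injective _ (h1.symm.trans h1')) (h2.symm.trans h2')
      omega
  have hswap : ∑ v, (Finset.univ.filter (R₂ v)).card =
      ∑ v, (Finset.univ.filter (fun w => R₂ w v)).card :=
    Finset.sum_card_bipartiteAbove_eq_sum_card_bipartiteBelow R₂
  rw [← coe_edgeFinset, Set.ncard_coe_finset, ← sum_degrees_eq_twice_card_edges]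
  refine (Finset.sum_le_sum fun v _ => hdeg v).trans ?_
  rw [Finset.sum_add_distrib, ← hswap, ← Finset.sum_add_distrib]
  refine (Finset.sum_le_card_nsmul _ _ K fun v _ => ?_).trans ?_
  · have := hR v
    omega
  · rw [smul_eq_mul, Finset.card_univ, mul_comm]

lemma HubSystem.exists_isSat [Fintype B] [Fintype Y] [DecidableRel F.Adj]
    (S : HubSystem Q p r M K strict hub comp asg) (N : CaterpillarParams m k p r M K)
    (hstrict : k 0 = K → strict) (hF : F.IsRegularOfDegree (K - 2)) :
    ∃ H, IsSat (Q □ F) H (caterpillar m k) ∧ 2 * H.edgeSet.ncard ≤ K * Fintype.card (B × Y) := by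
  refine ⟨hubGraph Q hub comp asg F, ⟨?_, S.not_hasCopy N hF, ?_⟩,
    S.two_mul_ncard_edgeSet_le N.two_le hF⟩
  · rintro v w (⟨-, h1, h2⟩ | ⟨h1, ⟨-, -, -, h⟩ | ⟨h2, h3, -⟩ | ⟨h2, h3, -⟩⟩) <;> rw [boxProd_adj]
    · exact Or.inr ⟨h2, h1⟩
    · exact Or.inl ⟨h, h1⟩
    · exact Or.inl ⟨(S.asg_hub _ _ h2 h3).2, h1⟩
    · exact Or.inl ⟨(S.asg_hub _ _ h2 h3).2.symm, h1⟩
  · rintro ⟨u, y⟩ ⟨v, z⟩ huv hn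
    have hadj : (hubGraph Q hub comp asg F ⊔ fromEdgeSet {s((u, y), (v, z))}).Adj (u, y) (v, z) :=
      Or.inr ((fromEdgeSet_adj _).2 ⟨rfl, huv.ne⟩)
    generalize hH' : hubGraph Q hub comp asg F ⊔ fromEdgeSet {s((u, y), (v, z))} = H' at hadj
    have hH : hubGraph Q hub comp asg F ≤ H' := hH' ▸ le_sup_left
    rw [boxProd_adj] at huv
    rcases huv with ⟨huv, hyz⟩ | ⟨hyz, huv⟩
    · simp only at huv hyz
      subst hyz
      by_cases hu : hub u <;> by_cases hv : hub v
      · exact S.hasCopy_of_hub_hub N hF hH hu hv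
          (Or.inl fun h => hn (Or.inr ⟨rfl, Or.inl ⟨hu, hv, h, huv⟩⟩)) hadj
      · exact S.hasCopy_of_low_hub N hF hH hv hu huv.symm
          (fun h => hn (Or.inr ⟨rfl, Or.inr (Or.inr ⟨hv, h, hu⟩)⟩)) hadj.symm
      · exact S.hasCopy_of_low_hub N hF hH hu hv huv
          (fun h => hn (Or.inr ⟨rfl, Or.inr (Or.inl ⟨hu, h, hv⟩)⟩)) hadj
      · exact S.hasCopy_of_low_low N hstrict hF hH hu hv huv hadj
    · simp only at huv hyz
      subst huv
      by_cases hu : hub u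
      · exact S.hasCopy_of_hub_hub N hF hH (v := (u, y)) (w := (u, z)) hu hu
          (Or.inr hyz.ne) hadj
      · exact (hn (Or.inl ⟨hu, rfl, hyz⟩)).elim

end HubSystem

/-- The vertex of a cube obtained by changing one coordinate. -/
def cubeFlip {ι : Type*} [DecidableEq ι] (u : ι → Bool) (i : ι) : ι → Bool :=
  Function.update u i (!u i)

section Cube

variable {ι : Type*} [DecidableEq ι]

@[simp]
lemma cubeFlip_self (u : ι → Bool) (i : ι) : cubeFlip u i i = !u i := by simp [cubeFlip]

lemma cubeFlip_of_ne (u : ι → Bool) {i j : ι} (h : j ≠ i) : cubeFlip u i j = u j := by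
  simp [cubeFlip, h]

@[simp]
lemma cubeFlip_cubeFlip (u : ι → Bool) (i : ι) : cubeFlip (cubeFlip u i) i = u := by
  simp [cubeFlip]

lemma cubeFlip_ne (u : ι → Bool) (i : ι) : cubeFlip u i ≠ u := by
  intro h
  simpa using congrFun h i

lemma cubeFlip_injective (u : ι → Bool) : Function.Injective (cubeFlip u) := by
  intro i j h
  by_contra hne
  have := congrFun h i
  rw [cubeFlip_self, cubeFlip_of_ne u hne] at this
  simp at this

/-- The graph of a cube with an arbitrary set of coordinates. -/
def cubeGraph (ι : Type*) [DecidableEq ι] : SimpleGraph (ι → Bool) where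
  Adj u v := ∃ i, v = cubeFlip u i
  symm := ⟨by
    rintro u _ ⟨i, rfl⟩
    exact ⟨i, by simp⟩⟩
  loopless := ⟨by
    rintro u ⟨i, h⟩
    exact cubeFlip_ne u i h.symm⟩

lemma cubeGraph_adj_flip (u : ι → Bool) (i : ι) : (cubeGraph ι).Adj u (cubeFlip u i) := ⟨i, rfl⟩

lemma cubeGraph_isRegularOfDegree [Fintype ι] [DecidableRel (cubeGraph ι).Adj] :
    (cubeGraph ι).IsRegularOfDegree (Fintype.card ι) := by
  intro u
  have : (cubeGraph ι).neighborFinset u = Finset.univ.image (cubeFlip u) := by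
    ext v
    rw [mem_neighborFinset, Finset.mem_image]
    exact ⟨fun ⟨i, h⟩ => ⟨i, Finset.mem_univ i, h.symm⟩, fun ⟨i, _, h⟩ => ⟨i, h.symm⟩⟩
  rw [← card_neighborFinset_eq_degree, this,
    Finset.card_image_of_injective _ (cubeFlip_injective u), Finset.card_univ]

lemma cubeFlip_comp {κ : Type*} [DecidableEq κ] (e : κ ≃ ι) (u : ι → Bool) (i : κ) :
    cubeFlip u (e i) ∘ e = cubeFlip (u ∘ e) i := by
  ext j
  by_cases h : j = i
  · subst h
    simp
  · rw [cubeFlip_of_ne _ h, Function.comp_apply, cubeFlip_of_ne _ (fun h' => h (e.injective h')),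
      Function.comp_apply]

/-- Relabelling the coordinates of a cube. -/
def cubeGraphCongr {κ : Type*} [DecidableEq κ] (e : κ ≃ ι) : cubeGraph ι ≃g cubeGraph κ where
  toEquiv := e.symm.arrowCongr (Equiv.refl Bool)
  map_rel_iff' := by
    intro u v
    change (∃ i, v ∘ e = cubeFlip (u ∘ e) i) ↔ ∃ i, v = cubeFlip u i
    constructor
    · rintro ⟨i, h⟩
      rw [← cubeFlip_comp] at h
      exact ⟨e i, e.surjective.injective_comp_right h⟩
    · rintro ⟨i, rfl⟩
      exact ⟨e.symm i, by rw [← cubeFlip_comp, e.apply_symm_apply]⟩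

/-- A cube is the product of two smaller cubes. -/
def cubeGraphSum {κ : Type*} [DecidableEq κ] :
    cubeGraph (ι ⊕ κ) ≃g cubeGraph ι □ cubeGraph κ where
  toEquiv := Equiv.sumArrowEquivProdArrow ι κ Bool
  map_rel_iff' := by
    intro u v
    rw [boxProd_adj]
    change ((∃ i, v ∘ Sum.inl = cubeFlip (u ∘ Sum.inl) i) ∧ u ∘ Sum.inr = v ∘ Sum.inr ∨
      (∃ i, v ∘ Sum.inr = cubeFlip (u ∘ Sum.inr) i) ∧ u ∘ Sum.inl = v ∘ Sum.inl) ↔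
      ∃ i, v = cubeFlip u i
    have key : ∀ w w' : ι ⊕ κ → Bool,
        w = w' ↔ w ∘ Sum.inl = w' ∘ Sum.inl ∧ w ∘ Sum.inr = w' ∘ Sum.inr := by
      intro w w'
      refine ⟨by rintro rfl; exact ⟨rfl, rfl⟩, fun ⟨h1, h2⟩ => ?_⟩
      ext (i | i)
      · exact congrFun h1 i
      · exact congrFun h2 i
    have hl : ∀ i, cubeFlip u (Sum.inl i) ∘ Sum.inl = cubeFlip (u ∘ Sum.inl) i ∧
        cubeFlip u (Sum.inl i) ∘ Sum.inr = u ∘ Sum.inr := by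
      intro i
      constructor <;> ext j
      · by_cases h : j = i
        · subst h; simp
        · simp [cubeFlip, h]
      · simp [cubeFlip]
    have hr : ∀ i, cubeFlip u (Sum.inr i) ∘ Sum.inr = cubeFlip (u ∘ Sum.inr) i ∧
        cubeFlip u (Sum.inr i) ∘ Sum.inl = u ∘ Sum.inl := by
      intro i
      constructor <;> ext j
      · by_cases h : j = i
        · subst h; simp
        · simp [cubeFlip, h]
      · simp [cubeFlip]
    constructor
    · rintro (⟨⟨i, h1⟩, h2⟩ | ⟨⟨i, h1⟩, h2⟩)
      · exact ⟨Sum.inl i, (key _ _).2 ⟨h1.trans (hl i).1.symm, h2.symm.trans (hl i).2.symm⟩⟩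
      · exact ⟨Sum.inr i, (key _ _).2 ⟨h2.symm.trans (hr i).2.symm, h1.trans (hr i).1.symm⟩⟩
    · rintro ⟨i | i, rfl⟩
      · exact Or.inl ⟨⟨i, (hl i).1⟩, (hl i).2.symm⟩
      · exact Or.inr ⟨⟨i, (hr i).1⟩, (hr i).2.symm⟩

lemma hypercube_eq_cubeGraph (n : ℕ) : hypercube n = cubeGraph (Fin n) := by
  ext u v
  have key : ∀ u v : Fin n → Bool, hammingDist u v = 1 ↔ ∃ i, v = cubeFlip u i := by
    intro u v
    rw [hammingDist, Finset.card_eq_one]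
    refine exists_congr fun i => ?_
    constructor
    · intro h
      ext j
      have hj := Finset.ext_iff.1 h j
      simp only [Finset.mem_filter, Finset.mem_univ, true_and, Finset.mem_singleton] at hj
      by_cases hji : j = i
      · subst hji
        rw [cubeFlip_self]
        have := hj.2 rfl
        revert this
        cases u j <;> cases v j <;> simp
      · rw [cubeFlip_of_ne _ hji]
        exact (not_not.1 fun hne => hji (hj.1 hne)).symm
    · rintro rfl
      ext j
      simp only [Finset.mem_filter, Finset.mem_univ, true_and, Finset.mem_singleton]
      by_cases hji : j = i
      · subst hji; simp
      · simp [cubeFlip_of_ne _ hji, hji]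
  rw [hypercube, fromRel_adj, hammingDist_comm v u, or_self, key]
  refine ⟨fun h => h.2, fun h => ⟨?_, h⟩⟩
  exact (show (cubeGraph (Fin n)).Adj u v from h).ne

/-- The sum of the labels of the coordinates that are switched on. -/
def cubeWeight {A : Type*} [AddCommGroup A] [Fintype ι] (label : ι → A) (u : ι → Bool) : A :=
  ∑ i, if u i then label i else 0

lemma cubeWeight_cubeFlip {A : Type*} [AddCommGroup A] [Fintype ι] {label : ι → A}
    (h2 : ∀ a : A, a + a = 0) (u : ι → Bool) (i : ι) :
    cubeWeight label (cubeFlip u i) = cubeWeight label u + label i := by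
  unfold cubeWeight
  rw [← Finset.add_sum_erase _ _ (Finset.mem_univ i),
    ← Finset.add_sum_erase Finset.univ (fun j => if u j then label j else 0) (Finset.mem_univ i)]
  have : ∑ j ∈ Finset.univ.erase i, (if cubeFlip u i j then label j else 0) =
      ∑ j ∈ Finset.univ.erase i, if u j then label j else 0 :=
    Finset.sum_congr rfl fun j hj => by rw [cubeFlip_of_ne _ (Finset.ne_of_mem_erase hj)]
  rw [this, cubeFlip_self]
  cases u i
  · simp [add_comm]
  · simp only [Bool.not_true, Bool.false_eq_true, if_false, if_true, zero_add]
    rw [add_right_comm, h2, zero_add]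

/-- The parity of a vertex of a cube. -/
def cubeParity [Fintype ι] (u : ι → Bool) : ZMod 2 := cubeWeight (fun _ => 1) u

lemma cubeParity_cubeFlip [Fintype ι] (u : ι → Bool) (i : ι) :
    cubeParity (cubeFlip u i) = cubeParity u + 1 :=
  cubeWeight_cubeFlip (fun a => CharTwo.add_self_eq_zero a) u i

lemma cubeParity_ne_of_adj [Fintype ι] {u v : ι → Bool} (h : (cubeGraph ι).Adj u v) :
    cubeParity u ≠ cubeParity v := by
  obtain ⟨i, rfl⟩ := h
  rw [cubeParity_cubeFlip]
  simp

end Cube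

/-- A Hamiltonian path, given as a list. -/
structure IsHamPath {V : Type*} (G : SimpleGraph V) (u v : V) (l : List V) : Prop where
  nodup : l.Nodup
  chain : l.IsChain G.Adj
  mem : ∀ x, x ∈ l
  head : l.head? = some u
  last : l.getLast? = some v

lemma IsHamPath.length_eq {V : Type*} [Fintype V] {G : SimpleGraph V} {u v : V} {l : List V}
    (h : IsHamPath G u v l) : l.length = Fintype.card V := by
  classical
  rw [← List.toFinset_card_of_nodup h.nodup, ← Finset.card_univ]
  congr 1
  ext x
  simp [h.mem]

/-- Adding a first coordinate to a vertex of a cube. -/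
def cubeCons {n : ℕ} (b : Bool) (x : Fin n → Bool) : Fin (n + 1) → Bool := Fin.cons b x

lemma cubeCons_inj {n : ℕ} {b c : Bool} {x y : Fin n → Bool} :
    cubeCons b x = cubeCons c y ↔ b = c ∧ x = y := Fin.cons_inj

lemma exists_eq_cubeCons {n : ℕ} (u : Fin (n + 1) → Bool) : ∃ b x, u = cubeCons b x :=
  ⟨u 0, Fin.tail u, (Fin.cons_self_tail u).symm⟩

lemma cubeFlip_cons_zero {n : ℕ} (b : Bool) (x : Fin n → Bool) :
    cubeFlip (cubeCons b x) 0 = cubeCons (!b) x := by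
  unfold cubeCons
  ext j
  refine Fin.cases ?_ (fun j => ?_) j
  · simp
  · rw [cubeFlip_of_ne _ (Fin.succ_ne_zero j), Fin.cons_succ, Fin.cons_succ]

lemma cubeFlip_cons_succ {n : ℕ} (b : Bool) (x : Fin n → Bool) (i : Fin n) :
    cubeFlip (cubeCons b x) i.succ = cubeCons b (cubeFlip x i) := by
  unfold cubeCons
  ext j
  refine Fin.cases ?_ (fun j => ?_) j
  · rw [cubeFlip_of_ne _ (Fin.succ_ne_zero i).symm, Fin.cons_zero, Fin.cons_zero]
  · by_cases h : j = i
    · subst h; simp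
    · rw [cubeFlip_of_ne _ (fun h' => h (Fin.succ_injective _ h')), Fin.cons_succ, Fin.cons_succ,
        cubeFlip_of_ne _ h]

lemma cubeGraph_adj_cons {n : ℕ} (b : Bool) {x y : Fin n → Bool} (h : (cubeGraph (Fin n)).Adj x y) :
    (cubeGraph (Fin (n + 1))).Adj (cubeCons b x) (cubeCons b y) := by
  obtain ⟨i, rfl⟩ := h
  exact ⟨i.succ, (cubeFlip_cons_succ b x i).symm⟩

lemma cubeGraph_adj_cons_not {n : ℕ} {b c : Bool} (hbc : b ≠ c) (x : Fin n → Bool) :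
    (cubeGraph (Fin (n + 1))).Adj (cubeCons b x) (cubeCons c x) := by
  obtain rfl : c = !b := by cases b <;> cases c <;> simp at hbc ⊢
  exact ⟨0, (cubeFlip_cons_zero b x).symm⟩

lemma cubeParity_cons {n : ℕ} (b : Bool) (x : Fin n → Bool) :
    cubeParity (cubeCons b x) = (if b then 1 else 0) + cubeParity x := by
  rw [cubeParity, cubeWeight, Fin.sum_univ_succ]
  rfl

lemma isChain_map_cons {n : ℕ} (b : Bool) {l : List (Fin n → Bool)}
    (h : l.IsChain (cubeGraph (Fin n)).Adj) :
    (l.map (cubeCons b)).IsChain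
      (cubeGraph (Fin (n + 1))).Adj := by
  rw [List.isChain_map]
  exact h.imp fun _ _ h => cubeGraph_adj_cons b h

lemma exists_isHamPath_cubeGraph (n : ℕ) : ∀ u v : Fin n → Bool, cubeParity u ≠ cubeParity v →
    ∃ l, IsHamPath (cubeGraph (Fin n)) u v l := by
  induction n with
  | zero => exact fun u v h => (h (congrArg _ (Subsingleton.elim u v))).elim
  | succ n ih =>
    intro u v
    obtain ⟨b, x, rfl⟩ := exists_eq_cubeCons u
    obtain ⟨c, y, rfl⟩ := exists_eq_cubeCons v
    intro huv
    rw [cubeParity_cons, cubeParity_cons] at huv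
    have inj : ∀ b : Bool, Function.Injective (cubeCons (n := n) b) :=
      fun b _ _ h => (cubeCons_inj.1 h).2
    have cover : ∀ {b c : Bool}, b ≠ c → ∀ z : Fin (n + 1) → Bool,
        z ∈ Set.range (cubeCons b) ∨ z ∈ Set.range (cubeCons c) := by
      intro b c hbc z
      obtain ⟨d, w, rfl⟩ := exists_eq_cubeCons z
      rcases eq_or_ne d b with rfl | h
      · exact Or.inl ⟨w, rfl⟩
      · obtain rfl : d = c := by cases b <;> cases c <;> cases d <;> simp at hbc h ⊢
        exact Or.inr ⟨w, rfl⟩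
    by_cases hbc : b = c
    · subst hbc
      have hxy : cubeParity x ≠ cubeParity y := fun h => huv (by rw [h])
      obtain ⟨l, hl⟩ := ih x y hxy
      obtain ⟨w, l', rfl⟩ : ∃ w l', l = x :: w :: l' := by
        have h1 := hl.head
        have h2 := hl.last
        rcases l with _ | ⟨x', _ | ⟨w, l'⟩⟩
        · simp at h1
        · simp only [List.head?_cons, Option.some.injEq, List.getLast?_singleton] at h1 h2
          exact (hxy (congrArg _ (h1.symm.trans h2))).elim
        · simp only [List.head?_cons, Option.some.injEq] at h1
          exact ⟨w, l', by rw [h1]⟩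
      have hc := List.isChain_cons_cons.1 hl.chain
      obtain ⟨q, hq⟩ := ih x w (cubeParity_ne_of_adj hc.1)
      have hne : b ≠ !b := by cases b <;> simp
      refine ⟨cubeCons b x :: (q.map (cubeCons (!b)) ++ (w :: l').map (cubeCons b)),
        ?_, ?_, ?_, rfl, ?_⟩
      · rw [List.nodup_cons, List.nodup_append]
        refine ⟨?_, hq.nodup.map (inj _), (List.nodup_cons.1 hl.nodup).2.map (inj _), ?_⟩
        · intro h
          rcases List.mem_append.1 h with h | h <;> obtain ⟨z, hz, hzz⟩ := List.mem_map.1 h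
          · exact hne (cubeCons_inj.1 hzz).1.symm
          · exact (List.nodup_cons.1 hl.nodup).1 ((cubeCons_inj.1 hzz).2 ▸ hz)
        · intro z hz z' hz' hzz
          obtain ⟨s, -, rfl⟩ := List.mem_map.1 hz
          obtain ⟨s', -, rfl⟩ := List.mem_map.1 hz'
          exact hne (cubeCons_inj.1 hzz).1.symm
      · rw [List.isChain_cons, List.isChain_append]
        refine ⟨?_, isChain_map_cons _ hq.chain, isChain_map_cons _ hc.2, ?_⟩
        · rw [List.head?_append, List.head?_map, hq.head]
          simp only [Option.map_some, Option.some_or, Option.mem_some_iff]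
          rintro _ rfl
          exact cubeGraph_adj_cons_not hne x
        · rw [List.getLast?_map, hq.last]
          simp only [List.map_cons, List.head?_cons, Option.map_some, Option.mem_some_iff]
          rintro _ rfl _ rfl
          exact cubeGraph_adj_cons_not hne.symm w
      · intro z
        rw [List.mem_cons, List.mem_append]
        rcases cover hne z with ⟨s, rfl⟩ | ⟨s, rfl⟩
        · rcases List.mem_cons.1 (hl.mem s) with rfl | h
          · exact Or.inl rfl
          · exact Or.inr (Or.inr (List.mem_map_of_mem h))
        · exact Or.inr (Or.inl (List.mem_map_of_mem (hq.mem s)))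
      · have := hl.last
        rw [List.getLast?_cons_cons] at this
        rw [← List.cons_append, List.getLast?_append, List.getLast?_map, this]
        rfl
    · obtain ⟨w, p, q, hp, hq⟩ : ∃ w p q, IsHamPath (cubeGraph (Fin n)) x w p ∧
          IsHamPath (cubeGraph (Fin n)) w y q := by
        rcases n with _ | n
        · have : IsHamPath (cubeGraph (Fin 0)) x x [x] :=
            ⟨by simp, by simp, fun z => by simp [Subsingleton.elim z x], rfl, rfl⟩
          exact ⟨x, [x], [x], this, Subsingleton.elim x y ▸ this⟩
        · have h1 : cubeParity (cubeFlip x 0) ≠ cubeParity x := by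
            rw [cubeParity_cubeFlip]; simp
          obtain ⟨p, hp⟩ := ih x (cubeFlip x 0) h1.symm
          obtain ⟨q, hq⟩ := ih (cubeFlip x 0) y (by
            rw [cubeParity_cubeFlip]
            revert huv hbc
            generalize cubeParity x = s
            generalize cubeParity y = t
            revert s t b c
            decide)
          exact ⟨_, p, q, hp, hq⟩
      refine ⟨p.map (cubeCons b) ++ q.map (cubeCons c), ?_, ?_, ?_, ?_, ?_⟩
      · rw [List.nodup_append]
        refine ⟨hp.nodup.map (inj _), hq.nodup.map (inj _), ?_⟩
        intro z hz z' hz' hzz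
        obtain ⟨s, -, rfl⟩ := List.mem_map.1 hz
        obtain ⟨s', -, rfl⟩ := List.mem_map.1 hz'
        exact hbc (cubeCons_inj.1 hzz).1
      · rw [List.isChain_append]
        refine ⟨isChain_map_cons _ hp.chain, isChain_map_cons _ hq.chain, ?_⟩
        rw [List.getLast?_map, List.head?_map, hp.last, hq.head]
        simp only [Option.map_some, Option.mem_some_iff]
        rintro _ rfl _ rfl
        exact cubeGraph_adj_cons_not hbc w
      · intro z
        rw [List.mem_append]
        rcases cover hbc z with ⟨s, rfl⟩ | ⟨s, rfl⟩
        · exact Or.inl (List.mem_map_of_mem (hp.mem s))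
        · exact Or.inr (List.mem_map_of_mem (hq.mem s))
      · rw [List.head?_append, List.head?_map, hp.head]
        rfl
      · rw [List.getLast?_append, List.getLast?_map, hq.last]
        rfl

/-- The cube without two adjacent vertices has a spanning path from each of its vertices. -/
lemma exists_path_tail_ne {n : ℕ} (ζ : Fin (n + 1) → Bool) (x : Fin (n + 2) → Bool)
    (hx : Fin.tail x ≠ ζ) : ∃ l, (x :: l).Nodup ∧ (x :: l).IsChain (cubeGraph (Fin (n + 2))).Adj ∧
      (∀ y, y ∈ x :: l ↔ Fin.tail y ≠ ζ) ∧ (x :: l).length = 2 ^ (n + 2) - 2 := by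
  obtain ⟨q, hq⟩ := exists_isHamPath_cubeGraph (n + 1) ζ (cubeFlip ζ 0)
    (by rw [cubeParity_cubeFlip]; simp)
  obtain ⟨y, ys, rfl⟩ : ∃ y ys, q = ζ :: y :: ys := by
    have h1 := hq.head
    have h2 := hq.last
    rcases q with _ | ⟨x', _ | ⟨w, l'⟩⟩
    · simp at h1
    · simp only [List.head?_cons, Option.some.injEq, List.getLast?_singleton] at h1 h2
      exact (cubeFlip_ne ζ 0 (h2.symm.trans h1)).elim
    · simp only [List.head?_cons, Option.some.injEq] at h1
      exact ⟨w, l', by rw [h1]⟩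
  have hnd := List.nodup_cons.1 hq.nodup
  have hlen := hq.length_eq
  rw [Fintype.card_fun, Fintype.card_bool, Fintype.card_fin] at hlen
  have hmem : ∀ w, w ∈ y :: ys ↔ w ≠ ζ := by
    intro w
    constructor
    · rintro h rfl
      exact hnd.1 h
    · intro h
      exact (List.mem_cons.1 (hq.mem w)).resolve_left h
  have hch := (List.isChain_cons_cons.1 hq.chain).2
  have inj : ∀ b : Bool, Function.Injective (cubeCons (n := n + 1) b) :=
    fun b _ _ h => (cubeCons_inj.1 h).2
  obtain ⟨cyc, hcyc⟩ : ∃ cyc, cyc = (y :: ys).map (cubeCons false) ++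
    ((y :: ys).map (cubeCons true)).reverse := ⟨_, rfl⟩
  have cnd : cyc.Nodup := by
    rw [hcyc, List.nodup_append]
    refine ⟨hnd.2.map (inj _), List.nodup_reverse.2 (hnd.2.map (inj _)), ?_⟩
    intro z hz z' hz' hzz
    obtain ⟨s, -, rfl⟩ := List.mem_map.1 hz
    obtain ⟨s', -, rfl⟩ := List.mem_map.1 (List.mem_reverse.1 hz')
    simpa using (cubeCons_inj.1 hzz).1
  have cch : cyc.IsChain (cubeGraph (Fin (n + 2))).Adj := by
    rw [hcyc, List.isChain_append]
    refine ⟨isChain_map_cons _ hch, ?_, ?_⟩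
    · rw [List.isChain_reverse]
      exact (isChain_map_cons _ hch).imp fun _ _ h => h.symm
    · rw [List.head?_reverse, List.getLast?_map, List.getLast?_map]
      intro z hz z' hz'
      rw [Option.mem_def, Option.map_eq_some_iff] at hz hz'
      obtain ⟨w, hw, rfl⟩ := hz
      obtain ⟨w', hw', rfl⟩ := hz'
      obtain rfl : w = w' := Option.some_injective _ (hw.symm.trans hw')
      exact cubeGraph_adj_cons_not (by simp) w
  have cmem : ∀ z, z ∈ cyc ↔ Fin.tail z ≠ ζ := by
    intro z
    obtain ⟨b, w, rfl⟩ := exists_eq_cubeCons z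
    have : Fin.tail (cubeCons b w) = w := Fin.tail_cons _ _
    rw [this, ← hmem, hcyc, List.mem_append, List.mem_reverse, List.mem_map, List.mem_map]
    constructor
    · rintro (⟨s, hs, h⟩ | ⟨s, hs, h⟩) <;> exact (cubeCons_inj.1 h).2 ▸ hs
    · intro h
      cases b
      · exact Or.inl ⟨w, h, rfl⟩
      · exact Or.inr ⟨w, h, rfl⟩
  have clen : cyc.length = 2 ^ (n + 2) - 2 := by
    rw [hcyc, List.length_append, List.length_reverse, List.length_map, List.length_map, pow_succ]
    rw [List.length_cons] at hlen
    omega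
  have cadj : ∀ z ∈ cyc.getLast?, ∀ w ∈ cyc.head?, (cubeGraph (Fin (n + 2))).Adj z w := by
    have h1 : cyc.getLast? = some (cubeCons true y) := by
      rw [hcyc, List.getLast?_append, List.getLast?_reverse]
      rfl
    have h2 : cyc.head? = some (cubeCons false y) := by rw [hcyc]; rfl
    rw [h1, h2]
    simp only [Option.mem_some_iff]
    rintro _ rfl _ rfl
    exact cubeGraph_adj_cons_not (by simp) y
  obtain ⟨A, D, rfl⟩ := List.append_of_mem ((cmem x).2 hx)
  have hperm : ((x :: D) ++ A).Perm (A ++ x :: D) := List.perm_append_comm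
  refine ⟨D ++ A, hperm.nodup_iff.2 cnd, ?_, fun z => hperm.mem_iff.trans (cmem z),
    hperm.length_eq.trans clen⟩
  rw [List.isChain_append] at cch
  rw [← List.cons_append, List.isChain_append]
  refine ⟨cch.2.1, cch.1, fun z hz w hw => cadj z ?_ w ?_⟩
  · rw [List.getLast?_append, Option.mem_def.1 hz]
    rfl
  · rw [List.head?_append, Option.mem_def.1 hw]
    rfl

section CubeHub

variable {a : ℕ} {I G : Type*} [Fintype I] [DecidableEq I] [AddCommGroup G]

/-- The hubs given by labels of the coordinates in `I`: the sum of the labels `g` is zero, and the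
first component avoids a set depending on the sum of the labels `s`. -/
def cubeHub (g : I → G) (s : I → ZMod 2) (Z : ZMod 2 → Set (Fin a → Bool))
    (b : (Fin a → Bool) × (I → Bool)) : Prop :=
  cubeWeight g b.2 = 0 ∧ b.1 ∉ Z (cubeWeight s b.2)

/-- The assignment flipping the coordinate `f b`. -/
def cubeAsg (f : (Fin a → Bool) × (I → Bool) → Option I) (b : (Fin a → Bool) × (I → Bool)) :
    Option ((Fin a → Bool) × (I → Bool)) :=
  (f b).map fun i => (b.1, cubeFlip b.2 i)

variable {g : I → G} {s : I → ZMod 2} {Z : ZMod 2 → Set (Fin a → Bool)} {p K : ℕ}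

lemma isHubPath_cubeHub {c : I → Bool} (hc : cubeWeight g c = 0) {l : List (Fin a → Bool)}
    (hnd : l.Nodup) (hch : l.IsChain (cubeGraph (Fin a)).Adj)
    (hZ : ∀ y ∈ l, y ∉ Z (cubeWeight s c)) :
    IsHubPath (cubeGraph (Fin a) □ cubeGraph I) (cubeHub g s Z) Prod.snd c
      (l.map fun x => (x, c)) where
  nodup := hnd.map fun _ _ h => (Prod.mk.inj h).1
  chain := by
    rw [List.isChain_map]
    exact hch.imp fun _ _ h => boxProd_adj.2 (Or.inl ⟨h, rfl⟩)
  hub := by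
    intro b hb
    obtain ⟨x, hx, rfl⟩ := List.mem_map.1 hb
    exact ⟨hc, hZ x hx⟩
  comp := by
    intro b hb
    obtain ⟨x, hx, rfl⟩ := List.mem_map.1 hb
    rfl

lemma IsHubPath.length_le_of_cubeHub
    (hsize : ∀ t (l : List (Fin a → Bool)), l.Nodup → (∀ y ∈ l, y ∉ Z t) → l.length ≤ p)
    (c : I → Bool) (l : List ((Fin a → Bool) × (I → Bool)))
    (hl : IsHubPath (cubeGraph (Fin a) □ cubeGraph I) (cubeHub g s Z) Prod.snd c l) :
    l.length ≤ p := by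
  have h := hsize (cubeWeight s c) (l.map Prod.fst) ?_ ?_
  · rwa [List.length_map] at h
  · refine hl.nodup.map_on fun x hx y hy hxy => ?_
    exact Prod.ext hxy ((hl.comp x hx).trans (hl.comp y hy).symm)
  · intro y hy
    obtain ⟨b, hb, rfl⟩ := List.mem_map.1 hy
    have := (hl.hub b hb).2
    rwa [hl.comp b hb] at this

lemma card_le_of_adj_of_snd_eq (haK : a ≤ K) (h : (Fin a → Bool) × (I → Bool))
    (T : Finset ((Fin a → Bool) × (I → Bool)))
    (hT : ∀ b ∈ T, cubeHub g s Z b ∧ b.2 = h.2 ∧ (cubeGraph (Fin a) □ cubeGraph I).Adj h b) :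
    T.card ≤ K := by
  have hsub : T ⊆ (Finset.univ : Finset (Fin a)).image fun i => (cubeFlip h.1 i, h.2) := by
    intro b hb
    obtain ⟨-, h1, h2⟩ := hT b hb
    rw [boxProd_adj] at h2
    rcases h2 with ⟨⟨i, hi⟩, -⟩ | ⟨h2, -⟩
    · exact Finset.mem_image.2 ⟨i, Finset.mem_univ _, Prod.ext hi.symm h1.symm⟩
    · exact (h2.ne h1.symm).elim
  refine (Finset.card_le_card hsub).trans (Finset.card_image_le.trans ?_)
  simpa using haK

/-- The hub system in which each vertex outside the hubs is assigned. -/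
lemma hubSystem_of_forall_path [Fintype G] {M : ℕ} (h2 : ∀ x : G, x + x = 0)
    (hM : M < Fintype.card G) (haK : a ≤ K)
    (disj : ∀ t x, x ∈ Z t → x ∉ Z (t + 1))
    (path : ∀ t x, x ∉ Z t → ∃ l, (x :: l).Nodup ∧ (x :: l).IsChain (cubeGraph (Fin a)).Adj ∧
      (∀ y, y ∈ x :: l ↔ y ∉ Z t) ∧ (x :: l).length = p)
    (emb : G × ZMod 2 × ZMod 2 → I) (hemb : Function.Injective emb)
    (hg : ∀ x, g (emb x) = x.1) (hs : ∀ x, s (emb x) = x.2.2) :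
    ∃ f, HubSystem (cubeGraph (Fin a) □ cubeGraph I) p p M K True (cubeHub g s Z) Prod.snd
      (cubeAsg f) := by
  classical
  let τ : (Fin a → Bool) × (I → Bool) → G × ZMod 2 × ZMod 2 := fun b =>
    (cubeWeight g b.2, cubeParity b.1, if b.1 ∈ Z (cubeWeight s b.2) then 1 else 0)
  have h2' : ∀ x : ZMod 2, x + x = 0 := CharTwo.add_self_eq_zero
  have hasg : ∀ b, cubeAsg (fun b => some (emb (τ b))) b = some (b.1, cubeFlip b.2 (emb (τ b))) :=
    fun _ => rfl
  have hhub : ∀ b, cubeHub g s Z (b.1, cubeFlip b.2 (emb (τ b))) := by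
    intro b
    constructor
    · simp only
      rw [cubeWeight_cubeFlip h2, hg, h2]
    · simp only
      rw [cubeWeight_cubeFlip h2', hs]
      by_cases h : b.1 ∈ Z (cubeWeight s b.2)
      · simpa only [τ, if_pos h] using disj _ _ h
      · simpa only [τ, if_neg h, add_zero] using h
  have hpath : ∀ h, cubeHub g s Z h → ∃ l, IsHubPath (cubeGraph (Fin a) □ cubeGraph I)
      (cubeHub g s Z) Prod.snd h.2 (h :: l) ∧ (h :: l).length = p := by
    rintro ⟨x, c⟩ ⟨hc, hx⟩
    obtain ⟨l, l1, l2, l3, l4⟩ := path _ _ hx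
    refine ⟨l.map fun y => (y, c), ?_, by simpa using l4⟩
    exact isHubPath_cubeHub hc l1 l2 fun y hy => (l3 y).1 hy
  refine ⟨fun b => some (emb (τ b)), ?_, ?_, ?_, ?_, ?_, ?_, ?_⟩
  · intro b h _ hbh
    rw [hasg, Option.some.injEq] at hbh
    subst hbh
    exact ⟨hhub b, boxProd_adj.2 (Or.inr ⟨cubeGraph_adj_flip _ _, rfl⟩)⟩
  · rintro ⟨x, c⟩ ⟨hc, hx⟩
    simp only at hc hx
    have hinj : Function.Injective fun γ : G => (x, cubeFlip c (emb (γ, cubeParity x, 0))) := by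
      intro γ γ' h
      exact (Prod.mk.inj (hemb (cubeFlip_injective c (Prod.mk.inj h).2))).1
    refine ⟨((Finset.univ : Finset G).erase 0).image
      fun γ => (x, cubeFlip c (emb (γ, cubeParity x, 0))), ?_, ?_⟩
    · rw [Finset.card_image_of_injective _ hinj, Finset.card_erase_of_mem (Finset.mem_univ _),
        Finset.card_univ]
      omega
    · intro b hb
      obtain ⟨γ, hγ, rfl⟩ := Finset.mem_image.1 hb
      have hγ0 := Finset.ne_of_mem_erase hγ
      have e1 : cubeWeight g (cubeFlip c (emb (γ, cubeParity x, 0))) = γ := by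
        rw [cubeWeight_cubeFlip h2, hg, hc, zero_add]
      have e2 : cubeWeight s (cubeFlip c (emb (γ, cubeParity x, 0))) = cubeWeight s c := by
        rw [cubeWeight_cubeFlip h2', hs, add_zero]
      refine ⟨fun h => hγ0 (e1.symm.trans h.1), ?_⟩
      rw [hasg]
      simp only [τ, e1, e2, if_neg hx, cubeFlip_cubeFlip]
  · refine fun c l => IsHubPath.length_le_of_cubeHub ?_ c l
    intro t l hl hlZ
    rcases l with _ | ⟨x, l⟩
    · simp
    · obtain ⟨q, -, -, q3, q4⟩ := path t x (hlZ x (by simp))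
      rw [← q4]
      exact (hl.subperm fun y hy => (q3 y).2 (hlZ y hy)).length_le
  · exact fun h _ T => card_le_of_adj_of_snd_eq haK h T
  · intro h hh
    obtain ⟨l, hl, hlp⟩ := hpath h hh
    exact ⟨l, hl, hlp.ge⟩
  · rintro ⟨x, c⟩ ⟨x', c'⟩ _ _ hadj
    refine ⟨_, _, Or.inl ⟨rfl, rfl⟩, _, hasg _, hpath _ (hhub _), fun _ => ⟨_, hasg _, ?_⟩⟩
    simp only
    rw [boxProd_adj] at hadj
    rcases hadj with ⟨h, rfl : c = c'⟩ | ⟨⟨i, h⟩, rfl : x = x'⟩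
    · intro heq
      have := hemb (cubeFlip_injective c heq)
      exact cubeParity_ne_of_adj h (congrArg (fun z => z.2.1) this)
    · intro heq
      have := congrArg cubeParity heq
      simp only at h
      rw [h, cubeParity_cubeFlip, cubeParity_cubeFlip, cubeParity_cubeFlip] at this
      simp at this
  · rintro ⟨x, c⟩ ⟨x', c'⟩ _ hh hadj hne
    refine ⟨hpath _ hh, _, hasg _, ?_⟩
    rw [hasg] at hne
    simp only
    rw [boxProd_adj] at hadj
    rcases hadj with ⟨h, rfl : c = c'⟩ | ⟨⟨i, h⟩, rfl : x = x'⟩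
    · exact cubeFlip_ne _ _
    · intro heq
      exact hne (by rw [heq])

/-- The hub system in which each component misses one vertex. -/
lemma hubSystem_of_puncture [Fintype G] {n M : ℕ} (h2 : ∀ x : G, x + x = 0)
    (hM : M < Fintype.card G) (hnK : n + 1 ≤ K) (z : ZMod 2 → Fin (n + 1) → Bool)
    (hz : ∀ t, cubeParity (z t) = t) (emb : G → I) (hemb : Function.Injective emb)
    (hg : ∀ x, g (emb x) = x) (hg' : ∀ i, g i ≠ 0 → emb (g i) = i) (hs : ∀ i, s i = 1) :
    ∃ f, HubSystem (cubeGraph (Fin (n + 1)) □ cubeGraph I) (2 ^ (n + 1) - 1) (2 ^ n) M K False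
      (cubeHub g s fun t => {z t}) Prod.snd (cubeAsg f) := by
  classical
  have h2' : ∀ x : ZMod 2, x + x = 0 := CharTwo.add_self_eq_zero
  have ws : ∀ c i, cubeWeight s (cubeFlip c i) = cubeWeight s c + 1 := fun c i => by
    rw [cubeWeight_cubeFlip h2', hs]
  have two : ∀ t t' : ZMod 2, t ≠ t' ↔ t + 1 = t' := by decide
  have hgood : ∀ t x, cubeParity x ≠ t → ∃ l, (x :: l).Nodup ∧
      (x :: l).IsChain (cubeGraph (Fin (n + 1))).Adj ∧ (∀ y, y ∈ x :: l ↔ y ≠ z t) ∧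
      (x :: l).length = 2 ^ (n + 1) - 1 := by
    intro t x hx
    obtain ⟨q, hq⟩ := exists_isHamPath_cubeGraph (n + 1) (z t) x (by rw [hz]; exact hx.symm)
    obtain ⟨l, rfl⟩ : ∃ l : List (Fin (n + 1) → Bool), q = z t :: l.reverse := by
      have := hq.head
      rcases q with _ | ⟨x', l⟩
      · simp at this
      · exact ⟨l.reverse, by simpa using this⟩
    obtain ⟨l, rfl⟩ : ∃ l', l = x :: l' := by
      have := hq.last
      rcases l with _ | ⟨x', l⟩
      · simp only [List.reverse_nil, List.getLast?_singleton, Option.some.injEq] at this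
        exact (hx (this ▸ hz t)).elim
      · rw [List.reverse_cons, ← List.cons_append, List.getLast?_append] at this
        exact ⟨l, by simpa using this⟩
    have hlen := hq.length_eq
    rw [Fintype.card_fun, Fintype.card_bool, Fintype.card_fin, List.length_cons,
      List.length_reverse] at hlen
    have hnd := List.nodup_cons.1 hq.nodup
    refine ⟨l, List.nodup_reverse.1 hnd.2, ?_, ?_, by omega⟩
    · have := (List.isChain_cons.1 hq.chain).2
      rw [List.isChain_reverse] at this
      exact this.imp fun _ _ h => h.symm
    · intro y
      constructor
      · rintro hy rfl
        exact hnd.1 (List.mem_reverse.2 hy)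
      · intro hy
        exact List.mem_reverse.1 ((List.mem_cons.1 (hq.mem y)).resolve_left hy)
  have hpath : ∀ h, cubeHub g s (fun t => {z t}) h → cubeParity h.1 ≠ cubeWeight s h.2 →
      ∃ l, IsHubPath (cubeGraph (Fin (n + 1)) □ cubeGraph I)
      (cubeHub g s fun t => {z t}) Prod.snd h.2 (h :: l) ∧ (h :: l).length = 2 ^ (n + 1) - 1 := by
    rintro ⟨x, c⟩ ⟨hc, -⟩ hx
    obtain ⟨l, l1, l2, l3, l4⟩ := hgood _ _ hx
    refine ⟨l.map fun y => (y, c), ?_, by simpa using l4⟩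
    exact isHubPath_cubeHub hc l1 l2 fun y hy => (l3 y).1 hy
  obtain ⟨f, hf⟩ : ∃ f : (Fin (n + 1) → Bool) × (I → Bool) → Option I, ∀ b, f b =
      if b.1 = z (cubeWeight s b.2 + 1) then none else some (emb (cubeWeight g b.2)) :=
    ⟨_, fun _ => rfl⟩
  have hasg : ∀ b : (Fin (n + 1) → Bool) × (I → Bool), b.1 ≠ z (cubeWeight s b.2 + 1) →
      cubeAsg f b = some (b.1, cubeFlip b.2 (emb (cubeWeight g b.2))) := by
    intro b hb
    rw [cubeAsg, hf, if_neg hb]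
    rfl
  have hasg' : ∀ b h, cubeAsg f b = some h → b.1 ≠ z (cubeWeight s b.2 + 1) := by
    intro b h hbh hb
    rw [cubeAsg, hf, if_pos hb] at hbh
    simp at hbh
  have hhub : ∀ b : (Fin (n + 1) → Bool) × (I → Bool), b.1 ≠ z (cubeWeight s b.2 + 1) →
      cubeHub g s (fun t => {z t}) (b.1, cubeFlip b.2 (emb (cubeWeight g b.2))) := by
    intro b hb
    constructor
    · simp only
      rw [cubeWeight_cubeFlip h2, hg, h2]
    · simp only
      rw [ws]
      exact hb
  have hstrong : ∀ x c, cubeParity x = cubeWeight s c → x ≠ z (cubeWeight s c + 1) := by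
    rintro x c h rfl
    rw [hz] at h
    simp at h
  refine ⟨f, ?_, ?_, ?_, ?_, ?_, ?_, ?_⟩
  · intro b h _ hbh
    have hb := hasg' _ _ hbh
    rw [hasg _ hb, Option.some.injEq] at hbh
    subst hbh
    exact ⟨hhub b hb, boxProd_adj.2 (Or.inr ⟨cubeGraph_adj_flip _ _, rfl⟩)⟩
  · rintro ⟨x, c⟩ ⟨hc, hx⟩
    simp only at hc hx
    have hinj : Function.Injective fun γ : G => (x, cubeFlip c (emb γ)) := by
      intro γ γ' h
      exact hemb (cubeFlip_injective c (Prod.mk.inj h).2)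
    refine ⟨((Finset.univ : Finset G).erase 0).image fun γ => (x, cubeFlip c (emb γ)), ?_, ?_⟩
    · rw [Finset.card_image_of_injective _ hinj, Finset.card_erase_of_mem (Finset.mem_univ _),
        Finset.card_univ]
      omega
    · intro b hb
      obtain ⟨γ, hγ, rfl⟩ := Finset.mem_image.1 hb
      have hγ0 := Finset.ne_of_mem_erase hγ
      have e1 : cubeWeight g (cubeFlip c (emb γ)) = γ := by
        rw [cubeWeight_cubeFlip h2, hg, hc, zero_add]
      refine ⟨fun h => hγ0 (e1.symm.trans h.1), ?_⟩
      rw [hasg]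
      · simp only [e1, cubeFlip_cubeFlip]
      · simp only
        rw [ws, add_assoc, h2', add_zero]
        exact hx
  · refine fun c l => IsHubPath.length_le_of_cubeHub ?_ c l
    intro t l hl hlZ
    have h1 : (z t :: l).Nodup := List.nodup_cons.2 ⟨fun h => hlZ _ h rfl, hl⟩
    have h3 := h1.length_le_card
    rw [Fintype.card_fun, Fintype.card_bool, Fintype.card_fin, List.length_cons] at h3
    omega
  · exact fun h _ T => card_le_of_adj_of_snd_eq hnK h T
  · rintro ⟨x, c⟩ ⟨hc, hx⟩
    obtain ⟨l, l1, l2, l3, l4⟩ := hgood (cubeWeight s c) (cubeFlip (z (cubeWeight s c)) 0) (by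
      rw [cubeParity_cubeFlip, hz]; simp)
    have hl := isHubPath_cubeHub (Z := fun t => {z t}) hc l1 l2 fun y hy => (l3 y).1 hy
    obtain ⟨l', hl', hlen⟩ := hl.exists_half (h := (x, c)) (List.mem_map_of_mem ((l3 x).2 hx))
    refine ⟨l', hl', ?_⟩
    rw [List.length_map, l4, pow_succ] at hlen
    have := Nat.one_le_two_pow (n := n)
    omega
  · have strong : ∀ x c, cubeParity x = cubeWeight s c →
        ∃ h, cubeAsg f (x, c) = some h ∧ ∃ l, IsHubPath (cubeGraph (Fin (n + 1)) □ cubeGraph I)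
          (cubeHub g s fun t => {z t}) Prod.snd h.2 (h :: l) ∧
          (h :: l).length = 2 ^ (n + 1) - 1 := by
      intro x c h
      refine ⟨_, hasg _ (hstrong x c h), hpath _ (hhub _ (hstrong x c h)) ?_⟩
      simp only
      rw [ws, h]
      simp
    rintro ⟨x, c⟩ ⟨x', c'⟩ _ _ hadj
    by_cases hx : cubeParity x = cubeWeight s c
    · obtain ⟨h, h1, h3⟩ := strong x c hx
      exact ⟨_, _, Or.inr ⟨rfl, rfl⟩, h, h1, h3, False.elim⟩
    · have hx' : cubeParity x' = cubeWeight s c' := by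
        rw [boxProd_adj] at hadj
        rcases hadj with ⟨⟨i, h⟩, rfl : c = c'⟩ | ⟨⟨i, h⟩, rfl : x = x'⟩ <;> simp only at h <;>
          subst h
        · rw [cubeParity_cubeFlip]
          exact (two _ _).1 hx
        · rw [ws]
          exact ((two _ _).1 (Ne.symm hx)).symm
      obtain ⟨h, h1, h3⟩ := strong x' c' hx'
      exact ⟨_, _, Or.inl ⟨rfl, rfl⟩, h, h1, h3, False.elim⟩
  · rintro ⟨x, c⟩ ⟨x', c'⟩ hu hh hadj hne
    rw [boxProd_adj] at hadj
    by_cases hx : cubeParity x = cubeWeight s c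
    · have hst := hstrong x c hx
      refine ⟨hpath _ hh ?_, _, hasg _ hst, ?_⟩
      · simp only
        rcases hadj with ⟨⟨i, h⟩, rfl : c = c'⟩ | ⟨⟨i, h⟩, rfl : x = x'⟩ <;> simp only at h <;>
          subst h
        · rw [cubeParity_cubeFlip, hx]; simp
        · rw [ws, hx]; simp
      · simp only
        rw [hasg _ hst] at hne
        rcases hadj with ⟨h, rfl : c = c'⟩ | ⟨⟨i, h⟩, rfl : x = x'⟩
        · exact cubeFlip_ne _ _
        · intro heq
          exact hne (by rw [heq])
    · have hg0 : cubeWeight g c ≠ 0 := fun h0 => hu ⟨h0, by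
        rintro (rfl : x = z (cubeWeight s c))
        exact hx (hz _)⟩
      rcases hadj with ⟨h, rfl : c = c'⟩ | ⟨⟨i, h⟩, rfl : x = x'⟩
      · exact (hg0 hh.1).elim
      · simp only at h
        subst h
        obtain ⟨hh1, hh2⟩ := hh
        simp only at hh1 hh2
        rw [cubeWeight_cubeFlip h2] at hh1
        rw [ws] at hh2
        have hgi : g i = cubeWeight g c := by
          rw [add_comm] at hh1
          rw [eq_neg_of_add_eq_zero_left hh1, ← eq_neg_of_add_eq_zero_left (h2 _)]
        refine (hne ?_).elim
        rw [hasg (x, c) hh2]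
        simp only
        rw [← hgi, hg' i (hgi ▸ hg0)]

end CubeHub

/-- The product of isomorphic graphs with a fixed graph. -/
def boxProdCongrLeft {V V' W : Type*} {G : SimpleGraph V} {G' : SimpleGraph V'} (e : G ≃g G')
    (H : SimpleGraph W) : (G □ H) ≃g (G' □ H) where
  toEquiv := e.toEquiv.prodCongr (Equiv.refl W)
  map_rel_iff' := by
    rintro ⟨a, b⟩ ⟨c, d⟩
    simp [boxProd_adj, e.map_adj_iff]

lemma satNum_hypercube_le {W : Type*} {G : SimpleGraph W} {a d f K : ℕ} (ha : 1 ≤ a)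
    (h : ∃ H, IsSat ((cubeGraph (Fin a) □ cubeGraph (Fin d)) □ cubeGraph (Fin f)) H G ∧
      2 * H.edgeSet.ncard ≤ K * Fintype.card (((Fin a → Bool) × (Fin d → Bool)) × (Fin f → Bool))) :
    satNum (hypercube (a + d + f)) G ≤ K * 2 ^ (a + d + f - 1) := by
  obtain ⟨H, hH, hcard⟩ := h
  have e : (Fin a ⊕ Fin d) ⊕ Fin f ≃ Fin (a + d + f) :=
    (finSumFinEquiv.sumCongr (Equiv.refl _)).trans finSumFinEquiv
  have φ := ((cubeGraphCongr e).trans cubeGraphSum).trans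
    (boxProdCongrLeft cubeGraphSum (cubeGraph (Fin f)))
  rw [hypercube_eq_cubeGraph]
  refine (satNum_le_of_iso φ hH).trans ?_
  simp only [Fintype.card_prod, Fintype.card_fun, Fintype.card_bool, Fintype.card_fin,
    ← pow_add] at hcard
  obtain ⟨n, hn⟩ : ∃ n, a + d + f = n + 1 := ⟨a + d + f - 1, by omega⟩
  rw [hn, pow_succ, ← mul_assoc] at hcard
  rw [hn, Nat.add_sub_cancel]
  omega

/-- Disjoint copies of a triangle-free regular graph are saturated for some caterpillars with three
spine vertices. -/
lemma exists_isSat_of_isRegularOfDegree {B Y : Type*} [Fintype B] [Fintype Y] (Q : SimpleGraph B)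
    {F : SimpleGraph Y} [DecidableRel F.Adj] {K : ℕ} {k : ℕ → ℕ} (hK : 2 ≤ K)
    (hF : F.IsRegularOfDegree (K - 1)) (htri : ∀ x y z, F.Adj x y → F.Adj x z → ¬ F.Adj y z)
    (h0 : k 0 ≤ K) (h1 : k 1 = K) (h2 : k 2 < K) :
    ∃ H, IsSat (Q □ F) H (caterpillar 3 k) ∧ 2 * H.edgeSet.ncard ≤ K * Fintype.card (B × Y) := by
  classical
  have hadj : ∀ v w : B × Y, ((⊥ : SimpleGraph B) □ F).Adj v w ↔ F.Adj v.2 w.2 ∧ v.1 = w.1 := by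
    simp [boxProd_adj]
  have hdeg : ∀ v [Fintype (((⊥ : SimpleGraph B) □ F).neighborSet v)],
      ((⊥ : SimpleGraph B) □ F).degree v = K - 1 := by
    intro v _
    rw [degree_boxProd, bot_degree, hF, zero_add]
  refine ⟨(⊥ : SimpleGraph B) □ F, ⟨?_, ?_, ?_⟩, ?_⟩
  · intro v w h
    exact boxProd_adj.2 (Or.inr ((hadj v w).1 h))
  · intro h
    obtain ⟨s, -, -, h⟩ := h.exists_spine
    have := h 1
    rw [hdeg] at this
    simp only [Fin.val_one] at this
    omega
  · rintro ⟨b, y⟩ ⟨c, y'⟩ hQ hn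
    rw [hadj] at hn
    rw [boxProd_adj] at hQ
    obtain ⟨hbc, rfl : y = y'⟩ := hQ.resolve_right hn
    have hne : b ≠ c := hbc.ne
    obtain ⟨z, hz⟩ : ∃ z, F.Adj y z := by
      rw [← degree_pos_iff_exists_adj, hF]
      omega
    let l : List (B × Y) := [(b, y), (c, y), (c, z)]
    let L : B × Y → Finset (B × Y) := fun v =>
      ((F.neighborFinset v.2).image fun x => (v.1, x)) \ l.toFinset
    have hmem : ∀ v x, x ∈ L v ↔ (F.Adj v.2 x.2 ∧ v.1 = x.1) ∧ x ∉ l := by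
      rintro v ⟨x1, x2⟩
      simp only [L, Finset.mem_sdiff, List.mem_toFinset, Finset.mem_image, mem_neighborFinset,
        Prod.mk.injEq]
      aesop
    have hcard : ∀ v (T : Finset Y), (∀ x ∈ T, F.Adj v.2 x ∧ (v.1, x) ∉ l) →
        T.card ≤ (L v).card := by
      intro v T hT
      rw [← Finset.card_image_of_injective T (Prod.mk_right_injective v.1)]
      refine Finset.card_le_card fun x hx => ?_
      obtain ⟨t, ht, rfl⟩ := Finset.mem_image.1 hx
      exact (hmem _ _).2 ⟨⟨(hT t ht).1, rfl⟩, (hT t ht).2⟩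
    have hc := fun x => (card_neighborFinset_eq_degree F x).trans (hF x)
    refine hasCopy_caterpillar_of_list l rfl ?_ ?_ L ?_ ?_ ?_
    · simp [l, hne, hz.ne]
    · simp [l, hz, hne]
    · intro w _ x hx
      rw [hmem] at hx
      exact ⟨Or.inl ((hadj _ _).2 hx.1), hx.2⟩
    · intro w hw w' hw' x hx hx'
      rw [hmem] at hx hx'
      have e1 : w.1 = w'.1 := hx.1.2.trans hx'.1.2.symm
      have e2 := htri x.2 w.2 w'.2 hx.1.1.symm hx'.1.1.symm
      have e3 : ¬ F.Adj w'.2 w.2 := fun h => e2 h.symm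
      simp only [l, List.mem_cons, List.not_mem_nil, or_false] at hw hw'
      rcases hw with rfl | rfl | rfl <;> rcases hw' with rfl | rfl | rfl <;> simp_all
    · intro j hj
      simp only [l, List.length_cons, List.length_nil] at hj
      interval_cases j
      · have := hcard (b, y) (F.neighborFinset y) (by
          simp [l, hne]
          exact fun x h => ⟨h, h.ne'⟩)
        rw [hc] at this
        change k 0 - 1 ≤ _
        exact (by omega : k 0 - 1 ≤ K - 1).trans this
      · have := hcard (c, y) ((F.neighborFinset y).erase z) (by
          simp [l, hne.symm]
          exact fun x h h' => ⟨h', h'.ne', h⟩)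
        rw [Finset.card_erase_of_mem ((mem_neighborFinset _ _ _).2 hz), hc] at this
        change k 1 - 2 ≤ _
        exact (by omega : k 1 - 2 ≤ K - 1 - 1).trans this
      · have := hcard (c, z) ((F.neighborFinset z).erase y) (by
          simp [l, hne.symm]
          exact fun x h h' => ⟨h', h, h'.ne'⟩)
        rw [Finset.card_erase_of_mem ((mem_neighborFinset _ _ _).2 hz.symm), hc] at this
        change k 2 - 1 ≤ _
        exact (by omega : k 2 - 1 ≤ K - 1 - 1).trans this
  · rw [Set.ncard_eq_toFinset_card', ← edgeFinset, ← sum_degrees_eq_twice_card_edges]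
    simp only [hdeg]
    rw [Finset.sum_const, smul_eq_mul, Finset.card_univ, mul_comm]
    exact Nat.mul_le_mul_right _ (by omega)

lemma exists_forall_satNum_le {a p r m M K : ℕ} {k : ℕ → ℕ} {strict : Prop} (ha : 1 ≤ a)
    (P : CaterpillarParams m k p r M K) (hstrict : k 0 = K → strict)
    (S : ∃ d₀, ∀ d ≥ d₀, ∃ hub asg, HubSystem (cubeGraph (Fin a) □ cubeGraph (Fin d)) p r M K strict
      hub Prod.snd asg) :
    ∃ N, ∀ n ≥ N, satNum (hypercube n) (caterpillar m k) ≤ K * 2 ^ (n - 1) := by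
  classical
  obtain ⟨d₀, hd₀⟩ := S
  refine ⟨a + d₀ + (K - 2), fun n hn => ?_⟩
  obtain ⟨d, hd, rfl⟩ : ∃ d ≥ d₀, n = a + d + (K - 2) := ⟨n - a - (K - 2), by omega, by omega⟩
  obtain ⟨hub, asg, S⟩ := hd₀ d hd
  refine satNum_hypercube_le ha (S.exists_isSat P hstrict ?_)
  simpa using cubeGraph_isRegularOfDegree (ι := Fin (K - 2))

lemma lt_card_fun_zmod_two (M : ℕ) : M < Fintype.card (Fin M → ZMod 2) := by
  simpa using M.lt_two_pow_self

lemma fun_zmod_two_add_self {M : ℕ} (x : Fin M → ZMod 2) : x + x = 0 :=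
  funext fun _ => CharTwo.add_self_eq_zero _

lemma exists_hubSystem_of_forall_path {a p K : ℕ} (M : ℕ) {Z : ZMod 2 → Set (Fin a → Bool)}
    (haK : a ≤ K) (disj : ∀ t x, x ∈ Z t → x ∉ Z (t + 1))
    (path : ∀ t x, x ∉ Z t → ∃ l, (x :: l).Nodup ∧ (x :: l).IsChain (cubeGraph (Fin a)).Adj ∧
      (∀ y, y ∈ x :: l ↔ y ∉ Z t) ∧ (x :: l).length = p) :
    ∃ d₀, ∀ d ≥ d₀, ∃ hub asg, HubSystem (cubeGraph (Fin a) □ cubeGraph (Fin d)) p p M K True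
      hub Prod.snd asg := by
  refine ⟨Fintype.card ((Fin M → ZMod 2) × ZMod 2 × ZMod 2), fun d hd => ?_⟩
  obtain ⟨emb⟩ := Function.Embedding.nonempty_of_card_le
    (α := (Fin M → ZMod 2) × ZMod 2 × ZMod 2) (β := Fin d) (by simpa using hd)
  obtain ⟨f, hf⟩ := hubSystem_of_forall_path (g := Function.extend emb Prod.fst 0)
    (s := Function.extend emb (fun x => x.2.2) 0) fun_zmod_two_add_self (lt_card_fun_zmod_two M)
    haK disj path emb emb.injective (fun x => emb.injective.extend_apply _ _ x)
    (fun x => emb.injective.extend_apply _ _ x)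
  exact ⟨_, _, hf⟩

lemma exists_hubSystem_of_puncture {n K : ℕ} (M : ℕ) (hnK : n + 1 ≤ K) :
    ∃ d₀, ∀ d ≥ d₀, ∃ hub asg, HubSystem (cubeGraph (Fin (n + 1)) □ cubeGraph (Fin d))
      (2 ^ (n + 1) - 1) (2 ^ n) M K False hub Prod.snd asg := by
  refine ⟨Fintype.card (Fin M → ZMod 2), fun d hd => ?_⟩
  obtain ⟨emb⟩ := Function.Embedding.nonempty_of_card_le
    (α := Fin M → ZMod 2) (β := Fin d) (by simpa using hd)
  have hz : ∀ t : ZMod 2, cubeParity (cubeCons (decide (t = 1)) fun _ : Fin n => false) = t := by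
    have h0 : cubeParity (fun _ : Fin n => false) = 0 := by simp [cubeParity, cubeWeight]
    intro t
    rw [cubeParity_cons, h0]
    revert t
    decide
  have hg : ∀ i, Function.extend emb id 0 i ≠ 0 → emb (Function.extend emb id 0 i) = i := by
    intro i hi
    by_cases h : ∃ x, emb x = i
    · obtain ⟨x, rfl⟩ := h
      rw [emb.injective.extend_apply]
      rfl
    · exact (hi (Function.extend_apply' _ _ _ h)).elim
  obtain ⟨f, hf⟩ := hubSystem_of_puncture (g := Function.extend emb id 0) (s := fun _ => 1)
    fun_zmod_two_add_self (lt_card_fun_zmod_two M) hnK _ hz emb emb.injective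
    (fun x => emb.injective.extend_apply _ _ x) hg (fun _ => rfl)
  exact ⟨_, _, hf⟩

/-- The bound for a caterpillar whose first two degrees attain the minimum. -/
lemma exists_forall_satNum_le_of_first {m a K : ℕ} {k : ℕ → ℕ} (ha : 1 ≤ a) (hm : m = 2 ^ a + 1)
    (hK : 2 ≤ K) (haK : a ≤ K) (first : k 0 ≤ K) (second : k 1 ≤ K)
    (adjacent : ∀ t, t + 1 < m → K ≤ max (k t) (k (t + 1)))
    (hcase : K ≤ k (m - 1) ∨ 2 ≤ a) :
    ∃ N, ∀ n ≥ N, satNum (hypercube n) (caterpillar m k) ≤ K * 2 ^ (n - 1) := by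
  obtain ⟨n, rfl⟩ : ∃ n, a = n + 1 := ⟨a - 1, by omega⟩
  let M := m + ∑ j ∈ Finset.range m, k j + 1
  have many : ∀ j < m, m + k j < M := fun j hj => by
    have := Finset.single_le_sum (f := k) (fun _ _ => Nat.zero_le _) (Finset.mem_range.2 hj)
    omega
  have hpow : 2 ^ (n + 1) = 2 * 2 ^ n := pow_succ' 2 n
  have hpos := Nat.one_le_two_pow (n := n)
  by_cases hlast : k (m - 1) < K
  · obtain ⟨n, rfl⟩ : ∃ n', n = n' + 1 := ⟨n - 1, by omega⟩
    have hpow' : 2 ^ (n + 2) = 2 * (2 * 2 ^ n) := by ring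
    have hpos' := Nat.one_le_two_pow (n := n)
    refine exists_forall_satNum_le ha (p := 2 ^ (n + 2) - 2) (r := 2 ^ (n + 2) - 2) (M := M)
      ⟨hK, by omega, by omega, ?_, ?_, ?_, first, second, adjacent, many⟩ (fun _ => trivial)
      (exists_hubSystem_of_forall_path M
        (Z := fun t => {x | Fin.tail x = fun _ => decide (t = 1)}) haK ?_ ?_)
    · rw [if_pos hlast]; split_ifs <;> omega
    · rw [if_pos hlast]; omega
    · rw [if_pos hlast]; split_ifs <;> omega
    · intro t x (hx : Fin.tail x = _) (hx' : Fin.tail x = _)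
      have key : ∀ t : ZMod 2, decide (t = 1) ≠ decide (t + 1 = 1) := by decide
      exact key t (congrFun (hx.symm.trans hx') 0)
    · exact fun t x hx => exists_path_tail_ne _ x hx
  · by_cases hfirst : k 0 < K
    · refine exists_forall_satNum_le ha (M := M)
        ⟨hK, by omega, by omega, ?_, ?_, ?_, first, second, adjacent, many⟩ (by omega)
        (exists_hubSystem_of_puncture M haK) <;>
      simp only [if_pos hfirst, if_neg hlast] <;> omega
    · refine exists_forall_satNum_le ha (p := 2 ^ (n + 1)) (r := 2 ^ (n + 1)) (M := M)
        ⟨hK, by omega, by omega, ?_, ?_, ?_, first, second, adjacent, many⟩ (fun _ => trivial)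
        (exists_hubSystem_of_forall_path M (Z := fun _ => ∅) haK (fun _ _ h => h.elim) ?_)
      · simp only [if_neg hfirst, if_neg hlast]; omega
      · simp only [if_neg hlast]; omega
      · simp only [if_neg hfirst, if_neg hlast]; omega
      · intro _ x _
        obtain ⟨l, hl⟩ := exists_isHamPath_cubeGraph (n + 1) x (cubeFlip x 0)
          (by rw [cubeParity_cubeFlip]; simp)
        obtain ⟨l, rfl⟩ : ∃ l', l = x :: l' := by
          have := hl.head
          rcases l with _ | ⟨y, l⟩
          · simp at this
          · exact ⟨l, by simpa using this⟩
        exact ⟨l, hl.nodup, hl.chain, fun y => ⟨fun _ h => h, fun _ => hl.mem y⟩,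
          by simpa using hl.length_eq⟩

lemma exists_forall_satNum_le_of_three {K : ℕ} {k : ℕ → ℕ} (hK : 2 ≤ K) (h0 : k 0 ≤ K)
    (h1 : k 1 = K) (h2 : k 2 < K) :
    ∃ N, ∀ n ≥ N, satNum (hypercube n) (caterpillar 3 k) ≤ K * 2 ^ (n - 1) := by
  classical
  refine ⟨1 + 0 + (K - 1), fun n hn => ?_⟩
  obtain ⟨d, rfl⟩ : ∃ d, n = 1 + d + (K - 1) := ⟨n - 1 - (K - 1), by omega⟩
  refine satNum_hypercube_le le_rfl (exists_isSat_of_isRegularOfDegree _ hK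
    (by simpa using cubeGraph_isRegularOfDegree (ι := Fin (K - 1))) ?_ h0 h1 h2)
  intro x y z hxy hxz hyz
  have key : ∀ p q r : ZMod 2, p ≠ q → p ≠ r → q ≠ r → False := by decide
  exact key _ _ _ (cubeParity_ne_of_adj hxy) (cubeParity_ne_of_adj hxz) (cubeParity_ne_of_adj hyz)

lemma satNum_caterpillar_reverse {V : Type*} (Q : SimpleGraph V) (m : ℕ) (k : ℕ → ℕ) :
    satNum Q (caterpillar m fun j => k (m - 1 - j)) = satNum Q (caterpillar m k) := by
  have key : ∀ H : SimpleGraph V,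
      HasCopy H (caterpillar m fun j => k (m - 1 - j)) ↔ HasCopy H (caterpillar m k) := fun H =>
    ⟨HasCopy.reverse fun j hj => by congr 1; omega, HasCopy.reverse fun _ _ => rfl⟩
  simp only [satNum, IsSat, key]

lemma exists_forall_satNum_le_caterpillar {m a K : ℕ} {k : ℕ → ℕ} (ha : 1 ≤ a)
    (hm : m = 2 ^ a + 1) (hK : 2 ≤ K) (haK : a ≤ K) (hmax : max (k 0) (k 1) = K)
    (adjacent : ∀ t, t + 1 < m → K ≤ max (k t) (k (t + 1))) :
    ∃ N, ∀ n ≥ N, satNum (hypercube n) (caterpillar m k) ≤ K * 2 ^ (n - 1) := by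
  by_cases hcase : K ≤ k (m - 1) ∨ 2 ≤ a
  · exact exists_forall_satNum_le_of_first ha hm hK haK (by omega) (by omega) adjacent hcase
  · obtain rfl : a = 1 := by omega
    obtain rfl : m = 3 := by omega
    simp only [Nat.add_one_sub_one] at hcase
    have h1 : K ≤ max (k 1) (k 2) := adjacent 1 (by omega)
    by_cases h0 : k 0 = K
    · have := exists_forall_satNum_le_of_first (k := fun j => k (3 - 1 - j)) ha hm hK haK
        (by change k 2 ≤ K; omega) (by change k 1 ≤ K; omega) ?_ (Or.inl (by simp [h0]))
      · simpa only [satNum_caterpillar_reverse] using this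
      · intro t ht
        obtain rfl | rfl : t = 0 ∨ t = 1 := by omega
        · change K ≤ max (k 2) (k 1); omega
        · change K ≤ max (k 1) (k 0); omega
    · exact exists_forall_satNum_le_of_three hK (by omega) (by omega) (by omega)

/-- upper bound on the saturation number of a caterpillar
`S_{k_1×⋯×k_m}` with `m = 2^a + 1`, when the adjacent pair minimizing
`max(k_t, k_{t+1})` occurs at `i = 1` or `i = m-1` (1-based; in 0-based terms
the pair is `(k (i-1), k i)`), and `max(k_i, k_{i+1}) ≥ a`. -/
theorem stmt7 (m a : ℕ) (ha : 1 ≤ a) (hm : m = 2 ^ a + 1) (k : ℕ → ℕ)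
    (hdeg : ∀ t < m, 2 ≤ k t)
    (i : ℕ) (hi : i = 1 ∨ i = m - 1)
    (hmin : ∀ t, 1 ≤ t → t ≤ m - 1 →
      max (k (i - 1)) (k i) ≤ max (k (t - 1)) (k t))
    (hbig : a ≤ max (k (i - 1)) (k i)) :
    ∃ N : ℕ, ∀ n ≥ N,
      satNum (hypercube n) (caterpillar m k) ≤ max (k (i - 1)) (k i) * 2 ^ (n - 1) := by
  have hm3 : 3 ≤ m := by
    have := Nat.pow_le_pow_right (n := 2) (by norm_num) ha
    omega
  have hK : 2 ≤ max (k (i - 1)) (k i) := (hdeg i (by omega)).trans (le_max_right _ _)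
  rcases hi with rfl | rfl
  · exact exists_forall_satNum_le_caterpillar ha hm hK hbig rfl fun t ht =>
      hmin (t + 1) (by omega) (by omega)
  · have := exists_forall_satNum_le_caterpillar (k := fun j => k (m - 1 - j)) ha hm hK hbig
      (by simp only [Nat.sub_zero]; rw [max_comm]) ?_
    · simpa only [satNum_caterpillar_reverse] using this
    · intro t ht
      have := hmin (m - 1 - t) (by omega) (by omega)
      rw [max_comm (k (m - 1 - t)), ← Nat.sub_sub]
      exact this
end
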